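/- arXiv:2409.19353 — 3 statements merged into one kernel-verified Lean document; each statement's English description precedes it below -/
import Mathlib

section
/- For every n ≥ 1 and every 1 < p < ∞ there exists a constant δ > 0, depending only on n and p, such that for every compactly supported continuously differentiable function f : ℂⁿ → ℂ one has δ·‖|∂f|‖_{L^p(ℂⁿ)} ≤ ‖|∂̄f|‖_{L^p(ℂⁿ)}, i.e. δ·(∫_{ℂⁿ} (∑ⱼ₌₁ⁿ |∂f/∂z_j|²)^{p/2} dV)^{1/p} ≤ (∫_{ℂⁿ} (∑ⱼ₌₁ⁿ |∂f/∂z̄_j|²)^{p/2} dV)^{1/p}. (Lemma 1.13.) -/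
open Metric MeasureTheory

noncomputable instance (n : ℕ) : MeasurableSpace (EuclideanSpace ℂ (Fin n)) := borel _
instance (n : ℕ) : BorelSpace (EuclideanSpace ℂ (Fin n)) := ⟨rfl⟩

/-- The Wirtinger derivative `∂f/∂z_j = ½(∂f/∂x_j − i ∂f/∂y_j)`. -/
noncomputable def wirtingerD (n : ℕ) (f : EuclideanSpace ℂ (Fin n) → ℂ)
    (z : EuclideanSpace ℂ (Fin n)) (j : Fin n) : ℂ :=
  (1 / 2 : ℂ) * (fderiv ℝ f z (EuclideanSpace.single j 1)
    - Complex.I * fderiv ℝ f z (EuclideanSpace.single j Complex.I))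

/-- The conjugate Wirtinger derivative `∂f/∂z̄_j = ½(∂f/∂x_j + i ∂f/∂y_j)`. -/
noncomputable def wirtingerDBar (n : ℕ) (f : EuclideanSpace ℂ (Fin n) → ℂ)
    (z : EuclideanSpace ℂ (Fin n)) (j : Fin n) : ℂ :=
  (1 / 2 : ℂ) * (fderiv ℝ f z (EuclideanSpace.single j 1)
    + Complex.I * fderiv ℝ f z (EuclideanSpace.single j Complex.I))

/-! ### The Bellman function -/

/-- `m = s^r + τ` -/
noncomputable def bM (r s τ : ℝ) : ℝ := s ^ r + τ
noncomputable def bE (r : ℝ) : ℝ := (1 - r⁻¹) / 2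
noncomputable def bK (r : ℝ) : ℝ := (2 * r ^ 2 + 1 - r⁻¹) / (r⁻¹ * (1 + r⁻¹))

noncomputable def bP (r s τ : ℝ) : ℝ :=
  s * bM r s τ ^ bE r + bK r * τ ^ ((1 + r⁻¹) / 2)
noncomputable def bPs (r s τ : ℝ) : ℝ :=
  bM r s τ ^ bE r + (r - 1) / 2 * (s ^ r * bM r s τ ^ (bE r - 1))
noncomputable def bPt (r s τ : ℝ) : ℝ :=
  bE r * (s * bM r s τ ^ (bE r - 1)) + bK r * ((1 + r⁻¹) / 2) * τ ^ ((1 + r⁻¹) / 2 - 1)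
noncomputable def bPss (r s τ : ℝ) : ℝ :=
  (r - 1) / 2 * ((1 + r) * (s ^ (r - 1) * bM r s τ ^ (bE r - 1))
    + (bE r - 1) * r * (s ^ r * s ^ (r - 1) * bM r s τ ^ (bE r - 1 - 1)))
noncomputable def bPst (r s τ : ℝ) : ℝ :=
  bE r * bM r s τ ^ (bE r - 1)
    + (r - 1) / 2 * ((bE r - 1) * (s ^ r * bM r s τ ^ (bE r - 1 - 1)))
noncomputable def bPtt (r s τ : ℝ) : ℝ :=
  bE r * (bE r - 1) * (s * bM r s τ ^ (bE r - 1 - 1))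
    + bK r * ((1 + r⁻¹) / 2) * ((1 + r⁻¹) / 2 - 1) * τ ^ ((1 + r⁻¹) / 2 - 1 - 1)

lemma bM_pos {r s τ : ℝ} (hs : 0 < s) (hτ : 0 < τ) : 0 < bM r s τ := by
  unfold bM; positivity

lemma bM_hasDerivAt {r : ℝ} {s τ : ℝ → ℝ} {s' τ' x : ℝ} (hs : HasDerivAt s s' x)
    (hτ : HasDerivAt τ τ' x) (s0 : 0 < s x) :
    HasDerivAt (fun x => bM r (s x) (τ x)) (s' * r * s x ^ (r - 1) + τ') x := by
  unfold bM
  exact (hs.rpow_const (Or.inl s0.ne')).add hτ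

lemma bE_mul {r : ℝ} (hr : 1 ≤ r) : bE r * r = (r - 1) / 2 := by
  have : r ≠ 0 := by positivity
  unfold bE; field_simp

lemma bP_hasDerivAt {r : ℝ} (hr : 1 ≤ r) {s τ : ℝ → ℝ} {s' τ' x : ℝ} (hs : HasDerivAt s s' x)
    (hτ : HasDerivAt τ τ' x) (s0 : 0 < s x) (τ0 : 0 < τ x) :
    HasDerivAt (fun x => bP r (s x) (τ x))
      (bPs r (s x) (τ x) * s' + bPt r (s x) (τ x) * τ') x := by
  have hM := bM_hasDerivAt (r := r) hs hτ s0
  have h1 := hM.rpow_const (p := bE r) (Or.inl (bM_pos s0 τ0).ne')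
  have h2 := hτ.rpow_const (p := (1 + r⁻¹) / 2) (Or.inl τ0.ne')
  have h3 := (hs.mul h1).add (h2.const_mul (bK r))
  unfold bP
  refine h3.congr_deriv ?_
  unfold bPs bPt
  have e1 : s x ^ r = s x * s x ^ (r - 1) := by
    rw [Real.rpow_sub_one s0.ne']; field_simp
  rw [← bE_mul hr, e1]
  ring

lemma bPs_hasDerivAt {r : ℝ} (hr : 1 ≤ r) {s τ : ℝ → ℝ} {s' τ' x : ℝ} (hs : HasDerivAt s s' x)
    (hτ : HasDerivAt τ τ' x) (s0 : 0 < s x) (τ0 : 0 < τ x) :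
    HasDerivAt (fun x => bPs r (s x) (τ x))
      (bPss r (s x) (τ x) * s' + bPst r (s x) (τ x) * τ') x := by
  have hM := bM_hasDerivAt (r := r) hs hτ s0
  have h1 := hM.rpow_const (p := bE r) (Or.inl (bM_pos s0 τ0).ne')
  have h1' := hM.rpow_const (p := bE r - 1) (Or.inl (bM_pos s0 τ0).ne')
  have h2 := hs.rpow_const (p := r) (Or.inl s0.ne')
  have h3 := h1.add ((h2.mul h1').const_mul ((r - 1) / 2))
  unfold bPs
  refine h3.congr_deriv ?_
  unfold bPss bPst
  have : s' * r * s x ^ (r - 1) * bE r = s' * s x ^ (r - 1) * ((r - 1) / 2) := by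
    rw [← bE_mul hr]; ring
  linear_combination (bM r (s x) (τ x) ^ (bE r - 1)) * this

lemma bPt_hasDerivAt {r : ℝ} (hr : 1 ≤ r) {s τ : ℝ → ℝ} {s' τ' x : ℝ} (hs : HasDerivAt s s' x)
    (hτ : HasDerivAt τ τ' x) (s0 : 0 < s x) (τ0 : 0 < τ x) :
    HasDerivAt (fun x => bPt r (s x) (τ x))
      (bPst r (s x) (τ x) * s' + bPtt r (s x) (τ x) * τ') x := by
  have hM := bM_hasDerivAt (r := r) hs hτ s0
  have h1' := hM.rpow_const (p := bE r - 1) (Or.inl (bM_pos s0 τ0).ne')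
  have h2 := hτ.rpow_const (p := (1 + r⁻¹) / 2 - 1) (Or.inl τ0.ne')
  have h3 := ((hs.mul h1').const_mul (bE r)).add (h2.const_mul (bK r * ((1 + r⁻¹) / 2)))
  unfold bPt
  refine h3.congr_deriv ?_
  unfold bPst bPtt
  have e1 : s x ^ r = s x * s x ^ (r - 1) := by
    rw [Real.rpow_sub_one s0.ne']; field_simp
  rw [e1, ← bE_mul hr]
  ring

set_option maxHeartbeats 1600000 in
lemma bellman_pointwise {r : ℝ} (hr : 1 ≤ r) {s τ A D x1 x2 y1 y2 : ℝ} (s0 : 0 < s) (τ0 : 0 < τ)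
    (hA : 0 ≤ A) (hD : 0 ≤ D)
    (hx : x1 ^ 2 + x2 ^ 2 ≤ 4 * s * A ^ 2) (hy : y1 ^ 2 + y2 ^ 2 ≤ 4 * τ * D ^ 2) :
    4 * (A * D) ≤ 2 * bPs r s τ * A ^ 2 + 2 * bPt r s τ * D ^ 2
      + bPss r s τ * (x1 ^ 2 + x2 ^ 2) + 2 * bPst r s τ * (x1 * y1 + x2 * y2)
      + bPtt r s τ * (y1 ^ 2 + y2 ^ 2) := by
  have r0 : 0 < r := by linarith
  have c0 : 0 < r⁻¹ := by positivity
  have c1 : r⁻¹ ≤ 1 := inv_le_one_of_one_le₀ hr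
  have hrc : r * r⁻¹ = 1 := mul_inv_cancel₀ r0.ne'
  have m0 := bM_pos (r := r) s0 τ0
  set m := bM r s τ with hm
  set c := r⁻¹ with hc
  have he : bE r = (1 - c) / 2 := rfl
  have hsr : s ^ r ≤ m := by rw [hm, bM]; linarith
  have hτm : τ ≤ m := by rw [hm, bM]; have := Real.rpow_pos_of_pos s0 r; linarith
  have sr0 := Real.rpow_pos_of_pos s0 r
  have hsm : s ≤ m ^ c := by
    have := Real.rpow_le_rpow sr0.le hsr c0.le
    rwa [← Real.rpow_mul s0.le, hrc, Real.rpow_one] at this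
  -- powers of m
  set N := m ^ bE r with hN
  have N0 : 0 < N := Real.rpow_pos_of_pos m0 _
  have hE1 : m ^ (bE r - 1) = N / m := by rw [Real.rpow_sub_one m0.ne']
  have hE2 : m ^ (bE r - 1 - 1) = N / m / m := by
    rw [Real.rpow_sub_one m0.ne', Real.rpow_sub_one m0.ne']
  have hmc : m ^ c = m / N ^ 2 := by
    rw [hN, ← Real.rpow_natCast, ← Real.rpow_mul m0.le, he]
    rw [show ((1 - c) / 2 * ((2:ℕ):ℝ)) = 1 - c by push_cast; ring]
    rw [Real.rpow_sub m0, Real.rpow_one]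
    have := Real.rpow_pos_of_pos m0 c
    field_simp
  have hsN : s * N ^ 2 ≤ m := by
    rw [hmc] at hsm
    rwa [le_div_iff₀ (by positivity)] at hsm
  have hy01 : s ^ r / m ≤ 1 := by rw [div_le_one m0]; exact hsr
  have hy00 : 0 ≤ s ^ r / m := by positivity
  set Y := s ^ r / m with hY
  -- Ps
  have hPs : N ≤ bPs r s τ := by
    unfold bPs
    rw [← hm, hE1]
    have : 0 ≤ (r - 1) / 2 * (s ^ r * (N / m)) := by
      have : 0 ≤ r - 1 := by linarith
      positivity
    linarith
  -- Pss
  have her : (bE r - 1) * r = -(r + 1) / 2 := by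
    rw [sub_mul, bE_mul hr]; ring
  have hPss : 0 ≤ bPss r s τ := by
    unfold bPss
    rw [← hm, hE1, hE2, her]
    have h1 : 0 ≤ r - 1 := by linarith
    have : (1 + r) * (s ^ (r - 1) * (N / m)) + -(r + 1) / 2 * (s ^ r * s ^ (r - 1) * (N / m / m))
      = (1 + r) * (s ^ (r - 1) * (N / m)) * (1 - Y / 2) := by
      rw [hY]; field_simp; ring
    rw [this]
    have h2 : 0 ≤ 1 - Y / 2 := by linarith
    positivity
  -- Pst
  have hPst : bPst r s τ = bE r * (1 - (r + 1) / 2 * Y) * (N / m) := by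
    unfold bPst
    rw [← hm, hE1, hE2, ← bE_mul hr]
    have : bE r * r * ((bE r - 1) * (s ^ r * (N / m / m))) =
        bE r * ((bE r - 1) * r) * (s ^ r * (N / m / m)) := by ring
    rw [this, her, hY]; field_simp; ring
  have e0 : 0 ≤ bE r := by rw [he]; linarith
  have hPst' : |bPst r s τ| ≤ (r - 1) / 2 * (N / m) := by
    rw [hPst, ← bE_mul hr, abs_mul, abs_mul, abs_of_nonneg e0, abs_of_nonneg (by positivity : 0 ≤ N / m)]
    gcongr
    rw [abs_le]
    constructor <;> nlinarith
  -- mixed term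
  have hmix : |x1 * y1 + x2 * y2| ≤ 4 * (m / N) * (A * D) := by
    apply abs_le_of_sq_le_sq _ (by positivity)
    have h1 : (x1 * y1 + x2 * y2) ^ 2 ≤ (x1 ^ 2 + x2 ^ 2) * (y1 ^ 2 + y2 ^ 2) := by
      nlinarith [sq_nonneg (x1 * y2 - x2 * y1)]
    have h2 : (x1 ^ 2 + x2 ^ 2) * (y1 ^ 2 + y2 ^ 2) ≤ (4 * s * A ^ 2) * (4 * τ * D ^ 2) := by
      gcongr
    have h3 : s * τ ≤ (m / N) ^ 2 := by
      rw [div_pow, le_div_iff₀ (by positivity)]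
      calc s * τ * N ^ 2 = (s * N ^ 2) * τ := by ring
        _ ≤ m * m := by gcongr
        _ = m ^ 2 := by ring
    calc _ ≤ _ := h1
      _ ≤ _ := h2
      _ = 16 * (A * D) ^ 2 * (s * τ) := by ring
      _ ≤ 16 * (A * D) ^ 2 * (m / N) ^ 2 := by gcongr
      _ = _ := by ring
  have hmix2 : -(4 * (r - 1) * (A * D)) ≤ 2 * bPst r s τ * (x1 * y1 + x2 * y2) := by
    have : |bPst r s τ * (x1 * y1 + x2 * y2)| ≤ ((r - 1) / 2 * (N / m)) * (4 * (m / N) * (A * D)) := by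
      rw [abs_mul]; gcongr
    have e : ((r - 1) / 2 * (N / m)) * (4 * (m / N) * (A * D)) = 2 * (r - 1) * (A * D) := by
      field_simp; ring
    rw [e] at this
    have := (abs_le.1 this).1
    linarith
  -- v terms
  have K0 : 0 < bK r := by
    unfold bK
    rw [← hc]
    apply div_pos _ (by positivity)
    have := sq_nonneg r
    have : 0 < r ^ 2 := by positivity
    linarith
  set w := τ ^ ((1 + c) / 2 - 1) with hw
  have w0 : 0 < w := Real.rpow_pos_of_pos τ0 _
  have hw1 : τ ^ ((1 + c) / 2 - 1 - 1) = w / τ := by rw [Real.rpow_sub_one τ0.ne']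
  have hwN : 1 / N ≤ w := by
    have : (1:ℝ) / N = m ^ ((1 + c) / 2 - 1) := by
      rw [hN, he, one_div, ← Real.rpow_neg m0.le]; congr 1; ring
    rw [this, hw]
    exact Real.rpow_le_rpow_of_nonpos τ0 hτm (by linarith)
  have hPtt : bPtt r s τ ≤ 0 := by
    unfold bPtt
    rw [← hm, ← hc, hE2, hw1]
    have h1 : 0 ≤ bE r * (s * (N / m / m)) := by positivity
    have h2 : 0 ≤ bK r * ((1 + c) / 2) * (w / τ) := by positivity
    have h3 : bE r - 1 ≤ 0 := by rw [he]; linarith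
    have h4 : (1 + c) / 2 - 1 ≤ 0 := by linarith
    nlinarith
  have hv : 2 * r ^ 2 * (1 / N) ≤ 2 * bPt r s τ + 4 * τ * bPtt r s τ := by
    have eq : 2 * bPt r s τ + 4 * τ * bPtt r s τ =
       2 * bE r * (s * (N / m)) * (1 - 2 * (1 - bE r) * (τ / m)) + bK r * (c * (1 + c)) * w := by
      unfold bPtt bPt
      rw [← hm, ← hc, hE2, hE1, hw1, ← hw]
      field_simp; ring
    have hK : bK r * (c * (1 + c)) = 2 * r ^ 2 + 1 - c := by
      unfold bK; rw [← hc]; field_simp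
    rw [eq, hK]
    have h1 : -(1 - c) * (1 / N) ≤ 2 * bE r * (s * (N / m)) * (1 - 2 * (1 - bE r) * (τ / m)) := by
      have hsm' : s * (N / m) ≤ 1 / N := by
        rw [le_div_iff₀ N0]
        calc s * (N / m) * N = s * N ^ 2 / m := by ring
          _ ≤ 1 := by rw [div_le_one m0]; exact hsN
      have ht1 : τ / m ≤ 1 := by rw [div_le_one m0]; exact hτm
      have ht0 : 0 ≤ τ / m := by positivity
      have e12 : bE r ≤ 1 := by rw [he]; linarith
      have h5 : -1 ≤ 1 - 2 * (1 - bE r) * (τ / m) := by nlinarith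
      have h6 : 0 ≤ 2 * bE r * (s * (N / m)) := by positivity
      have h7 : 2 * bE r * (s * (N / m)) ≤ (1 - c) * (1 / N) := by
        rw [he]
        have : 0 ≤ 1 - c := by linarith
        calc 2 * ((1 - c) / 2) * (s * (N / m)) = (1 - c) * (s * (N / m)) := by ring
          _ ≤ _ := by gcongr
      nlinarith
    have h2 : (2 * r ^ 2 + 1 - c) * (1 / N) ≤ (2 * r ^ 2 + 1 - c) * w := by
      apply mul_le_mul_of_nonneg_left hwN
      have : 0 ≤ r ^ 2 := by positivity
      linarith
    linarith
  have hT : bPtt r s τ * (4 * τ * D ^ 2) ≤ bPtt r s τ * (y1 ^ 2 + y2 ^ 2) :=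
    mul_le_mul_of_nonpos_left hy hPtt
  have hS : 0 ≤ bPss r s τ * (x1 ^ 2 + x2 ^ 2) := by positivity
  have h1 : 2 * N * A ^ 2 ≤ 2 * bPs r s τ * A ^ 2 := by gcongr
  have h2 : 2 * r ^ 2 * (1 / N) * D ^ 2 ≤ (2 * bPt r s τ + 4 * τ * bPtt r s τ) * D ^ 2 := by gcongr
  have h3 : 4 * r * (A * D) ≤ 2 * N * A ^ 2 + 2 * r ^ 2 * (1 / N) * D ^ 2 := by
    have : 2 * N * A ^ 2 + 2 * r ^ 2 * (1 / N) * D ^ 2 - 4 * r * (A * D) =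
      2 * (N * A - r * D) ^ 2 / N := by field_simp; ring
    have : 0 ≤ 2 * (N * A - r * D) ^ 2 / N := by positivity
    linarith
  linarith

lemma bP_nonneg {r s τ : ℝ} (hr : 1 ≤ r) (s0 : 0 < s) (τ0 : 0 < τ) : 0 ≤ bP r s τ := by
  have := bM_pos (r := r) s0 τ0
  have : 0 ≤ bK r := by
    unfold bK
    have c1 : r⁻¹ ≤ 1 := inv_le_one_of_one_le₀ hr
    have : 0 < r⁻¹ := by positivity
    apply div_nonneg _ (by positivity)
    have : 0 ≤ r ^ 2 := by positivity
    linarith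
  unfold bP; positivity

lemma bP_le {r s τ : ℝ} (hr : 1 ≤ r) (s0 : 0 < s) (τ0 : 0 < τ) :
    bP r s τ ≤ (bK r + 2) * (s ^ ((1 + r) / 2) + τ ^ ((1 + r⁻¹) / 2)) := by
  have r0 : 0 < r := by linarith
  have c0 : 0 < r⁻¹ := by positivity
  have c1 : r⁻¹ ≤ 1 := inv_le_one_of_one_le₀ hr
  have hrc : r * r⁻¹ = 1 := mul_inv_cancel₀ r0.ne'
  have K0 : 0 ≤ bK r := by
    unfold bK
    apply div_nonneg _ (by positivity)
    have : 0 ≤ r ^ 2 := by positivity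
    linarith
  have e0 : 0 ≤ bE r := by rw [bE]; linarith
  have e1 : bE r ≤ 1 := by rw [bE]; linarith
  have h2 : (2:ℝ) ^ bE r ≤ 2 := by
    calc (2:ℝ) ^ bE r ≤ 2 ^ (1:ℝ) := Real.rpow_le_rpow_of_exponent_le (by norm_num) e1
      _ = 2 := by simp
  have a0 : 0 < s ^ ((1 + r) / 2) := Real.rpow_pos_of_pos s0 _
  have b0 : 0 < τ ^ ((1 + r⁻¹) / 2) := Real.rpow_pos_of_pos τ0 _
  have sr0 := Real.rpow_pos_of_pos s0 r
  have key : s * bM r s τ ^ bE r ≤ 2 * (s ^ ((1 + r) / 2) + τ ^ ((1 + r⁻¹) / 2)) := by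
    rcases le_total τ (s ^ r) with h | h
    · calc s * bM r s τ ^ bE r ≤ s * (2 * s ^ r) ^ bE r := by
            gcongr
            · exact (bM_pos s0 τ0).le
            · unfold bM; linarith
        _ = 2 ^ bE r * (s * s ^ (r * bE r)) := by
            rw [Real.mul_rpow (by norm_num) sr0.le, ← Real.rpow_mul s0.le]; ring
        _ = 2 ^ bE r * s ^ ((1 + r) / 2) := by
            rw [mul_comm r, bE_mul hr]
            congr 1
            rw [show (1 + r) / 2 = 1 + (r - 1) / 2 by ring, Real.rpow_add s0, Real.rpow_one]
        _ ≤ 2 * s ^ ((1 + r) / 2) := by gcongr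
        _ ≤ _ := by linarith
    · have hs : s ≤ τ ^ r⁻¹ := by
        have := Real.rpow_le_rpow sr0.le h c0.le
        rwa [← Real.rpow_mul s0.le, hrc, Real.rpow_one] at this
      calc s * bM r s τ ^ bE r ≤ τ ^ r⁻¹ * (2 * τ) ^ bE r := by
            gcongr
            · exact Real.rpow_nonneg (bM_pos s0 τ0).le _
            · exact (bM_pos s0 τ0).le
            · unfold bM; linarith
        _ = 2 ^ bE r * (τ ^ r⁻¹ * τ ^ bE r) := by
            rw [Real.mul_rpow (by norm_num) τ0.le]; ring
        _ = 2 ^ bE r * τ ^ ((1 + r⁻¹) / 2) := by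
            rw [← Real.rpow_add τ0]; congr 2; unfold bE; ring
        _ ≤ 2 * τ ^ ((1 + r⁻¹) / 2) := by gcongr
        _ ≤ _ := by linarith
  unfold bP
  nlinarith

/-! ### Integration over the box -/

section Box
set_option linter.unusedSectionVars false
variable {F : Type*} [NormedAddCommGroup F] [NormedSpace ℝ F]

noncomputable def sqInt (f : ℝ → ℝ → F) : F :=
  ∫ x in (-Real.pi)..Real.pi, ∫ y in (-Real.pi)..Real.pi, f x y

def Cont2 (f : ℝ → ℝ → F) : Prop := Continuous fun q : ℝ × ℝ => f q.1 q.2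
def Cont3 (f : ℝ → ℝ → ℝ → F) : Prop := Continuous fun q : ℝ × ℝ × ℝ => f q.1 q.2.1 q.2.2

lemma Cont3.slice {f : ℝ → ℝ → ℝ → F} (h : Cont3 f) (t : ℝ) : Cont2 (f t) := by
  unfold Cont3 at h; unfold Cont2
  exact h.comp (by fun_prop : Continuous fun q : ℝ × ℝ => (t, q.1, q.2))

lemma interval_swap {f : ℝ → ℝ → F} (h : Cont2 f) (a b c d : ℝ) :
    ∫ x in a..b, ∫ y in c..d, f x y = ∫ y in c..d, ∫ x in a..b, f x y := by
  apply intervalIntegral_intervalIntegral_swap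
  have h' : Continuous (Function.uncurry f) := h
  refine (h'.continuousOn.integrableOn_compact
    (isCompact_uIcc.prod isCompact_uIcc) (μ := volume) (K := Set.uIcc a b ×ˢ Set.uIcc c d)).mono_set ?_
  exact Set.prod_mono Set.uIoc_subset_uIcc Set.uIoc_subset_uIcc

lemma cont_inner {f : ℝ → ℝ → F} (h : Cont2 f) (c d : ℝ) :
    Continuous fun x => ∫ y in c..d, f x y := by
  have h' : Continuous (Function.uncurry f) := h
  exact intervalIntegral.continuous_parametric_intervalIntegral_of_continuous' h' c d

lemma Cont3.inner {f : ℝ → ℝ → ℝ → F} (h : Cont3 f) (c d : ℝ) :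
    Cont2 fun t x => ∫ y in c..d, f t x y := by
  have h' : Continuous (Function.uncurry (fun (q : ℝ × ℝ) (y : ℝ) => f q.1 q.2 y)) :=
    Continuous.comp (g := fun q : ℝ × ℝ × ℝ => f q.1 q.2.1 q.2.2) h
      (by fun_prop : Continuous fun q : (ℝ × ℝ) × ℝ => (q.1.1, q.1.2, q.2))
  exact intervalIntegral.continuous_parametric_intervalIntegral_of_continuous' h' c d

lemma Cont3.sqInt {f : ℝ → ℝ → ℝ → F} (h : Cont3 f) : Continuous fun t => sqInt (f t) :=
  cont_inner (h.inner _ _) _ _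

lemma cont2_right {f : ℝ → ℝ → F} (h : Cont2 f) (x : ℝ) : Continuous (f x) :=
  Continuous.comp (g := fun q : ℝ × ℝ => f q.1 q.2) h (by fun_prop : Continuous fun y : ℝ => (x, y))

lemma cont2_left {f : ℝ → ℝ → F} (h : Cont2 f) (y : ℝ) : Continuous (fun x => f x y) :=
  Continuous.comp (g := fun q : ℝ × ℝ => f q.1 q.2) h (by fun_prop : Continuous fun x : ℝ => (x, y))

lemma sqInt_sub {f g : ℝ → ℝ → F} (hf : Cont2 f) (hg : Cont2 g) :
    sqInt (fun x y => f x y - g x y) = sqInt f - sqInt g := by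
  unfold sqInt
  rw [← intervalIntegral.integral_sub ((cont_inner hf _ _).intervalIntegrable _ _)
    ((cont_inner hg _ _).intervalIntegrable _ _)]
  congr 1; ext x
  rw [← intervalIntegral.integral_sub ((cont2_right hf x).intervalIntegrable _ _)
    ((cont2_right hg x).intervalIntegrable _ _)]

lemma sqInt_mono {f g : ℝ → ℝ → ℝ} (hf : Cont2 f) (hg : Cont2 g) (h : ∀ x y, f x y ≤ g x y) :
    sqInt f ≤ sqInt g := by
  have hpi : -Real.pi ≤ Real.pi := by linarith [Real.pi_pos]
  unfold sqInt
  apply intervalIntegral.integral_mono hpi ((cont_inner hf _ _).intervalIntegrable _ _)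
    ((cont_inner hg _ _).intervalIntegrable _ _)
  intro x
  exact intervalIntegral.integral_mono hpi ((cont2_right hf x).intervalIntegrable _ _)
    ((cont2_right hg x).intervalIntegrable _ _) (h x)

lemma norm_sqInt_le {f : ℝ → ℝ → F} (hf : Cont2 f) :
    ‖sqInt f‖ ≤ sqInt fun x y => ‖f x y‖ := by
  have hpi : -Real.pi ≤ Real.pi := by linarith [Real.pi_pos]
  unfold sqInt
  refine (intervalIntegral.norm_integral_le_integral_norm hpi).trans ?_
  have hn : Cont2 fun x y => ‖f x y‖ := Continuous.norm hf
  apply intervalIntegral.integral_mono hpi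
    ((cont_inner hf _ _).norm.intervalIntegrable _ _)
    ((cont_inner hn _ _).intervalIntegrable _ _)
  intro x
  exact intervalIntegral.norm_integral_le_integral_norm hpi

lemma box_formula [CompleteSpace F] {P P' Q1 Q1' Q2 Q2' : ℝ → ℝ → ℝ → F} (T : ℝ)
    (hP : ∀ t x y, HasDerivAt (fun t => P t x y) (P' t x y) t)
    (hQ1 : ∀ t x y, HasDerivAt (fun x => Q1 t x y) (Q1' t x y) x)
    (hQ2 : ∀ t x y, HasDerivAt (fun y => Q2 t x y) (Q2' t x y) y)
    (cP : Cont3 P) (cP' : Cont3 P') (cQ1' : Cont3 Q1') (cQ2' : Cont3 Q2')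
    (per1 : ∀ t y, Q1 t Real.pi y = Q1 t (-Real.pi) y)
    (per2 : ∀ t x, Q2 t x Real.pi = Q2 t x (-Real.pi)) :
    ∫ t in (0:ℝ)..T, sqInt (fun x y => P' t x y - Q1' t x y - Q2' t x y)
      = sqInt (P T) - sqInt (P 0) := by
  have h1 : ∀ t, sqInt (Q1' t) = 0 := by
    intro t
    unfold sqInt
    rw [interval_swap (cQ1'.slice t)]
    have : ∀ y, ∫ x in (-Real.pi)..Real.pi, Q1' t x y = 0 := by
      intro y
      rw [intervalIntegral.integral_eq_sub_of_hasDerivAt (fun x _ => hQ1 t x y)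
        ((cont2_left (cQ1'.slice t) y).intervalIntegrable _ _), per1, sub_self]
    simp [this]
  have h2 : ∀ t, sqInt (Q2' t) = 0 := by
    intro t
    unfold sqInt
    have : ∀ x, ∫ y in (-Real.pi)..Real.pi, Q2' t x y = 0 := by
      intro x
      rw [intervalIntegral.integral_eq_sub_of_hasDerivAt (fun y _ => hQ2 t x y)
        ((cont2_right (cQ2'.slice t) x).intervalIntegrable _ _), per2, sub_self]
    simp [this]
  have h3 : ∀ t, sqInt (fun x y => P' t x y - Q1' t x y - Q2' t x y) = sqInt (P' t) := by
    intro t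
    rw [sqInt_sub (f := fun x y => P' t x y - Q1' t x y)
      (Continuous.sub (cP'.slice t) (cQ1'.slice t)) (cQ2'.slice t),
      sqInt_sub (cP'.slice t) (cQ1'.slice t), h1, h2, sub_zero, sub_zero]
  simp only [h3]
  rw [← sqInt_sub (cP.slice T) (cP.slice 0)]
  unfold sqInt
  rw [interval_swap (cP'.inner _ _)]
  congr 1; ext x
  have cs : Cont2 fun t y => P' t x y :=
    Continuous.comp (g := fun q : ℝ × ℝ × ℝ => P' q.1 q.2.1 q.2.2) cP'
      (by fun_prop : Continuous fun q : ℝ × ℝ => (q.1, x, q.2))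
  rw [interval_swap cs]
  congr 1; ext y
  rw [intervalIntegral.integral_eq_sub_of_hasDerivAt (fun t _ => hP t x y)
    ((cont2_left cs y).intervalIntegrable _ _)]

end Box

/-! ### Trigonometric polynomials and their heat extension -/

section TP
variable {ι : Type*} (S : Finset ι) (k l : ι → ℤ)

noncomputable def TP (c : ι → ℂ) (t x y : ℝ) : ℂ :=
  ∑ j ∈ S, c j * Complex.exp (-((k j : ℂ) ^ 2 + (l j : ℂ) ^ 2) * t
    + Complex.I * ((k j : ℂ) * x + (l j : ℂ) * y))

lemma TP_cont (c : ι → ℂ) : Cont3 (TP S k l c) := by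
  unfold Cont3 TP; fun_prop

noncomputable def cX (c : ι → ℂ) : ι → ℂ := fun j => Complex.I * (k j : ℂ) * c j
noncomputable def cT (c : ι → ℂ) : ι → ℂ := fun j => -((k j : ℂ) ^ 2 + (l j : ℂ) ^ 2) * c j

lemma TP_dx (c : ι → ℂ) (t x y : ℝ) :
    HasDerivAt (fun x => TP S k l c t x y) (TP S k l (cX k c) t x y) x := by
  unfold TP cX
  apply HasDerivAt.fun_sum
  intro j _
  have h : HasDerivAt (fun x : ℝ => (-((k j : ℂ) ^ 2 + (l j : ℂ) ^ 2) * t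
    + Complex.I * ((k j : ℂ) * x + (l j : ℂ) * y))) (Complex.I * (k j : ℂ)) x := by
    have h0 := (hasDerivAt_id x).ofReal_comp
    have := (((h0.const_mul (k j : ℂ)).add_const ((l j : ℂ) * y)).const_mul Complex.I).const_add
      (-((k j : ℂ) ^ 2 + (l j : ℂ) ^ 2) * t)
    simpa using this
  refine (h.cexp.const_mul (c j)).congr_deriv ?_
  ring

lemma TP_dy (c : ι → ℂ) (t x y : ℝ) :
    HasDerivAt (fun y => TP S k l c t x y) (TP S k l (cX l c) t x y) y := by
  unfold TP cX
  apply HasDerivAt.fun_sum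
  intro j _
  have h : HasDerivAt (fun y : ℝ => (-((k j : ℂ) ^ 2 + (l j : ℂ) ^ 2) * t
    + Complex.I * ((k j : ℂ) * x + (l j : ℂ) * y))) (Complex.I * (l j : ℂ)) y := by
    have h0 := (hasDerivAt_id y).ofReal_comp
    have := (((h0.const_mul (l j : ℂ)).const_add ((k j : ℂ) * x)).const_mul Complex.I).const_add
      (-((k j : ℂ) ^ 2 + (l j : ℂ) ^ 2) * t)
    simpa using this
  refine (h.cexp.const_mul (c j)).congr_deriv ?_
  ring

lemma TP_dt (c : ι → ℂ) (t x y : ℝ) :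
    HasDerivAt (fun t => TP S k l c t x y) (TP S k l (cT k l c) t x y) t := by
  unfold TP cT
  apply HasDerivAt.fun_sum
  intro j _
  have h : HasDerivAt (fun t : ℝ => (-((k j : ℂ) ^ 2 + (l j : ℂ) ^ 2) * t
    + Complex.I * ((k j : ℂ) * x + (l j : ℂ) * y))) (-((k j : ℂ) ^ 2 + (l j : ℂ) ^ 2)) t := by
    have h0 := (hasDerivAt_id t).ofReal_comp
    have := (h0.const_mul (-((k j : ℂ) ^ 2 + (l j : ℂ) ^ 2))).add_const
      (Complex.I * ((k j : ℂ) * x + (l j : ℂ) * y))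
    simpa using this
  refine (h.cexp.const_mul (c j)).congr_deriv ?_
  ring

lemma TP_heat (c : ι → ℂ) (t x y : ℝ) :
    TP S k l (cT k l c) t x y
      = TP S k l (cX k (cX k c)) t x y + TP S k l (cX l (cX l c)) t x y := by
  unfold TP cX cT
  rw [← Finset.sum_add_distrib]
  apply Finset.sum_congr rfl
  intro j _
  linear_combination (-((k j : ℂ) ^ 2 + (l j : ℂ) ^ 2) * c j *
    Complex.exp (-((k j : ℂ) ^ 2 + (l j : ℂ) ^ 2) * t
    + Complex.I * ((k j : ℂ) * x + (l j : ℂ) * y))) * Complex.I_sq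

lemma exp_per (k : ℤ) (A B : ℂ) :
    Complex.exp (A + Complex.I * (k * ((Real.pi : ℝ) : ℂ) + B))
     = Complex.exp (A + Complex.I * (k * ((-Real.pi : ℝ) : ℂ) + B)) := by
  rw [Complex.exp_eq_exp_iff_exists_int]
  exact ⟨k, by push_cast; ring⟩

lemma TP_perx (c : ι → ℂ) (t y : ℝ) : TP S k l c t Real.pi y = TP S k l c t (-Real.pi) y := by
  unfold TP
  apply Finset.sum_congr rfl
  intro j _
  rw [exp_per]

lemma TP_pery (c : ι → ℂ) (t x : ℝ) : TP S k l c t x Real.pi = TP S k l c t x (-Real.pi) := by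
  unfold TP
  apply Finset.sum_congr rfl
  intro j _
  rw [add_comm ((k j : ℂ) * x), exp_per, add_comm ((k j : ℂ) * x)]

def dotc (a b : ℂ) : ℝ := a.re * b.re + a.im * b.im

lemma dotc_hasDerivAt {u w : ℝ → ℂ} {u' w' : ℂ} {x : ℝ} (hu : HasDerivAt u u' x)
    (hw : HasDerivAt w w' x) :
    HasDerivAt (fun x => dotc (u x) (w x)) (dotc u' (w x) + dotc (u x) w') x := by
  have r1 := Complex.reCLM.hasFDerivAt.comp_hasDerivAt x hu
  have i1 := Complex.imCLM.hasFDerivAt.comp_hasDerivAt x hu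
  have r2 := Complex.reCLM.hasFDerivAt.comp_hasDerivAt x hw
  have i2 := Complex.imCLM.hasFDerivAt.comp_hasDerivAt x hw
  unfold dotc
  refine ((r1.mul r2).add (i1.mul i2)).congr_deriv ?_
  simp
  ring

lemma dotc_comm (a b : ℂ) : dotc a b = dotc b a := by unfold dotc; ring

lemma dotc_cs (a b : ℂ) : dotc a b ^ 2 ≤ dotc a a * dotc b b := by
  unfold dotc; nlinarith [sq_nonneg (a.re * b.im - a.im * b.re)]

lemma dotc_self_nonneg (a : ℂ) : 0 ≤ dotc a a := by
  unfold dotc; nlinarith [sq_nonneg a.re, sq_nonneg a.im]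

lemma dotc_self (a : ℂ) : dotc a a = ‖a‖ ^ 2 := by
  rw [Complex.sq_norm, Complex.normSq_apply]; rfl

lemma dotc_add_right (a b c : ℂ) : dotc a (b + c) = dotc a b + dotc a c := by
  unfold dotc; simp; ring

lemma continuous_dotc {X : Type*} [TopologicalSpace X] {f g : X → ℂ} (hf : Continuous f)
    (hg : Continuous g) : Continuous fun x => dotc (f x) (g x) := by
  unfold dotc; fun_prop

/-- Gradient norm. -/
noncomputable def gradN (c : ι → ℂ) (t x y : ℝ) : ℝ :=
  Real.sqrt (‖TP S k l (cX k c) t x y‖ ^ 2 + ‖TP S k l (cX l c) t x y‖ ^ 2)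

lemma gradN_nonneg (c : ι → ℂ) (t x y : ℝ) : 0 ≤ gradN S k l c t x y := Real.sqrt_nonneg _

lemma gradN_cont (c : ι → ℂ) : Cont3 (gradN S k l c) := by
  have h1 : Continuous fun q : ℝ × ℝ × ℝ => TP S k l (cX k c) q.1 q.2.1 q.2.2 := TP_cont S k l _
  have h2 : Continuous fun q : ℝ × ℝ × ℝ => TP S k l (cX l c) q.1 q.2.1 q.2.2 := TP_cont S k l _
  unfold Cont3 gradN
  fun_prop

lemma bM_cont {X : Type*} [TopologicalSpace X] {f g : X → ℝ} {r : ℝ} (hf : Continuous f)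
    (hg : Continuous g) (f0 : ∀ x, 0 < f x) : Continuous fun x => bM r (f x) (g x) := by
  unfold bM
  exact (hf.rpow_const fun x => Or.inl (f0 x).ne').add hg

lemma bP_conts {X : Type*} [TopologicalSpace X] {f g : X → ℝ} {r : ℝ} (hf : Continuous f)
    (hg : Continuous g) (f0 : ∀ x, 0 < f x) (g0 : ∀ x, 0 < g x) :
    Continuous (fun x => bP r (f x) (g x)) ∧ Continuous (fun x => bPs r (f x) (g x)) ∧
    Continuous (fun x => bPt r (f x) (g x)) ∧ Continuous (fun x => bPss r (f x) (g x)) ∧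
    Continuous (fun x => bPst r (f x) (g x)) ∧ Continuous (fun x => bPtt r (f x) (g x)) := by
  have hF : ∀ a : ℝ, Continuous fun x => f x ^ a :=
    fun a => hf.rpow_const fun x => Or.inl (f0 x).ne'
  have hG : ∀ a : ℝ, Continuous fun x => g x ^ a :=
    fun a => hg.rpow_const fun x => Or.inl (g0 x).ne'
  have hM : ∀ a : ℝ, Continuous fun x => bM r (f x) (g x) ^ a :=
    fun a => (bM_cont hf hg f0).rpow_const fun x => Or.inl (bM_pos (f0 x) (g0 x)).ne'
  unfold bP bPs bPt bPss bPst bPtt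
  refine ⟨?_, ?_, ?_, ?_, ?_, ?_⟩ <;> fun_prop

set_option maxHeartbeats 1000000 in
lemma energy {r : ℝ} (hr : 1 ≤ r) {ε : ℝ} (hε : 0 < ε) (c d : ι → ℂ) {T : ℝ} (hT : 0 ≤ T) :
    ∫ t in (0:ℝ)..T, sqInt (fun x y => 4 * (gradN S k l c t x y * gradN S k l d t x y))
      ≤ sqInt fun x y => bP r (ε + dotc (TP S k l c 0 x y) (TP S k l c 0 x y))
          (ε + dotc (TP S k l d 0 x y) (TP S k l d 0 x y)) := by
  set s : ℝ → ℝ → ℝ → ℝ := fun t x y => ε + dotc (TP S k l c t x y) (TP S k l c t x y) with hs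
  set τ : ℝ → ℝ → ℝ → ℝ := fun t x y => ε + dotc (TP S k l d t x y) (TP S k l d t x y) with hτ
  have s0 : ∀ t x y, 0 < s t x y := fun t x y => by
    have := dotc_self_nonneg (TP S k l c t x y); simp only [hs]; linarith
  have τ0 : ∀ t x y, 0 < τ t x y := fun t x y => by
    have := dotc_self_nonneg (TP S k l d t x y); simp only [hτ]; linarith
  let D1 : (ι → ℤ) → (ι → ℂ) → ℝ → ℝ → ℝ → ℝ := fun m c t x y =>
    2 * dotc (TP S k l c t x y) (TP S k l (cX m c) t x y)
  let D2 : (ι → ℤ) → (ι → ℂ) → ℝ → ℝ → ℝ → ℝ := fun m c t x y =>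
    2 * (dotc (TP S k l (cX m c) t x y) (TP S k l (cX m c) t x y)
      + dotc (TP S k l c t x y) (TP S k l (cX m (cX m c)) t x y))
  let Dt : (ι → ℂ) → ℝ → ℝ → ℝ → ℝ := fun c t x y =>
    2 * dotc (TP S k l c t x y) (TP S k l (cT k l c) t x y)
  have hsx : ∀ c t x y, HasDerivAt (fun x => ε + dotc (TP S k l c t x y) (TP S k l c t x y))
      (D1 k c t x y) x := fun c t x y => by
    refine ((dotc_hasDerivAt (TP_dx S k l c t x y) (TP_dx S k l c t x y)).const_add ε).congr_deriv ?_
    simp only [D1]; rw [dotc_comm (TP S k l (cX k c) t x y)]; ring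
  have hsy : ∀ c t x y, HasDerivAt (fun y => ε + dotc (TP S k l c t x y) (TP S k l c t x y))
      (D1 l c t x y) y := fun c t x y => by
    refine ((dotc_hasDerivAt (TP_dy S k l c t x y) (TP_dy S k l c t x y)).const_add ε).congr_deriv ?_
    simp only [D1]; rw [dotc_comm (TP S k l (cX l c) t x y)]; ring
  have hst : ∀ c t x y, HasDerivAt (fun t => ε + dotc (TP S k l c t x y) (TP S k l c t x y))
      (Dt c t x y) t := fun c t x y => by
    refine ((dotc_hasDerivAt (TP_dt S k l c t x y) (TP_dt S k l c t x y)).const_add ε).congr_deriv ?_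
    simp only [Dt]; rw [dotc_comm (TP S k l (cT k l c) t x y)]; ring
  have hsxx : ∀ c t x y, HasDerivAt (fun x => D1 k c t x y) (D2 k c t x y) x := fun c t x y =>
    (dotc_hasDerivAt (TP_dx S k l c t x y) (TP_dx S k l (cX k c) t x y)).const_mul 2
  have hsyy : ∀ c t x y, HasDerivAt (fun y => D1 l c t x y) (D2 l c t x y) y := fun c t x y =>
    (dotc_hasDerivAt (TP_dy S k l c t x y) (TP_dy S k l (cX l c) t x y)).const_mul 2
  have hheat : ∀ c t x y, Dt c t x y = D2 k c t x y + D2 l c t x y - 2 * gradN S k l c t x y ^ 2 := by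
    intro c t x y
    simp only [Dt, D2, gradN]
    rw [Real.sq_sqrt (by positivity), TP_heat, dotc_add_right, dotc_self, dotc_self]; ring
  have cTP : ∀ c : ι → ℂ, Continuous fun q : ℝ × ℝ × ℝ => TP S k l c q.1 q.2.1 q.2.2 :=
    fun c => TP_cont S k l c
  have cD1 : ∀ m c, Continuous fun q : ℝ × ℝ × ℝ => D1 m c q.1 q.2.1 q.2.2 :=
    fun m c => (continuous_dotc (cTP _) (cTP _)).const_mul 2
  have cD2 : ∀ m c, Continuous fun q : ℝ × ℝ × ℝ => D2 m c q.1 q.2.1 q.2.2 :=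
    fun m c => ((continuous_dotc (cTP _) (cTP _)).add (continuous_dotc (cTP _) (cTP _))).const_mul 2
  have cDt : ∀ c, Continuous fun q : ℝ × ℝ × ℝ => Dt c q.1 q.2.1 q.2.2 :=
    fun c => (continuous_dotc (cTP _) (cTP _)).const_mul 2
  have cs : Continuous fun q : ℝ × ℝ × ℝ => s q.1 q.2.1 q.2.2 :=
    continuous_const.add (continuous_dotc (cTP _) (cTP _))
  have cτ : Continuous fun q : ℝ × ℝ × ℝ => τ q.1 q.2.1 q.2.2 :=
    continuous_const.add (continuous_dotc (cTP _) (cTP _))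
  obtain ⟨k0, k1, k2, k3, k4, k5⟩ := bP_conts (r := r) cs cτ (fun q => s0 _ _ _) (fun q => τ0 _ _ _)
  let Q' : (ι → ℤ) → ℝ → ℝ → ℝ → ℝ := fun m t x y =>
    ((bPss r (s t x y) (τ t x y) * D1 m c t x y + bPst r (s t x y) (τ t x y) * D1 m d t x y)
      * D1 m c t x y + bPs r (s t x y) (τ t x y) * D2 m c t x y)
    + ((bPst r (s t x y) (τ t x y) * D1 m c t x y + bPtt r (s t x y) (τ t x y) * D1 m d t x y)
      * D1 m d t x y + bPt r (s t x y) (τ t x y) * D2 m d t x y)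
  let P' : ℝ → ℝ → ℝ → ℝ := fun t x y =>
    bPs r (s t x y) (τ t x y) * Dt c t x y + bPt r (s t x y) (τ t x y) * Dt d t x y
  have cQ' : ∀ m, Cont3 (Q' m) := fun m => by
    have a1 := cD1 m c
    have a2 := cD1 m d
    have a3 := cD2 m c
    have a4 := cD2 m d
    exact ((((k3.mul a1).add (k4.mul a2)).mul a1).add (k1.mul a3)).add
      ((((k4.mul a1).add (k5.mul a2)).mul a2).add (k2.mul a4))
  have cP' : Cont3 P' := (k1.mul (cDt c)).add (k2.mul (cDt d))
  have key := box_formula (P := fun t x y => bP r (s t x y) (τ t x y)) (P' := P')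
    (Q1 := fun t x y => bPs r (s t x y) (τ t x y) * D1 k c t x y
      + bPt r (s t x y) (τ t x y) * D1 k d t x y)
    (Q2 := fun t x y => bPs r (s t x y) (τ t x y) * D1 l c t x y
      + bPt r (s t x y) (τ t x y) * D1 l d t x y)
    (Q1' := Q' k) (Q2' := Q' l) T
    (fun t x y => bP_hasDerivAt hr (hst c t x y) (hst d t x y) (s0 _ _ _) (τ0 _ _ _))
    (fun t x y => ((bPs_hasDerivAt hr (hsx c t x y) (hsx d t x y) (s0 _ _ _) (τ0 _ _ _)).mul
        (hsxx c t x y)).add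
      ((bPt_hasDerivAt hr (hsx c t x y) (hsx d t x y) (s0 _ _ _) (τ0 _ _ _)).mul (hsxx d t x y)))
    (fun t x y => ((bPs_hasDerivAt hr (hsy c t x y) (hsy d t x y) (s0 _ _ _) (τ0 _ _ _)).mul
        (hsyy c t x y)).add
      ((bPt_hasDerivAt hr (hsy c t x y) (hsy d t x y) (s0 _ _ _) (τ0 _ _ _)).mul (hsyy d t x y)))
    k0 cP' (cQ' k) (cQ' l)
    (fun t y => by simp only [s, τ, D1, TP_perx])
    (fun t y => by simp only [s, τ, D1, TP_pery])
  have hpos : 0 ≤ sqInt (fun x y => bP r (s T x y) (τ T x y)) := by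
    have hpi : -Real.pi ≤ Real.pi := by linarith [Real.pi_pos]
    unfold sqInt
    apply intervalIntegral.integral_nonneg hpi
    intro x _
    apply intervalIntegral.integral_nonneg hpi
    intro y _
    exact bP_nonneg hr (s0 _ _ _) (τ0 _ _ _)
  have cg : Cont3 fun t x y => 4 * (gradN S k l c t x y * gradN S k l d t x y) := by
    have h1 := gradN_cont S k l c
    have h2 := gradN_cont S k l d
    unfold Cont3 at h1 h2 ⊢
    fun_prop
  have cN : Cont3 fun t x y => P' t x y - Q' k t x y - Q' l t x y :=
    Continuous.sub (Continuous.sub cP' (cQ' k)) (cQ' l)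
  have cN' : Cont3 fun t x y => -(P' t x y - Q' k t x y - Q' l t x y) := Continuous.neg cN
  have hle : ∫ t in (0:ℝ)..T, sqInt (fun x y => 4 * (gradN S k l c t x y * gradN S k l d t x y))
     ≤ ∫ t in (0:ℝ)..T, sqInt (fun x y => -(P' t x y - Q' k t x y - Q' l t x y)) := by
    apply intervalIntegral.integral_mono hT (cg.sqInt.intervalIntegrable _ _)
      (cN'.sqInt.intervalIntegrable _ _)
    intro t
    apply sqInt_mono (cg.slice t) (cN'.slice t)
    intro x y
    have hb : ∀ c : ι → ℂ, D1 k c t x y ^ 2 + D1 l c t x y ^ 2 ≤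
        4 * (ε + dotc (TP S k l c t x y) (TP S k l c t x y)) * gradN S k l c t x y ^ 2 := by
      intro c
      simp only [D1, gradN]
      rw [Real.sq_sqrt (by positivity), ← dotc_self, ← dotc_self]
      have h1 := dotc_cs (TP S k l c t x y) (TP S k l (cX k c) t x y)
      have h2 := dotc_cs (TP S k l c t x y) (TP S k l (cX l c) t x y)
      have h3 := mul_nonneg hε.le (dotc_self_nonneg (TP S k l (cX k c) t x y))
      have h4 := mul_nonneg hε.le (dotc_self_nonneg (TP S k l (cX l c) t x y))
      nlinarith
    have hbell := bellman_pointwise hr (s0 t x y) (τ0 t x y)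
      (gradN_nonneg S k l c t x y) (gradN_nonneg S k l d t x y)
      (hb c) (hb d)
    refine hbell.trans (le_of_eq ?_)
    simp only [P', Q']
    rw [hheat, hheat]
    ring
  refine hle.trans ?_
  have hneg : ∀ t, sqInt (fun x y => -(P' t x y - Q' k t x y - Q' l t x y)) =
      - sqInt (fun x y => (P' t x y - Q' k t x y - Q' l t x y)) := by
    intro t; unfold sqInt; simp only [intervalIntegral.integral_neg]
  simp only [hneg, intervalIntegral.integral_neg]
  rw [key]
  linarith

end TP

/-! ### The bilinear estimate for trigonometric polynomials -/

section Bilin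
variable {ι : Type*} (S : Finset ι) (k l : ι → ℤ)

noncomputable def cD (c : ι → ℂ) : ι → ℂ :=
  fun j => (1 / 2 : ℂ) * (cX k c j - Complex.I * cX l c j)
noncomputable def cDb (c : ι → ℂ) : ι → ℂ :=
  fun j => (1 / 2 : ℂ) * (cX k c j + Complex.I * cX l c j)

lemma TP_cD (c : ι → ℂ) (t x y : ℝ) : TP S k l (cD k l c) t x y =
    (1 / 2 : ℂ) * (TP S k l (cX k c) t x y - Complex.I * TP S k l (cX l c) t x y) := by
  unfold TP cD
  rw [Finset.mul_sum, ← Finset.sum_sub_distrib, Finset.mul_sum]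
  exact Finset.sum_congr rfl fun j _ => by ring

lemma TP_cDb (c : ι → ℂ) (t x y : ℝ) : TP S k l (cDb k l c) t x y =
    (1 / 2 : ℂ) * (TP S k l (cX k c) t x y + Complex.I * TP S k l (cX l c) t x y) := by
  unfold TP cDb
  rw [Finset.mul_sum, ← Finset.sum_add_distrib, Finset.mul_sum]
  exact Finset.sum_congr rfl fun j _ => by ring

lemma cD_cDb_comm (c : ι → ℂ) : cDb k l (cD k l c) = cD k l (cDb k l c) := by
  ext j; simp only [cDb, cD, cX]; ring

lemma TP_heat1 (c : ι → ℂ) (t x y : ℝ) : TP S k l (cT k l c) t x y =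
    2 * (TP S k l (cX k (cD k l c)) t x y + Complex.I * TP S k l (cX l (cD k l c)) t x y) := by
  unfold TP cD cX cT
  rw [Finset.mul_sum, ← Finset.sum_add_distrib, Finset.mul_sum]
  refine Finset.sum_congr rfl fun j _ => ?_
  ring_nf
  have h3 : Complex.I ^ 3 = -Complex.I := Complex.I_pow_three
  have h4 : Complex.I ^ 4 = 1 := Complex.I_pow_four
  simp only [Complex.I_sq, h3, h4]
  ring

lemma TP_heat2 (c : ι → ℂ) (t x y : ℝ) : TP S k l (cT k l (cD k l c)) t x y =
    2 * (TP S k l (cX k (cD k l (cDb k l c))) t x y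
      - Complex.I * TP S k l (cX l (cD k l (cDb k l c))) t x y) := by
  unfold TP cD cDb cX cT
  rw [Finset.mul_sum, ← Finset.sum_sub_distrib, Finset.mul_sum]
  refine Finset.sum_congr rfl fun j _ => ?_
  ring_nf
  have h3 : Complex.I ^ 3 = -Complex.I := Complex.I_pow_three
  have h4 : Complex.I ^ 4 = 1 := Complex.I_pow_four
  have h5 : Complex.I ^ 5 = Complex.I := by rw [pow_succ, h4, one_mul]
  have h6 : Complex.I ^ 6 = -1 := by rw [pow_succ, h5]; simp
  simp only [Complex.I_sq, h3, h4, h5, h6]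
  ring

lemma bilin_identity (c d : ι → ℂ) (T : ℝ) :
    ∫ t in (0:ℝ)..T, sqInt (fun x y => -8 *
        (TP S k l (cD k l (cDb k l c)) t x y * TP S k l (cD k l d) t x y))
      = sqInt (fun x y => TP S k l (cD k l c) T x y * TP S k l d T x y)
        - sqInt (fun x y => TP S k l (cD k l c) 0 x y * TP S k l d 0 x y) := by
  set a := cD k l c with ha
  set e := cD k l (cDb k l c) with he
  set w := cD k l d with hw
  have cTP : ∀ c : ι → ℂ, Continuous fun q : ℝ × ℝ × ℝ => TP S k l c q.1 q.2.1 q.2.2 :=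
    fun c => TP_cont S k l c
  have key := box_formula
    (P := fun t x y => TP S k l a t x y * TP S k l d t x y)
    (P' := fun t x y => TP S k l (cT k l a) t x y * TP S k l d t x y
      + TP S k l a t x y * TP S k l (cT k l d) t x y)
    (Q1 := fun t x y => 2 * (TP S k l d t x y * TP S k l e t x y
      + TP S k l a t x y * TP S k l w t x y))
    (Q1' := fun t x y => 2 * ((TP S k l (cX k d) t x y * TP S k l e t x y
      + TP S k l d t x y * TP S k l (cX k e) t x y)
      + (TP S k l (cX k a) t x y * TP S k l w t x y + TP S k l a t x y * TP S k l (cX k w) t x y)))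
    (Q2 := fun t x y => (2 * Complex.I) * (TP S k l a t x y * TP S k l w t x y
      - TP S k l d t x y * TP S k l e t x y))
    (Q2' := fun t x y => (2 * Complex.I) * ((TP S k l (cX l a) t x y * TP S k l w t x y
      + TP S k l a t x y * TP S k l (cX l w) t x y)
      - (TP S k l (cX l d) t x y * TP S k l e t x y
      + TP S k l d t x y * TP S k l (cX l e) t x y)))
    T
    (fun t x y => (TP_dt S k l a t x y).mul (TP_dt S k l d t x y))
    (fun t x y => (((TP_dx S k l d t x y).mul (TP_dx S k l e t x y)).add
      ((TP_dx S k l a t x y).mul (TP_dx S k l w t x y))).const_mul 2)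
    (fun t x y => (((TP_dy S k l a t x y).mul (TP_dy S k l w t x y)).sub
      ((TP_dy S k l d t x y).mul (TP_dy S k l e t x y))).const_mul (2 * Complex.I))
    ((cTP _).mul (cTP _)) (((cTP _).mul (cTP _)).add ((cTP _).mul (cTP _)))
    (((((cTP _).mul (cTP _)).add ((cTP _).mul (cTP _))).add
      (((cTP _).mul (cTP _)).add ((cTP _).mul (cTP _)))).const_mul 2)
    (((((cTP _).mul (cTP _)).add ((cTP _).mul (cTP _))).sub
      (((cTP _).mul (cTP _)).add ((cTP _).mul (cTP _)))).const_mul (2 * Complex.I))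
    (fun t y => by simp only [TP_perx])
    (fun t y => by simp only [TP_pery])
  rw [← key]
  congr 1; ext t; congr 1; ext x y
  rw [ha, TP_heat2, ← he, TP_heat1 S k l d, ← hw, ← ha]
  have h1 : TP S k l e t x y =
      (1 / 2 : ℂ) * (TP S k l (cX k a) t x y + Complex.I * TP S k l (cX l a) t x y) := by
    rw [he, ← cD_cDb_comm, ← ha, TP_cDb]
  have h2 : TP S k l w t x y =
      (1 / 2 : ℂ) * (TP S k l (cX k d) t x y - Complex.I * TP S k l (cX l d) t x y) := by
    rw [hw, TP_cD]
  linear_combination (-4 * TP S k l w t x y) * h1 + (-4 * TP S k l e t x y) * h2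

lemma norm_TP_le (c : ι → ℂ) {t : ℝ} (ht : 0 ≤ t) (x y : ℝ) :
    ‖TP S k l c t x y‖ ≤ ∑ j ∈ S, ‖c j‖ := by
  unfold TP
  refine (norm_sum_le _ _).trans (Finset.sum_le_sum fun j _ => ?_)
  rw [norm_mul, Complex.norm_exp]
  apply mul_le_of_le_one_right (norm_nonneg _)
  rw [Real.exp_le_one_iff]
  have : (-((k j : ℂ) ^ 2 + (l j : ℂ) ^ 2) * t
    + Complex.I * ((k j : ℂ) * x + (l j : ℂ) * y)).re = -((k j : ℝ) ^ 2 + (l j : ℝ) ^ 2) * t := by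
    have : (-((k j : ℂ) ^ 2 + (l j : ℂ) ^ 2) * t
      + Complex.I * ((k j : ℂ) * x + (l j : ℂ) * y)) =
      ((-((k j : ℝ) ^ 2 + (l j : ℝ) ^ 2) * t : ℝ) : ℂ) + (((k j : ℝ) * x + (l j : ℝ) * y : ℝ) : ℂ) * Complex.I := by
      push_cast; ring
    rw [this]; simp only [Complex.add_re, Complex.ofReal_re, Complex.re_ofReal_mul, Complex.I_re]
    ring
  rw [this]
  have : 0 ≤ (k j : ℝ) ^ 2 + (l j : ℝ) ^ 2 := by positivity
  nlinarith

lemma norm_TP_D_le (c : ι → ℂ) {t : ℝ} (ht : 0 ≤ t) (x y : ℝ) :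
    ‖TP S k l (cD k l c) t x y‖ ≤ Real.exp (-t) * ∑ j ∈ S, ‖cD k l c j‖ := by
  unfold TP
  rw [Finset.mul_sum]
  refine (norm_sum_le _ _).trans (Finset.sum_le_sum fun j _ => ?_)
  rw [norm_mul, Complex.norm_exp]
  have : (-((k j : ℂ) ^ 2 + (l j : ℂ) ^ 2) * t
    + Complex.I * ((k j : ℂ) * x + (l j : ℂ) * y)).re = -((k j : ℝ) ^ 2 + (l j : ℝ) ^ 2) * t := by
    have : (-((k j : ℂ) ^ 2 + (l j : ℂ) ^ 2) * t
      + Complex.I * ((k j : ℂ) * x + (l j : ℂ) * y)) =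
      ((-((k j : ℝ) ^ 2 + (l j : ℝ) ^ 2) * t : ℝ) : ℂ) + (((k j : ℝ) * x + (l j : ℝ) * y : ℝ) : ℂ) * Complex.I := by
      push_cast; ring
    rw [this]; simp only [Complex.add_re, Complex.ofReal_re, Complex.re_ofReal_mul, Complex.I_re]
    ring
  rw [this]
  by_cases h : k j = 0 ∧ l j = 0
  · have : cD k l c j = 0 := by simp [cD, cX, h.1, h.2]
    simp [this]
  · have h1 : (1 : ℤ) ≤ k j ^ 2 + l j ^ 2 := by
      by_contra hlt
      push Not at hlt
      apply h
      constructor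
      · have : k j ^ 2 = 0 := by nlinarith [sq_nonneg (k j), sq_nonneg (l j)]
        exact pow_eq_zero_iff (two_ne_zero) |>.1 this
      · have : l j ^ 2 = 0 := by nlinarith [sq_nonneg (k j), sq_nonneg (l j)]
        exact pow_eq_zero_iff (two_ne_zero) |>.1 this
    have h2 : (1 : ℝ) ≤ (k j : ℝ) ^ 2 + (l j : ℝ) ^ 2 := by exact_mod_cast h1
    rw [mul_comm]
    gcongr
    nlinarith

lemma norm_D_le_gradN (c : ι → ℂ) (t x y : ℝ) :
    ‖TP S k l (cD k l c) t x y‖ ^ 2 ≤ gradN S k l c t x y ^ 2 / 2 := by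
  rw [TP_cD, gradN, Real.sq_sqrt (by positivity), norm_mul]
  set A := TP S k l (cX k c) t x y
  set B := TP S k l (cX l c) t x y
  have h : ‖A - Complex.I * B‖ ≤ ‖A‖ + ‖B‖ := by
    refine (norm_sub_le _ _).trans ?_
    simp
  have h' : ‖A - Complex.I * B‖ ^ 2 ≤ (‖A‖ + ‖B‖) ^ 2 := by gcongr
  have : ‖(1 / 2 : ℂ)‖ = 1 / 2 := by simp
  rw [this]
  nlinarith [sq_nonneg (‖A‖ - ‖B‖)]

lemma norm_DD_le (c d : ι → ℂ) (t x y : ℝ) :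
    ‖-8 * (TP S k l (cD k l c) t x y * TP S k l (cD k l d) t x y)‖ ≤
      4 * (gradN S k l c t x y * gradN S k l d t x y) := by
  have h1 := norm_D_le_gradN S k l c t x y
  have h2 := norm_D_le_gradN S k l d t x y
  have g1 := gradN_nonneg S k l c t x y
  have g2 := gradN_nonneg S k l d t x y
  have : ‖TP S k l (cD k l c) t x y‖ * ‖TP S k l (cD k l d) t x y‖ ≤
      gradN S k l c t x y * gradN S k l d t x y / 2 := by
    apply le_of_sq_le_sq _ (by positivity)
    calc (‖TP S k l (cD k l c) t x y‖ * ‖TP S k l (cD k l d) t x y‖) ^ 2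
        = ‖TP S k l (cD k l c) t x y‖ ^ 2 * ‖TP S k l (cD k l d) t x y‖ ^ 2 := by ring
      _ ≤ (gradN S k l c t x y ^ 2 / 2) * (gradN S k l d t x y ^ 2 / 2) := by gcongr
      _ = _ := by ring
  rw [norm_mul, norm_mul, norm_neg]
  have : ‖(8 : ℂ)‖ = 8 := by simp
  rw [this]; linarith

lemma sqInt_const_le {F : Type*} [NormedAddCommGroup F] [NormedSpace ℝ F] {f : ℝ → ℝ → F} {M : ℝ}
    (h : ∀ x y, ‖f x y‖ ≤ M) : ‖sqInt f‖ ≤ M * (2 * Real.pi) * (2 * Real.pi) := by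
  have hpi : |Real.pi - -Real.pi| = 2 * Real.pi := by
    rw [abs_of_nonneg] <;> linarith [Real.pi_pos]
  unfold sqInt
  rw [← hpi]
  apply intervalIntegral.norm_integral_le_of_norm_le_const
  intro x _
  apply intervalIntegral.norm_integral_le_of_norm_le_const
  intro y _
  exact h x y

/-- the bilinear bound in terms of the space-time energy -/
lemma bilin_le_of_energy (c d : ι → ℂ) (M : ℝ)
    (hM : ∀ T, 0 ≤ T → ∫ t in (0:ℝ)..T, sqInt (fun x y =>
      4 * (gradN S k l (cDb k l c) t x y * gradN S k l d t x y)) ≤ M) :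
    ‖sqInt (fun x y => TP S k l (cD k l c) 0 x y * TP S k l d 0 x y)‖ ≤ M := by
  have cTP : ∀ c : ι → ℂ, Continuous fun q : ℝ × ℝ × ℝ => TP S k l c q.1 q.2.1 q.2.2 :=
    fun c => TP_cont S k l c
  set A := ∑ j ∈ S, ‖cD k l c j‖ with hA
  set B := ∑ j ∈ S, ‖d j‖ with hB
  have A0 : 0 ≤ A := Finset.sum_nonneg fun _ _ => norm_nonneg _
  have B0 : 0 ≤ B := Finset.sum_nonneg fun _ _ => norm_nonneg _
  have step : ∀ T : ℝ, 0 ≤ T →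
      ‖sqInt (fun x y => TP S k l (cD k l c) 0 x y * TP S k l d 0 x y)‖
      ≤ Real.exp (-T) * (A * B * (2 * Real.pi) * (2 * Real.pi)) + M := by
    intro T hT
    have hid := bilin_identity S k l c d T
    have h1 : ‖sqInt (fun x y => TP S k l (cD k l c) T x y * TP S k l d T x y)‖
        ≤ Real.exp (-T) * A * B * (2 * Real.pi) * (2 * Real.pi) := by
      apply sqInt_const_le
      intro x y
      rw [norm_mul]
      exact mul_le_mul (norm_TP_D_le S k l c hT x y) (norm_TP_le S k l d hT x y)
        (norm_nonneg _) (by positivity)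
    have c1 : Cont3 (fun t x y => -8 *
        (TP S k l (cD k l (cDb k l c)) t x y * TP S k l (cD k l d) t x y)) :=
      ((cTP _).mul (cTP _)).const_mul (-8)
    have c1n : Cont3 (fun t x y => ‖-8 *
        (TP S k l (cD k l (cDb k l c)) t x y * TP S k l (cD k l d) t x y)‖) := Continuous.norm c1
    have cg : Cont3 fun t x y => 4 * (gradN S k l (cDb k l c) t x y * gradN S k l d t x y) := by
      have h1 := gradN_cont S k l (cDb k l c)
      have h2 := gradN_cont S k l d
      unfold Cont3 at h1 h2 ⊢
      fun_prop
    have h2 : ‖∫ t in (0:ℝ)..T, sqInt (fun x y => -8 *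
        (TP S k l (cD k l (cDb k l c)) t x y * TP S k l (cD k l d) t x y))‖ ≤ M := by
      refine (intervalIntegral.norm_integral_le_integral_norm hT).trans (le_trans ?_ (hM T hT))
      apply intervalIntegral.integral_mono hT (c1.sqInt.norm.intervalIntegrable _ _)
        (cg.sqInt.intervalIntegrable _ _)
      intro t
      exact (norm_sqInt_le (c1.slice t)).trans
        (sqInt_mono (c1n.slice t) (cg.slice t) fun x y => norm_DD_le S k l _ _ t x y)
    have h3 : sqInt (fun x y => TP S k l (cD k l c) 0 x y * TP S k l d 0 x y)
       = sqInt (fun x y => TP S k l (cD k l c) T x y * TP S k l d T x y) -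
        ∫ t in (0:ℝ)..T, sqInt (fun x y => -8 *
        (TP S k l (cD k l (cDb k l c)) t x y * TP S k l (cD k l d) t x y)) := by
      rw [hid]; ring
    rw [h3]
    refine (norm_sub_le _ _).trans ?_
    have : Real.exp (-T) * A * B * (2 * Real.pi) * (2 * Real.pi) =
      Real.exp (-T) * (A * B * (2 * Real.pi) * (2 * Real.pi)) := by ring
    linarith
  have lim : Filter.Tendsto (fun T : ℝ => Real.exp (-T) * (A * B * (2 * Real.pi) * (2 * Real.pi)) + M)
      Filter.atTop (nhds (0 * (A * B * (2 * Real.pi) * (2 * Real.pi)) + M)) :=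
    ((Real.tendsto_exp_neg_atTop_nhds_zero).mul_const _).add_const _
  rw [zero_mul, zero_add] at lim
  apply ge_of_tendsto lim
  filter_upwards [Filter.eventually_ge_atTop 0] with T hT using step T hT

lemma bilin_main (p : ℝ) (hp : 1 < p) : ∃ C > (0 : ℝ), ∀ (ι : Type) (S : Finset ι) (k l : ι → ℤ)
    (c d : ι → ℂ) (ε : ℝ), 0 < ε →
    ‖sqInt (fun x y => TP S k l (cD k l c) 0 x y * TP S k l d 0 x y)‖ ≤
      sqInt (fun x y => C * ((ε + ‖TP S k l (cDb k l c) 0 x y‖ ^ 2) ^ (p / 2)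
        + (ε + ‖TP S k l d 0 x y‖ ^ 2) ^ (p / (p - 1) / 2))) := by
  have hp0 : 0 < p - 1 := by linarith
  have gen : ∀ r : ℝ, 1 ≤ r → ∀ (ι : Type) (S : Finset ι) (k l : ι → ℤ)
    (c d : ι → ℂ) (ε : ℝ), 0 < ε → ∀ T : ℝ, 0 ≤ T →
    ∫ t in (0:ℝ)..T, sqInt (fun x y => 4 * (gradN S k l c t x y * gradN S k l d t x y))
      ≤ sqInt fun x y => (bK r + 2) * ((ε + ‖TP S k l c 0 x y‖ ^ 2) ^ ((1 + r) / 2)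
        + (ε + ‖TP S k l d 0 x y‖ ^ 2) ^ ((1 + r⁻¹) / 2)) := by
    intro r hr ι S k l c d ε hε T hT
    refine (energy S k l hr hε c d hT).trans ?_
    have cTP : ∀ c : ι → ℂ, Continuous fun q : ℝ × ℝ => TP S k l c 0 q.1 q.2 :=
      fun c => (TP_cont S k l c).slice 0
    have pos : ∀ z : ℂ, 0 < ε + ‖z‖ ^ 2 := fun z => by positivity
    have cc : ∀ c : ι → ℂ, Continuous fun q : ℝ × ℝ => ε + ‖TP S k l c 0 q.1 q.2‖ ^ 2 := by
      intro c; have := cTP c; fun_prop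
    simp only [dotc_self]
    apply sqInt_mono
    · exact (bP_conts (r := r) (cc c) (cc d) (fun _ => pos _) (fun _ => pos _)).1
    · exact (((cc c).rpow_const fun _ => Or.inl (pos _).ne').add
        ((cc d).rpow_const fun _ => Or.inl (pos _).ne')).const_mul _
    · intro x y
      exact bP_le hr (pos _) (pos _)
  have Kpos : ∀ r : ℝ, 1 ≤ r → 0 < bK r + 2 := by
    intro r hr
    have c1 : r⁻¹ ≤ 1 := inv_le_one_of_one_le₀ hr
    have : 0 < r⁻¹ := by positivity
    have : 0 ≤ bK r := by
      unfold bK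
      apply div_nonneg _ (by positivity)
      have : 0 ≤ r ^ 2 := by positivity
      linarith
    linarith
  rcases le_total 2 p with h2 | h2
  · refine ⟨bK (p - 1) + 2, Kpos _ (by linarith), ?_⟩
    intro ι S k l c d ε hε
    apply bilin_le_of_energy
    intro T hT
    have := gen (p - 1) (by linarith) ι S k l (cDb k l c) d ε hε T hT
    rwa [show (1 + (p - 1)) / 2 = p / 2 by ring,
      show (1 + (p - 1)⁻¹) / 2 = p / (p - 1) / 2 by field_simp; ring] at this
  · have hr : 1 ≤ (p - 1)⁻¹ := (one_le_inv₀ hp0).2 (by linarith)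
    refine ⟨bK (p - 1)⁻¹ + 2, Kpos _ hr, ?_⟩
    intro ι S k l c d ε hε
    apply bilin_le_of_energy
    intro T hT
    have := gen (p - 1)⁻¹ hr ι S k l d (cDb k l c) ε hε T hT
    rw [inv_inv, show (1 + (p - 1)) / 2 = p / 2 by ring,
      show (1 + (p - 1)⁻¹) / 2 = p / (p - 1) / 2 by field_simp; ring] at this
    simpa only [mul_comm (gradN S k l d _ _ _), add_comm (_ ^ (p / (p - 1) / 2))] using this

end Bilin


/-! ### Approximation by trigonometric polynomials -/

section Approx

noncomputable def kap (x : ℝ) : ℝ := (1 + Real.cos x) / 2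

lemma kap_nonneg (x : ℝ) : 0 ≤ kap x := by
  unfold kap; linarith [Real.neg_one_le_cos x]

lemma kap_cont : Continuous kap := by
  unfold kap; fun_prop

lemma kap_le_one (x : ℝ) : kap x ≤ 1 := by
  unfold kap; linarith [Real.cos_le_one x]

lemma kap_zero : kap 0 = 1 := by
  unfold kap; norm_num

lemma kap_lt_one {x : ℝ} (h0 : x ≠ 0) (h1 : -(2 * Real.pi) < x) (h2 : x < 2 * Real.pi) :
    kap x < 1 := by
  rcases lt_or_eq_of_le (kap_le_one x) with h | h
  · exact h
  · exfalso
    apply h0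
    have : Real.cos x = 1 := by unfold kap at h; linarith
    exact (Real.cos_eq_one_iff_of_lt_of_lt h1 h2).1 this

noncomputable def kb (n j : ℕ) : ℂ := ((2 * n).choose j : ℂ) / 4 ^ n

lemma kap_expand (n : ℕ) (x : ℝ) : ((kap x ^ n : ℝ) : ℂ) =
    ∑ j ∈ Finset.range (2 * n + 1),
      kb n j * Complex.exp (Complex.I * ((((j : ℤ) - (n : ℤ) : ℤ) : ℂ) * x)) := by
  have h1 : ((kap x : ℝ) : ℂ) =
      (Complex.exp (Complex.I * x / 2) + Complex.exp (-(Complex.I * x / 2))) ^ 2 / 4 := by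
    have e1 : Complex.exp (Complex.I * x / 2) ^ 2 = Complex.exp (x * Complex.I) := by
      rw [← Complex.exp_nat_mul]; congr 1; push_cast; ring
    have e2 : Complex.exp (-(Complex.I * x / 2)) ^ 2 = Complex.exp (-x * Complex.I) := by
      rw [← Complex.exp_nat_mul]; congr 1; push_cast; ring
    have e3 : Complex.exp (Complex.I * x / 2) * Complex.exp (-(Complex.I * x / 2)) = 1 := by
      rw [← Complex.exp_add]; simp
    rw [add_sq, e1, e2, mul_assoc, e3]
    unfold kap
    push_cast
    rw [Complex.cos]
    ring
  push_cast
  rw [h1, div_pow, ← pow_mul, add_pow, Finset.sum_div]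
  apply Finset.sum_congr rfl
  intro j hj
  have hj' : j ≤ 2 * n := by simpa [Nat.lt_succ_iff] using hj
  rw [← Complex.exp_nat_mul, ← Complex.exp_nat_mul, ← Complex.exp_add]
  unfold kb
  have : (j : ℂ) * (Complex.I * x / 2) + ((2 * n - j : ℕ) : ℂ) * -(Complex.I * x / 2)
      = Complex.I * ((((j : ℤ) - (n : ℤ) : ℤ) : ℂ) * x) := by
    rw [Nat.cast_sub hj']; push_cast; ring
  rw [this]
  push_cast
  ring

noncomputable def kZ (n : ℕ) : ℝ := ∫ x in (-Real.pi)..Real.pi, kap x ^ n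

lemma kap_shift (n : ℕ) (x : ℝ) : ∫ w in (-Real.pi)..Real.pi, kap (x - w) ^ n = kZ n := by
  have hper : Function.Periodic (fun w => kap w ^ n) (2 * Real.pi) := by
    intro w; simp [kap]
  rw [intervalIntegral.integral_comp_sub_left (fun w => kap w ^ n)]
  have := hper.intervalIntegral_add_eq (x - Real.pi) (-Real.pi)
  unfold kZ
  convert this using 2 <;> ring

lemma kZ_pos (n : ℕ) : 0 < kZ n := by
  unfold kZ
  apply intervalIntegral.intervalIntegral_pos_of_pos_on
  · exact ((kap_cont.pow n).intervalIntegrable _ _)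
  · intro x hx
    apply pow_pos
    rcases lt_or_eq_of_le (kap_nonneg x) with h | h
    · exact h
    · exfalso
      have h1 : Real.cos (x / 2) ^ 2 = 0 := by
        have := Real.cos_sq (x / 2)
        rw [this]; unfold kap at h; rw [show 2 * (x / 2) = x by ring]; linarith
      have := Real.cos_pos_of_mem_Ioo (x := x / 2) ⟨by linarith [hx.1], by linarith [hx.2]⟩
      nlinarith
  · linarith [Real.pi_pos]

def sqO : Set (ℝ × ℝ) := Set.Ioo (-Real.pi) Real.pi ×ˢ Set.Ioo (-Real.pi) Real.pi
def sqC : Set (ℝ × ℝ) := Set.Icc (-Real.pi) Real.pi ×ˢ Set.Icc (-Real.pi) Real.pi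

lemma sqO_sub_sqC : sqO ⊆ sqC := Set.prod_mono Set.Ioo_subset_Icc_self Set.Ioo_subset_Icc_self
lemma sqC_compact : IsCompact sqC := isCompact_Icc.prod isCompact_Icc
lemma sqO_open : IsOpen sqO := isOpen_Ioo.prod isOpen_Ioo
lemma sqO_meas : MeasurableSet sqO := sqO_open.measurableSet

lemma sqInt_eq_O {F : Type*} [NormedAddCommGroup F] [NormedSpace ℝ F] {f : ℝ → ℝ → F}
    (hf : Cont2 f) : sqInt f = ∫ w in sqO, f w.1 w.2 := by
  have hpi : -Real.pi ≤ Real.pi := by linarith [Real.pi_pos]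
  have hi : IntegrableOn (fun w : ℝ × ℝ => f w.1 w.2) sqO (volume.prod volume) :=
    (hf.continuousOn.integrableOn_compact sqC_compact).mono_set sqO_sub_sqC
  unfold sqO at *
  rw [Measure.volume_eq_prod, setIntegral_prod _ hi]
  unfold sqInt
  simp only [intervalIntegral.integral_of_le hpi, integral_Ioc_eq_integral_Ioo]

lemma sqInt_eq_C {F : Type*} [NormedAddCommGroup F] [NormedSpace ℝ F] {f : ℝ → ℝ → F}
    (hf : Cont2 f) : sqInt f = ∫ w in sqC, f w.1 w.2 := by
  have hpi : -Real.pi ≤ Real.pi := by linarith [Real.pi_pos]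
  have hi : IntegrableOn (fun w : ℝ × ℝ => f w.1 w.2) sqC (volume.prod volume) :=
    (hf.continuousOn.integrableOn_compact sqC_compact)
  unfold sqC at *
  rw [Measure.volume_eq_prod, setIntegral_prod _ hi]
  unfold sqInt
  simp only [intervalIntegral.integral_of_le hpi, integral_Icc_eq_integral_Ioc]

lemma ker_int (n : ℕ) (x y : ℝ) :
    ∫ w in sqC, (kap (x - w.1) * kap (y - w.2)) ^ n = kZ n * kZ n := by
  have hc : Cont2 (fun a b => (kap (x - a) * kap (y - b)) ^ n) := by
    unfold Cont2
    have := kap_cont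
    fun_prop
  rw [← sqInt_eq_C hc]
  unfold sqInt
  simp only [mul_pow, intervalIntegral.integral_const_mul, intervalIntegral.integral_mul_const,
    kap_shift]

noncomputable def App (n : ℕ) (h : ℝ × ℝ → ℂ) (x y : ℝ) : ℂ :=
  (((kZ n * kZ n)⁻¹ : ℝ) : ℂ) * ∫ w : ℝ × ℝ, (((kap (x - w.1) * kap (y - w.2)) ^ n : ℝ) : ℂ) * h w

lemma App_eq_C (n : ℕ) {h : ℝ × ℝ → ℂ} (hs : Function.support h ⊆ sqO) (x y : ℝ) :
    App n h x y = (((kZ n * kZ n)⁻¹ : ℝ) : ℂ) *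
      ∫ w in sqC, (((kap (x - w.1) * kap (y - w.2)) ^ n : ℝ) : ℂ) * h w := by
  unfold App
  rw [setIntegral_eq_integral_of_forall_compl_eq_zero]
  intro w hw
  have : h w = 0 := by
    by_contra hne
    exact hw (sqO_sub_sqC (hs hne))
  simp [this]

lemma App_bound (n : ℕ) {h : ℝ × ℝ → ℂ} (hs : Function.support h ⊆ sqO) {M : ℝ}
    (hM : ∀ w, ‖h w‖ ≤ M) (x y : ℝ) : ‖App n h x y‖ ≤ M := by
  rw [App_eq_C n hs, norm_mul, Complex.norm_real, Real.norm_of_nonneg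
    (inv_nonneg.2 (mul_self_nonneg _))]
  have hz : 0 < kZ n * kZ n := mul_pos (kZ_pos n) (kZ_pos n)
  rw [inv_mul_le_iff₀ hz]
  have hc : Continuous (fun w : ℝ × ℝ => (kap (x - w.1) * kap (y - w.2)) ^ n) := by
    have := kap_cont
    fun_prop
  calc ‖∫ w in sqC, (((kap (x - w.1) * kap (y - w.2)) ^ n : ℝ) : ℂ) * h w‖
      ≤ ∫ w in sqC, (kap (x - w.1) * kap (y - w.2)) ^ n * M := by
        apply norm_integral_le_of_norm_le
        · exact ((hc.mul continuous_const).continuousOn.integrableOn_compact sqC_compact)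
        · refine Filter.Eventually.of_forall fun w => ?_
          have h0 : 0 ≤ (kap (x - w.1) * kap (y - w.2)) ^ n :=
            pow_nonneg (mul_nonneg (kap_nonneg _) (kap_nonneg _)) _
          rw [norm_mul, Complex.norm_real, Real.norm_of_nonneg h0]
          exact mul_le_mul_of_nonneg_left (hM w) h0
    _ = _ := by rw [integral_mul_const, ker_int]

lemma App_tendsto {h : ℝ × ℝ → ℂ} (hs : Function.support h ⊆ sqO) (hc : Continuous h)
    {z : ℝ × ℝ} (hz : z ∈ sqO) :
    Filter.Tendsto (fun n => App n h z.1 z.2) Filter.atTop (nhds (h z)) := by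
  have key := tendsto_setIntegral_pow_smul_of_unique_maximum_of_isCompact_of_continuousOn
    (μ := (volume : Measure (ℝ × ℝ))) (s := sqC) (x₀ := z) (g := h)
    (c := fun w => kap (z.1 - w.1) * kap (z.2 - w.2)) sqC_compact
    (by have := kap_cont; fun_prop)
    (by
      intro w hw hne
      simp only [sub_self, kap_zero, mul_one]
      have hz1 := hz.1; have hz2 := hz.2; have hw1 := hw.1; have hw2 := hw.2
      simp only [Set.mem_Ioo, Set.mem_Icc] at hz1 hz2 hw1 hw2
      by_cases h1 : w.1 = z.1
      · have h2 : w.2 ≠ z.2 := fun h2 => hne (Prod.ext h1 h2)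
        have := kap_lt_one (x := z.2 - w.2) (fun h => h2 (by linarith)) (by linarith) (by linarith)
        nlinarith [kap_le_one (z.1 - w.1), kap_nonneg (z.1 - w.1), kap_nonneg (z.2 - w.2)]
      · have := kap_lt_one (x := z.1 - w.1) (fun h => h1 (by linarith)) (by linarith) (by linarith)
        nlinarith [kap_le_one (z.2 - w.2), kap_nonneg (z.1 - w.1), kap_nonneg (z.2 - w.2)])
    (fun w _ => mul_nonneg (kap_nonneg _) (kap_nonneg _))
    (by simp [kap_zero])
    (subset_closure (interior_maximal sqO_sub_sqC sqO_open hz))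
    hc.continuousOn
  refine key.congr fun n => ?_
  rw [App_eq_C n hs, ker_int]
  simp only [Complex.real_smul]

noncomputable def ek (n : ℕ) (j : ℕ × ℕ) : ℤ := (j.1 : ℤ) - (n : ℤ)
noncomputable def el (n : ℕ) (j : ℕ × ℕ) : ℤ := (j.2 : ℤ) - (n : ℤ)
def eS (n : ℕ) : Finset (ℕ × ℕ) := Finset.range (2 * n + 1) ×ˢ Finset.range (2 * n + 1)

noncomputable def fhat (h : ℝ × ℝ → ℂ) (k l : ℤ) : ℂ :=
  ∫ w : ℝ × ℝ, h w * Complex.exp (-(Complex.I * ((k : ℂ) * w.1 + (l : ℂ) * w.2)))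

noncomputable def cf (n : ℕ) (h : ℝ × ℝ → ℂ) (j : ℕ × ℕ) : ℂ :=
  (((kZ n * kZ n)⁻¹ : ℝ) : ℂ) * (kb n j.1 * kb n j.2 * fhat h (ek n j) (el n j))

lemma TP_cf (n : ℕ) {h : ℝ × ℝ → ℂ} (hc : Continuous h) (hs : HasCompactSupport h) (x y : ℝ) :
    TP (eS n) (ek n) (el n) (cf n h) 0 x y = App n h x y := by
  have e : ∀ w : ℝ × ℝ, (((kap (x - w.1) * kap (y - w.2)) ^ n : ℝ) : ℂ) * h w =
      ∑ j ∈ eS n, (kb n j.1 * kb n j.2 * Complex.exp (Complex.I * ((ek n j : ℂ) * x + (el n j : ℂ) * y)))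
       * (h w * Complex.exp (-(Complex.I * ((ek n j : ℂ) * w.1 + (el n j : ℂ) * w.2)))) := by
    intro w
    rw [mul_pow, Complex.ofReal_mul, kap_expand, kap_expand, Finset.sum_mul_sum,
      ← Finset.sum_product', Finset.sum_mul]
    apply Finset.sum_congr rfl
    intro j _
    have : ∀ a b c d : ℂ, kb n j.1 * a * (kb n j.2 * b) * h w = kb n j.1 * kb n j.2 * c * (h w * d)
        ↔ kb n j.1 * kb n j.2 * h w * (a * b) = kb n j.1 * kb n j.2 * h w * (c * d) := by
      intro a b c d
      constructor <;> intro hh <;> linear_combination hh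
    rw [this, ← Complex.exp_add, ← Complex.exp_add]
    congr 2
    unfold ek el
    push_cast
    ring
  unfold App
  simp only [e]
  rw [integral_finsetSum]
  · unfold TP cf fhat
    rw [Finset.mul_sum]
    apply Finset.sum_congr rfl
    intro j _
    rw [integral_const_mul]
    simp only [Complex.ofReal_zero, mul_zero, zero_add]
    ring
  · intro j _
    apply Integrable.const_mul
    apply Continuous.integrable_of_hasCompactSupport
    · fun_prop
    · exact hs.mul_right

lemma fhat_deriv {h : ℝ × ℝ → ℂ} (hc : ContDiff ℝ 1 h) (hs : HasCompactSupport h) (k l : ℤ)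
    (v : ℝ × ℝ) : fhat (fun w => fderiv ℝ h w v) k l
      = Complex.I * ((k : ℂ) * v.1 + (l : ℂ) * v.2) * fhat h k l := by
  set E : ℝ × ℝ → ℂ := fun w => Complex.exp (-(Complex.I * ((k : ℂ) * w.1 + (l : ℂ) * w.2))) with hE
  have hEd : ∀ w, HasFDerivAt E (E w • -(Complex.I • ((k : ℂ) • (Complex.ofRealCLM.comp
      (ContinuousLinearMap.fst ℝ ℝ ℝ)) + (l : ℂ) • (Complex.ofRealCLM.comp
      (ContinuousLinearMap.snd ℝ ℝ ℝ))))) w := by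
    intro w
    apply HasFDerivAt.cexp
    apply HasFDerivAt.neg
    apply HasFDerivAt.const_mul
    apply HasFDerivAt.add
    · exact ((Complex.ofRealCLM.comp (ContinuousLinearMap.fst ℝ ℝ ℝ)).hasFDerivAt).const_mul _
    · exact ((Complex.ofRealCLM.comp (ContinuousLinearMap.snd ℝ ℝ ℝ)).hasFDerivAt).const_mul _
  have hEv : ∀ w, fderiv ℝ E w v = -(Complex.I * ((k : ℂ) * v.1 + (l : ℂ) * v.2)) * E w := by
    intro w
    rw [(hEd w).fderiv]
    simp
    ring
  have hEc : Continuous E := by rw [hE]; fun_prop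
  have hdc : Continuous fun w => fderiv ℝ h w v :=
    (hc.continuous_fderiv (by norm_num)).clm_apply continuous_const
  have hds : HasCompactSupport fun w => fderiv ℝ h w v := hs.fderiv_apply ℝ v
  have := integral_mul_fderiv_eq_neg_fderiv_mul_of_integrable (μ := (volume : Measure (ℝ × ℝ)))
    (f := E) (g := h) (v := v) (𝕜 := ℂ)
    (by
      simp only [hEv]
      exact Continuous.integrable_of_hasCompactSupport (by have := hc.continuous; fun_prop)
        hs.mul_left)
    (Continuous.integrable_of_hasCompactSupport (by fun_prop) hds.mul_left)
    (Continuous.integrable_of_hasCompactSupport (by have := hc.continuous; fun_prop) hs.mul_left)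
    (fun w _ => (hEd w).differentiableAt) (fun w _ => (hc.differentiable (by norm_num)) w)
  unfold fhat
  simp only [hEv] at this
  calc ∫ w, fderiv ℝ h w v * E w = ∫ w, E w * fderiv ℝ h w v := by simp only [mul_comm]
    _ = _ := this
    _ = -∫ w, -(Complex.I * ((k : ℂ) * v.1 + (l : ℂ) * v.2)) * (h w * E w) := by
        congr 1; congr 1; ext w; ring
    _ = _ := by rw [integral_const_mul]; ring

end Approx


/-! ### The planar estimate -/

section Planar

noncomputable def dD (g : ℝ × ℝ → ℂ) (w : ℝ × ℝ) : ℂ :=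
  (1 / 2 : ℂ) * (fderiv ℝ g w (1, 0) - Complex.I * fderiv ℝ g w (0, 1))
noncomputable def dB (g : ℝ × ℝ → ℂ) (w : ℝ × ℝ) : ℂ :=
  (1 / 2 : ℂ) * (fderiv ℝ g w (1, 0) + Complex.I * fderiv ℝ g w (0, 1))

lemma cont_fd {g : ℝ × ℝ → ℂ} (hg : ContDiff ℝ 1 g) (v : ℝ × ℝ) :
    Continuous fun w => fderiv ℝ g w v :=
  (hg.continuous_fderiv (by norm_num)).clm_apply continuous_const

lemma dD_cont {g : ℝ × ℝ → ℂ} (hg : ContDiff ℝ 1 g) : Continuous (dD g) := by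
  have h1 := cont_fd hg (1, 0)
  have h2 := cont_fd hg (0, 1)
  unfold dD; fun_prop

lemma dB_cont {g : ℝ × ℝ → ℂ} (hg : ContDiff ℝ 1 g) : Continuous (dB g) := by
  have h1 := cont_fd hg (1, 0)
  have h2 := cont_fd hg (0, 1)
  unfold dB; fun_prop

lemma dD_supp (g : ℝ × ℝ → ℂ) : Function.support (dD g) ⊆ tsupport g := by
  intro w hw
  by_contra h
  apply hw
  have : fderiv ℝ g w = 0 := by
    by_contra h'
    exact h (support_fderiv_subset ℝ h')
  simp [dD, this]

lemma dB_supp (g : ℝ × ℝ → ℂ) : Function.support (dB g) ⊆ tsupport g := by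
  intro w hw
  by_contra h
  apply hw
  have : fderiv ℝ g w = 0 := by
    by_contra h'
    exact h (support_fderiv_subset ℝ h')
  simp [dB, this]

lemma cs_of_supp {E : Type*} [TopologicalSpace E] [T2Space E] {g h : E → ℂ}
    (hg : HasCompactSupport g)
    (hs : Function.support h ⊆ tsupport g) : HasCompactSupport h :=
  HasCompactSupport.intro hg fun x hx => by
    by_contra h'
    exact hx (hs h')

lemma cX_cf_k (n : ℕ) {g : ℝ × ℝ → ℂ} (hg : ContDiff ℝ 1 g) (hs : HasCompactSupport g) :
    cX (ek n) (cf n g) = cf n (fun w => fderiv ℝ g w (1, 0)) := by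
  ext j
  unfold cX cf
  rw [fhat_deriv hg hs]
  simp only [Complex.ofReal_one, Complex.ofReal_zero]
  ring

lemma cX_cf_l (n : ℕ) {g : ℝ × ℝ → ℂ} (hg : ContDiff ℝ 1 g) (hs : HasCompactSupport g) :
    cX (el n) (cf n g) = cf n (fun w => fderiv ℝ g w (0, 1)) := by
  ext j
  unfold cX cf
  rw [fhat_deriv hg hs]
  simp only [Complex.ofReal_one, Complex.ofReal_zero]
  ring

lemma App_lin (n : ℕ) (a b : ℂ) {u v : ℝ × ℝ → ℂ} (hu : Continuous u) (hv : Continuous v)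
    (su : HasCompactSupport u) (sv : HasCompactSupport v) (x y : ℝ) :
    App n (fun w => a * (u w + b * v w)) x y = a * (App n u x y + b * App n v x y) := by
  unfold App
  have hk : Continuous (fun w : ℝ × ℝ => (((kap (x - w.1) * kap (y - w.2)) ^ n : ℝ) : ℂ)) := by
    have := kap_cont
    fun_prop
  have i1 : Integrable (fun w : ℝ × ℝ =>
      (((kap (x - w.1) * kap (y - w.2)) ^ n : ℝ) : ℂ) * u w) :=
    (hk.mul hu).integrable_of_hasCompactSupport su.mul_left
  have i2 : Integrable (fun w : ℝ × ℝ =>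
      (((kap (x - w.1) * kap (y - w.2)) ^ n : ℝ) : ℂ) * v w) :=
    (hk.mul hv).integrable_of_hasCompactSupport sv.mul_left
  have : ∀ w : ℝ × ℝ, (((kap (x - w.1) * kap (y - w.2)) ^ n : ℝ) : ℂ) * (a * (u w + b * v w)) =
      a * ((((kap (x - w.1) * kap (y - w.2)) ^ n : ℝ) : ℂ) * u w
        + b * ((((kap (x - w.1) * kap (y - w.2)) ^ n : ℝ) : ℂ) * v w)) := fun w => by ring
  simp only [this]
  rw [integral_const_mul, integral_add i1 (i2.const_mul b), integral_const_mul]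
  ring

lemma TP_dD (n : ℕ) {g : ℝ × ℝ → ℂ} (hg : ContDiff ℝ 1 g) (hs : HasCompactSupport g) (x y : ℝ) :
    TP (eS n) (ek n) (el n) (cD (ek n) (el n) (cf n g)) 0 x y = App n (dD g) x y := by
  rw [TP_cD, cX_cf_k n hg hs, cX_cf_l n hg hs, TP_cf n (cont_fd hg _) (hs.fderiv_apply ℝ _),
    TP_cf n (cont_fd hg _) (hs.fderiv_apply ℝ _)]
  have := App_lin n (1 / 2) (-Complex.I) (cont_fd hg (1, 0)) (cont_fd hg (0, 1))
    (hs.fderiv_apply ℝ _) (hs.fderiv_apply ℝ _) x y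
  have e : dD g = fun w => (1 / 2 : ℂ) * (fderiv ℝ g w (1, 0) + -Complex.I * fderiv ℝ g w (0, 1)) := by
    ext w; unfold dD; ring
  rw [e, this]
  ring

lemma TP_dB (n : ℕ) {g : ℝ × ℝ → ℂ} (hg : ContDiff ℝ 1 g) (hs : HasCompactSupport g) (x y : ℝ) :
    TP (eS n) (ek n) (el n) (cDb (ek n) (el n) (cf n g)) 0 x y = App n (dB g) x y := by
  rw [TP_cDb, cX_cf_k n hg hs, cX_cf_l n hg hs, TP_cf n (cont_fd hg _) (hs.fderiv_apply ℝ _),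
    TP_cf n (cont_fd hg _) (hs.fderiv_apply ℝ _)]
  have := App_lin n (1 / 2) (Complex.I) (cont_fd hg (1, 0)) (cont_fd hg (0, 1))
    (hs.fderiv_apply ℝ _) (hs.fderiv_apply ℝ _) x y
  exact this.symm

lemma App_cont (n : ℕ) {h : ℝ × ℝ → ℂ} (hc : Continuous h) (hs : HasCompactSupport h) :
    Cont2 (App n h) := by
  have : App n h = TP (eS n) (ek n) (el n) (cf n h) 0 := by
    ext x y; rw [TP_cf n hc hs]
  rw [this]
  exact (TP_cont _ _ _ _).slice 0

instance : IsFiniteMeasure ((volume : Measure (ℝ × ℝ)).restrict sqO) :=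
  ⟨by
    rw [Measure.restrict_apply_univ]
    exact lt_of_le_of_lt (measure_mono sqO_sub_sqC) sqC_compact.measure_lt_top⟩

lemma setInt_sqO {F : Type*} [NormedAddCommGroup F] [NormedSpace ℝ F] {f : ℝ × ℝ → F}
    (h : ∀ w, w ∉ sqO → f w = 0) : ∫ w in sqO, f w = ∫ w, f w :=
  setIntegral_eq_integral_of_forall_compl_eq_zero h

lemma tendsto_en : Filter.Tendsto (fun n : ℕ => 1 / ((n : ℝ) + 1)) Filter.atTop (nhds 0) :=
  tendsto_one_div_add_atTop_nhds_zero_nat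

lemma pow_tendsto {h : ℝ × ℝ → ℂ} (hc : Continuous h) (hs : HasCompactSupport h)
    (hO : Function.support h ⊆ sqO) {s : ℝ} (hs0 : 0 < s) :
    Filter.Tendsto (fun n : ℕ => ∫ w in sqO,
      (1 / ((n : ℝ) + 1) + ‖App n h w.1 w.2‖ ^ 2) ^ (s / 2)) Filter.atTop
      (nhds (∫ w, ‖h w‖ ^ s)) := by
  obtain ⟨M, hM⟩ := hs.exists_bound_of_continuous hc
  have hM0 : 0 ≤ M := (norm_nonneg _).trans (hM 0)
  have hs2 : 0 < s / 2 := by linarith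
  rw [← setInt_sqO (f := fun w => ‖h w‖ ^ s) (by
    intro w hw
    have : h w = 0 := by by_contra h'; exact hw (hO h')
    simp [this, Real.zero_rpow hs0.ne'])]
  have e : ∀ w, ‖h w‖ ^ s = (0 + ‖h w‖ ^ 2) ^ (s / 2) := by
    intro w
    rw [zero_add, ← Real.rpow_natCast, ← Real.rpow_mul (norm_nonneg _)]
    congr 1; push_cast; ring
  simp only [e]
  apply tendsto_integral_of_dominated_convergence (fun _ => (1 + M ^ 2) ^ (s / 2))
  · intro n
    have := App_cont n hc hs
    unfold Cont2 at this
    have h2 : Continuous fun w : ℝ × ℝ => (1 / ((n : ℝ) + 1) + ‖App n h w.1 w.2‖ ^ 2) ^ (s / 2) :=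
      (by fun_prop : Continuous fun w : ℝ × ℝ => (1 / ((n : ℝ) + 1) + ‖App n h w.1 w.2‖ ^ 2)).rpow_const
        fun w => Or.inr hs2.le
    exact h2.aestronglyMeasurable
  · exact integrable_const _
  · intro n
    refine Filter.Eventually.of_forall fun w => ?_
    have h1 : 1 / ((n : ℝ) + 1) ≤ 1 := by
      rw [div_le_one (by positivity)]; linarith [(Nat.cast_nonneg n : (0:ℝ) ≤ n)]
    have h2 : ‖App n h w.1 w.2‖ ≤ M := App_bound n hO hM _ _
    rw [Real.norm_of_nonneg (by positivity)]
    gcongr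
  · filter_upwards [ae_restrict_mem sqO_meas] with w hw
    exact (tendsto_en.add ((App_tendsto hO hc hw).norm.pow 2)).rpow_const (Or.inr hs2.le)

lemma bilin_R2 (p : ℝ) (hp : 1 < p) : ∃ C > 0, ∀ g ψ : ℝ × ℝ → ℂ, ContDiff ℝ 1 g →
    HasCompactSupport g → tsupport g ⊆ sqO → Continuous ψ → HasCompactSupport ψ →
    Function.support ψ ⊆ sqO →
    ‖∫ w, dD g w * ψ w‖ ≤ C * ((∫ w, ‖dB g w‖ ^ p) + ∫ w, ‖ψ w‖ ^ (p / (p - 1))) := by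
  obtain ⟨C, hC, H⟩ := bilin_main p hp
  refine ⟨C, hC, fun g ψ hg sg tg hψ sψ tψ => ?_⟩
  have cD' := dD_cont hg
  have cB' := dB_cont hg
  have sD := cs_of_supp sg (dD_supp g)
  have sB := cs_of_supp sg (dB_supp g)
  have tD := (dD_supp g).trans tg
  have tB := (dB_supp g).trans tg
  have hq : 0 < p / (p - 1) := div_pos (by linarith) (by linarith)
  have hp0 : 0 < p := by linarith
  have A1 : Filter.Tendsto (fun n : ℕ => ∫ w in sqO, App n (dD g) w.1 w.2 * App n ψ w.1 w.2)
      Filter.atTop (nhds (∫ w, dD g w * ψ w)) := by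
    rw [← setInt_sqO (f := fun w => dD g w * ψ w) (by
      intro w hw
      have : ψ w = 0 := by by_contra h'; exact hw (tψ h')
      simp [this])]
    obtain ⟨M, hM⟩ := sD.exists_bound_of_continuous cD'
    obtain ⟨N, hN⟩ := sψ.exists_bound_of_continuous hψ
    have hM0 : 0 ≤ M := (norm_nonneg _).trans (hM 0)
    apply tendsto_integral_of_dominated_convergence (fun _ => M * N)
    · intro n
      have h1 := App_cont n cD' sD
      have h2 := App_cont n hψ sψ
      unfold Cont2 at h1 h2
      exact (h1.mul h2).aestronglyMeasurable
    · exact integrable_const _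
    · intro n
      refine Filter.Eventually.of_forall fun w => ?_
      rw [norm_mul]
      exact mul_le_mul (App_bound n tD hM _ _) (App_bound n tψ hN _ _) (norm_nonneg _) hM0
    · filter_upwards [ae_restrict_mem sqO_meas] with w hw
      exact (App_tendsto tD cD' hw).mul (App_tendsto tψ hψ hw)
  have A2 := pow_tendsto cB' sB tB hp0
  have A3 := pow_tendsto hψ sψ tψ hq
  refine le_of_tendsto_of_tendsto' A1.norm ((A2.add A3).const_mul C) fun n => ?_
  have h := H (ℕ × ℕ) (eS n) (ek n) (el n) (cf n g) (cf n ψ) (1 / ((n : ℝ) + 1)) (by positivity)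
  simp only [TP_dD n hg sg, TP_dB n hg sg, TP_cf n hψ sψ] at h
  have c1 := App_cont n cD' sD
  have c2 := App_cont n hψ sψ
  have c3 := App_cont n cB' sB
  unfold Cont2 at c1 c2 c3
  have r1 : Continuous fun w : ℝ × ℝ =>
      (1 / ((n : ℝ) + 1) + ‖App n (dB g) w.1 w.2‖ ^ 2) ^ (p / 2) :=
    (by fun_prop : Continuous fun w : ℝ × ℝ =>
      (1 / ((n : ℝ) + 1) + ‖App n (dB g) w.1 w.2‖ ^ 2)).rpow_const fun w => Or.inr (by linarith)
  have r2 : Continuous fun w : ℝ × ℝ =>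
      (1 / ((n : ℝ) + 1) + ‖App n ψ w.1 w.2‖ ^ 2) ^ (p / (p - 1) / 2) :=
    (by fun_prop : Continuous fun w : ℝ × ℝ =>
      (1 / ((n : ℝ) + 1) + ‖App n ψ w.1 w.2‖ ^ 2)).rpow_const fun w => Or.inr (by linarith)
  rw [sqInt_eq_O (by unfold Cont2; exact c1.mul c2),
    sqInt_eq_O (by unfold Cont2; exact continuous_const.mul (r1.add r2)), integral_const_mul,
    integral_add] at h
  · exact h
  · exact (r1.continuousOn.integrableOn_compact sqC_compact).mono_set sqO_sub_sqC
  · exact (r2.continuousOn.integrableOn_compact sqC_compact).mono_set sqO_sub_sqC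

end Planar


section PlanarLp

noncomputable def dual (p : ℝ) (a : ℂ) : ℂ := (starRingEnd ℂ) a * ((‖a‖ ^ (p - 2) : ℝ) : ℂ)

lemma dual_norm {p : ℝ} (hp : 1 < p) (a : ℂ) : ‖dual p a‖ = ‖a‖ ^ (p - 1) := by
  unfold dual
  rw [norm_mul, Complex.norm_real, Real.norm_of_nonneg (by positivity), RCLike.norm_conj]
  rcases eq_or_ne a 0 with rfl | ha
  · rw [norm_zero, zero_mul, Real.zero_rpow (by linarith)]
  · have : 0 < ‖a‖ := norm_pos_iff.2 ha
    rw [show p - 1 = 1 + (p - 2) by ring, Real.rpow_add this, Real.rpow_one]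

lemma dual_mul {p : ℝ} (hp : 1 < p) (a : ℂ) : a * dual p a = ((‖a‖ ^ p : ℝ) : ℂ) := by
  unfold dual
  rcases eq_or_ne a 0 with rfl | ha
  · rw [norm_zero, zero_mul, Real.zero_rpow (by linarith)]; simp
  · have : 0 < ‖a‖ := norm_pos_iff.2 ha
    rw [← mul_assoc, Complex.mul_conj, Complex.normSq_eq_norm_sq, ← Complex.ofReal_mul]
    congr 1
    rw [← Real.rpow_natCast, ← Real.rpow_add this]
    congr 1; push_cast; ring

lemma dual_zero {p : ℝ} : dual p 0 = 0 := by simp [dual]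

lemma dual_cont {p : ℝ} (hp : 1 < p) : Continuous (dual p) := by
  rw [continuous_iff_continuousAt]
  intro a
  rcases eq_or_ne a 0 with rfl | ha
  · unfold ContinuousAt
    rw [dual_zero, tendsto_zero_iff_norm_tendsto_zero]
    simp only [dual_norm hp]
    have : Continuous fun a : ℂ => ‖a‖ ^ (p - 1) :=
      continuous_norm.rpow_const fun _ => Or.inr (by linarith)
    have h := this.tendsto 0
    simpa [Real.zero_rpow (by linarith : p - 1 ≠ 0)] using h
  · unfold dual
    have h1 : ContinuousAt (fun a : ℂ => ‖a‖ ^ (p - 2)) a :=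
      continuous_norm.continuousAt.rpow_const (Or.inl (norm_ne_zero_iff.2 ha))
    have h2 : ContinuousAt (fun a : ℂ => (starRingEnd ℂ) a) a := Complex.continuous_conj.continuousAt
    exact h2.mul (Complex.continuous_ofReal.continuousAt.comp h1)

lemma planar_sq (p : ℝ) (hp : 1 < p) : ∃ C > 0, ∀ g : ℝ × ℝ → ℂ, ContDiff ℝ 1 g →
    HasCompactSupport g → tsupport g ⊆ sqO →
    ∫ w, ‖dD g w‖ ^ p ≤ C * ∫ w, ‖dB g w‖ ^ p := by
  obtain ⟨C, hC, H⟩ := bilin_R2 p hp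
  have hp1 : 0 < p - 1 := by linarith
  set δ : ℝ := (1 / (2 * C)) ^ (p - 1) with hδ
  have δ0 : 0 < δ := by positivity
  have δq : δ ^ (p / (p - 1)) = δ * (1 / (2 * C)) := by
    rw [show p / (p - 1) = 1 + 1 / (p - 1) by field_simp; ring, Real.rpow_add δ0, Real.rpow_one]
    congr 1
    rw [hδ, ← Real.rpow_mul (by positivity), mul_one_div_cancel hp1.ne', Real.rpow_one]
  refine ⟨2 * C / δ, by positivity, fun g hg sg tg => ?_⟩
  set ψ : ℝ × ℝ → ℂ := fun w => (δ : ℂ) * dual p (dD g w) with hψ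
  have cψ : Continuous ψ := continuous_const.mul ((dual_cont hp).comp (dD_cont hg))
  have tψ : Function.support ψ ⊆ Function.support (dD g) := by
    intro w hw h
    apply hw
    simp only [hψ, h, dual_zero, mul_zero]
  have h := H g ψ hg sg tg cψ (cs_of_supp sg (tψ.trans (dD_supp g)))
    ((tψ.trans (dD_supp g)).trans tg)
  have e1 : ∀ w, dD g w * ψ w = ((δ * ‖dD g w‖ ^ p : ℝ) : ℂ) := by
    intro w
    rw [Complex.ofReal_mul, ← dual_mul hp]; simp only [hψ]; ring
  have e2 : ∀ w, ‖ψ w‖ ^ (p / (p - 1)) = δ * (1 / (2 * C)) * ‖dD g w‖ ^ p := by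
    intro w
    simp only [hψ]
    rw [norm_mul, dual_norm hp, Complex.norm_real, Real.norm_of_nonneg δ0.le,
      Real.mul_rpow δ0.le (by positivity), δq, ← Real.rpow_mul (norm_nonneg _),
      mul_div_cancel₀ _ hp1.ne']
  simp only [e1, e2] at h
  rw [integral_complex_ofReal, Complex.norm_real, integral_const_mul, integral_const_mul] at h
  set A := ∫ w, ‖dD g w‖ ^ p
  set B := ∫ w, ‖dB g w‖ ^ p
  have h' : δ * A ≤ C * (B + δ * (1 / (2 * C)) * A) := (le_abs_self _).trans h
  have e3 : C * (B + δ * (1 / (2 * C)) * A) = C * B + δ * A / 2 := by field_simp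
  rw [e3] at h'
  rw [div_mul_eq_mul_div, le_div_iff₀ δ0]
  linarith

lemma planar_Lp (p : ℝ) (hp : 1 < p) : ∃ C > 0, ∀ g : ℝ × ℝ → ℂ, ContDiff ℝ 1 g →
    HasCompactSupport g →
    ∫ w, ‖dD g w‖ ^ p ≤ C * ∫ w, ‖dB g w‖ ^ p := by
  obtain ⟨C, hC, H⟩ := planar_sq p hp
  refine ⟨C, hC, fun g hg sg => ?_⟩
  obtain ⟨R0, hR0⟩ := sg.isCompact.isBounded.subset_closedBall 0
  set R : ℝ := max R0 1 with hR
  have R1 : 0 < R := lt_of_lt_of_le one_pos (le_max_right _ _)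
  have hRb : tsupport g ⊆ closedBall 0 R := hR0.trans (closedBall_subset_closedBall (le_max_left _ _))
  set G : ℝ × ℝ → ℂ := fun w => g (R • w) with hG
  have cG : ContDiff ℝ 1 G := hg.comp (contDiff_const_smul R)
  have sG' : Function.support G ⊆ closedBall 0 1 := by
    intro w hw
    have h1 : R • w ∈ closedBall (0 : ℝ × ℝ) R := hRb (subset_tsupport g hw)
    rw [mem_closedBall_zero_iff, norm_smul, Real.norm_of_nonneg R1.le] at h1
    rw [mem_closedBall_zero_iff]
    by_contra h2
    push Not at h2
    nlinarith
  have tG : tsupport G ⊆ closedBall 0 1 := closure_minimal sG' isClosed_closedBall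
  have sG : HasCompactSupport G := (isCompact_closedBall 0 1).of_isClosed_subset (isClosed_tsupport _) tG
  have tO : tsupport G ⊆ sqO := by
    refine tG.trans fun w hw => ?_
    rw [mem_closedBall_zero_iff, Prod.norm_def, max_le_iff, Real.norm_eq_abs, Real.norm_eq_abs,
      abs_le, abs_le] at hw
    have := Real.pi_gt_three
    exact ⟨⟨by linarith [hw.1.1], by linarith [hw.1.2]⟩, ⟨by linarith [hw.2.1], by linarith [hw.2.2]⟩⟩
  have h := H G cG sG tO
  have fd : ∀ w v, fderiv ℝ G w v = R * fderiv ℝ g (R • w) v := by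
    intro w v
    have : HasFDerivAt G ((fderiv ℝ g (R • w)).comp (R • ContinuousLinearMap.id ℝ (ℝ × ℝ))) w :=
      HasFDerivAt.comp w ((hg.differentiable (by norm_num)) (R • w)).hasFDerivAt
        ((hasFDerivAt_id w).const_smul R)
    rw [this.fderiv]
    simp
  have f1 : ∀ w, ‖dD G w‖ ^ p = R ^ p * ‖dD g (R • w)‖ ^ p := by
    intro w
    have : dD G w = R * dD g (R • w) := by unfold dD; rw [fd, fd]; ring
    rw [this, norm_mul, Complex.norm_real, Real.norm_of_nonneg R1.le,
      Real.mul_rpow R1.le (norm_nonneg _)]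
  have f2 : ∀ w, ‖dB G w‖ ^ p = R ^ p * ‖dB g (R • w)‖ ^ p := by
    intro w
    have : dB G w = R * dB g (R • w) := by unfold dB; rw [fd, fd]; ring
    rw [this, norm_mul, Complex.norm_real, Real.norm_of_nonneg R1.le,
      Real.mul_rpow R1.le (norm_nonneg _)]
  simp only [f1, f2] at h
  rw [integral_const_mul, integral_const_mul,
    Measure.integral_comp_smul volume (fun w => ‖dD g w‖ ^ p) R,
    Measure.integral_comp_smul volume (fun w => ‖dB g w‖ ^ p) R, smul_eq_mul, smul_eq_mul] at h
  have hK : 0 < R ^ p * |(R ^ Module.finrank ℝ (ℝ × ℝ))⁻¹| := by positivity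
  refine le_of_mul_le_mul_left ?_ hK
  linarith

/-- One complex variable. -/
lemma complex_Lp (p : ℝ) (hp : 1 < p) : ∃ C > 0, ∀ g : ℂ → ℂ, ContDiff ℝ 1 g →
    HasCompactSupport g →
    ∫ w, ‖(1 / 2 : ℂ) * (fderiv ℝ g w 1 - Complex.I * fderiv ℝ g w Complex.I)‖ ^ p
      ≤ C * ∫ w, ‖(1 / 2 : ℂ) * (fderiv ℝ g w 1 + Complex.I * fderiv ℝ g w Complex.I)‖ ^ p := by
  obtain ⟨C, hC, H⟩ := planar_Lp p hp
  refine ⟨C, hC, fun g hg sg => ?_⟩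
  set e := Complex.equivRealProdCLM with he
  have hm : MeasurePreserving (fun w : ℝ × ℝ => e.symm w) volume volume :=
    Complex.volume_preserving_equiv_real_prod.symm
  have hme : MeasurableEmbedding (fun w : ℝ × ℝ => e.symm w) :=
    Complex.measurableEquivRealProd.symm.measurableEmbedding
  have h := H (fun w => g (e.symm w)) (hg.comp e.symm.contDiff)
    (sg.comp_homeomorph e.symm.toHomeomorph)
  have fd : ∀ w v, fderiv ℝ (fun w => g (e.symm w)) w v = fderiv ℝ g (e.symm w) (e.symm v) := by
    intro w v
    have := HasFDerivAt.comp w ((hg.differentiable (by norm_num)) (e.symm w)).hasFDerivAt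
        e.symm.hasFDerivAt
    exact congrArg (fun L => L v) this.fderiv
  have e1 : e.symm (1, 0) = 1 := by
    apply Complex.ext <;> simp [he, Complex.equivRealProdCLM_symm_apply]
  have e2 : e.symm (0, 1) = Complex.I := by
    apply Complex.ext <;> simp [he, Complex.equivRealProdCLM_symm_apply]
  simp only [dD, dB, fd, e1, e2] at h
  rw [hm.integral_comp hme
      (fun w => ‖(1 / 2 : ℂ) * (fderiv ℝ g w 1 - Complex.I * fderiv ℝ g w Complex.I)‖ ^ p),
    hm.integral_comp hme
      (fun w => ‖(1 / 2 : ℂ) * (fderiv ℝ g w 1 + Complex.I * fderiv ℝ g w Complex.I)‖ ^ p)] at h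
  exact h

end PlanarLp


section ManyVariables

/-- Directional Wirtinger-type derivatives on `Fin n → ℂ`; `s = -I` or `s = I`. -/
noncomputable def pD {n : ℕ} (s : ℂ) (F : (Fin n → ℂ) → ℂ) (j : Fin n) (w : Fin n → ℂ) : ℂ :=
  (1 / 2 : ℂ) * (fderiv ℝ F w (Pi.single j 1) + s * fderiv ℝ F w (Pi.single j Complex.I))

lemma pD_cont {n : ℕ} (s : ℂ) {F : (Fin n → ℂ) → ℂ} (hF : ContDiff ℝ 1 F) (j : Fin n) :
    Continuous (pD s F j) := by
  have h : ∀ v, Continuous fun w => fderiv ℝ F w v := fun v =>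
    (hF.continuous_fderiv (by norm_num)).clm_apply continuous_const
  have h1 := h (Pi.single j 1)
  have h2 := h (Pi.single j Complex.I)
  unfold pD; fun_prop

lemma pD_supp {n : ℕ} (s : ℂ) (F : (Fin n → ℂ) → ℂ) (j : Fin n) :
    Function.support (pD s F j) ⊆ tsupport F := by
  intro w hw
  by_contra h
  apply hw
  have : fderiv ℝ F w = 0 := by
    by_contra h'
    exact h (support_fderiv_subset ℝ h')
  simp [pD, this]

lemma pow_int {E : Type*} [TopologicalSpace E] [T2Space E] [MeasurableSpace E]
    [OpensMeasurableSpace E] {μ : Measure E} [IsFiniteMeasureOnCompacts μ] {h : E → ℂ}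
    (hc : Continuous h) (hs : HasCompactSupport h) {p : ℝ} (hp : 0 < p) :
    Integrable (fun x => ‖h x‖ ^ p) μ := by
  apply Continuous.integrable_of_hasCompactSupport
  · exact hc.norm.rpow_const fun _ => Or.inr hp.le
  · exact hs.comp_left (g := fun a : ℂ => ‖a‖ ^ p) (by simp [Real.zero_rpow hp.ne'])

lemma slice_fderiv {n : ℕ} {F : (Fin n → ℂ) → ℂ} (hF : ContDiff ℝ 1 F) (x : Fin n → ℂ) (j : Fin n)
    (z v : ℂ) : fderiv ℝ (fun z => F (Function.update x j z)) z v =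
      fderiv ℝ F (Function.update x j z) (Pi.single j v) := by
  have := HasFDerivAt.comp z ((hF.differentiable (by norm_num)) (Function.update x j z)).hasFDerivAt
    (hasFDerivAt_update (𝕜 := ℝ) x z)
  have h2 := congrArg (fun L => L v) this.fderiv
  refine h2.trans ?_
  simp only [ContinuousLinearMap.comp_apply]
  congr 1
  ext i
  rcases eq_or_ne i j with rfl | hij
  · simp
  · simp [hij]

lemma pi_Lp (p : ℝ) (hp : 1 < p) : ∃ C > 0, ∀ (n : ℕ) (F : (Fin n → ℂ) → ℂ), ContDiff ℝ 1 F →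
    HasCompactSupport F → ∀ j,
    ∫ w, ‖pD (-Complex.I) F j w‖ ^ p ≤ C * ∫ w, ‖pD Complex.I F j w‖ ^ p := by
  obtain ⟨C, hC, H⟩ := complex_Lp p hp
  have hp0 : 0 < p := by linarith
  refine ⟨C, hC, fun n F hF sF j => ?_⟩
  have c : ∀ s, Continuous (pD s F j) := fun s => pD_cont s hF j
  have cs : ∀ s, HasCompactSupport (pD s F j) := fun s => cs_of_supp sF (pD_supp s F j)
  have i : ∀ s, Integrable (fun w => ‖pD s F j w‖ ^ p) := fun s => pow_int (c s) (cs s) hp0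
  have m : ∀ s, Measurable fun w => ENNReal.ofReal (‖pD s F j w‖ ^ p) := fun s =>
    ((c s).norm.rpow_const fun _ => Or.inr hp0.le).measurable.ennreal_ofReal
  have key : ∫⁻ w, ENNReal.ofReal (‖pD (-Complex.I) F j w‖ ^ p)
      ≤ ∫⁻ w, ENNReal.ofReal C * ENNReal.ofReal (‖pD Complex.I F j w‖ ^ p) := by
    rw [volume_pi]
    apply lintegral_le_of_lmarginal_le {j} (m _) ((m _).const_mul _)
    intro x
    rw [lmarginal_singleton, lmarginal_singleton]
    simp only
    rw [lintegral_const_mul _ (by exact (m Complex.I).comp (measurable_update x))]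
    have sl := H (fun z => F (Function.update x j z))
      (hF.comp (contDiff_update 1 x j))
      (HasCompactSupport.intro (sF.isCompact.image (continuous_apply j)) (fun z hz => by
        by_contra h'
        exact hz ⟨Function.update x j z, subset_tsupport _ h', by simp⟩))
    simp only [slice_fderiv hF] at sl
    have e1 : ∀ z, ‖(1 / 2 : ℂ) * (fderiv ℝ F (Function.update x j z) (Pi.single j 1)
        - Complex.I * fderiv ℝ F (Function.update x j z) (Pi.single j Complex.I))‖ ^ p
        = ‖pD (-Complex.I) F j (Function.update x j z)‖ ^ p := by
      intro z; unfold pD; congr 2; ring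
    have e2 : ∀ z, ‖(1 / 2 : ℂ) * (fderiv ℝ F (Function.update x j z) (Pi.single j 1)
        + Complex.I * fderiv ℝ F (Function.update x j z) (Pi.single j Complex.I))‖ ^ p
        = ‖pD Complex.I F j (Function.update x j z)‖ ^ p := by
      intro z; unfold pD; rfl
    simp only [e1, e2] at sl
    have ii : ∀ s, Integrable (fun z => ‖pD s F j (Function.update x j z)‖ ^ p) := by
      intro s
      apply pow_int ((c s).comp (continuous_const.update j continuous_id)) _ hp0
      exact HasCompactSupport.intro ((cs s).isCompact.image (continuous_apply j)) (fun z hz => by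
        by_contra h'
        exact hz ⟨Function.update x j z, subset_tsupport _ h', by simp⟩)
    rw [← ofReal_integral_eq_lintegral_ofReal (ii _)
        (Filter.Eventually.of_forall fun z => by positivity),
      ← ofReal_integral_eq_lintegral_ofReal (ii _)
        (Filter.Eventually.of_forall fun z => by positivity), ← ENNReal.ofReal_mul hC.le]
    exact ENNReal.ofReal_le_ofReal sl
  rw [lintegral_const_mul _ (m _), ← ofReal_integral_eq_lintegral_ofReal (i _)
        (Filter.Eventually.of_forall fun z => by positivity),
      ← ofReal_integral_eq_lintegral_ofReal (i _)
        (Filter.Eventually.of_forall fun z => by positivity), ← ENNReal.ofReal_mul hC.le,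
      ENNReal.ofReal_le_ofReal_iff (mul_nonneg hC.le (integral_nonneg fun z => by positivity))] at key
  exact key

lemma sqrt_le_pow {n : ℕ} {p : ℝ} (hp : 1 < p) (a : Fin n → ℂ) :
    (Real.sqrt (∑ j, ‖a j‖ ^ 2)) ^ p ≤ (n : ℝ) ^ (p - 1) * ∑ j, ‖a j‖ ^ p := by
  have h1 : Real.sqrt (∑ j, ‖a j‖ ^ 2) ≤ ∑ j, ‖a j‖ := by
    rw [Real.sqrt_le_left (Finset.sum_nonneg fun j _ => norm_nonneg _)]
    exact Finset.sum_sq_le_sq_sum_of_nonneg fun j _ => norm_nonneg _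
  have h2 := Real.rpow_sum_le_const_mul_sum_rpow_of_nonneg (p := p) (f := fun j => ‖a j‖)
    Finset.univ hp.le (fun j _ => norm_nonneg _)
  rw [Finset.card_univ, Fintype.card_fin] at h2
  exact (Real.rpow_le_rpow (Real.sqrt_nonneg _) h1 (by linarith)).trans h2

lemma pow_le_sqrt {n : ℕ} {p : ℝ} (hp : 1 < p) (a : Fin n → ℂ) (j : Fin n) :
    ‖a j‖ ^ p ≤ (Real.sqrt (∑ j, ‖a j‖ ^ 2)) ^ p := by
  apply Real.rpow_le_rpow (norm_nonneg _) _ (by linarith)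
  apply Real.le_sqrt_of_sq_le
  exact Finset.single_le_sum (f := fun j => ‖a j‖ ^ 2) (fun j _ => by positivity) (Finset.mem_univ j)

lemma sqrt_int {n : ℕ} {p : ℝ} (hp : 1 < p) {h : Fin n → (Fin n → ℂ) → ℂ}
    (hc : ∀ j, Continuous (h j)) (hs : ∀ j, HasCompactSupport (h j)) :
    Integrable (fun w => (Real.sqrt (∑ j, ‖h j w‖ ^ 2)) ^ p) := by
  have hc' : Continuous (fun w => (Real.sqrt (∑ j, ‖h j w‖ ^ 2)) ^ p) :=
    (by fun_prop : Continuous fun w => Real.sqrt (∑ j, ‖h j w‖ ^ 2)).rpow_const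
      fun _ => Or.inr (by linarith)
  refine Integrable.mono' (g := fun w => (n : ℝ) ^ (p - 1) * ∑ j, ‖h j w‖ ^ p) ?_
    hc'.aestronglyMeasurable ?_
  · exact (integrable_finsetSum _ fun j _ => pow_int (hc j) (hs j) (by linarith)).const_mul _
  · refine Filter.Eventually.of_forall fun w => ?_
    rw [Real.norm_of_nonneg (by positivity)]
    exact sqrt_le_pow hp fun j => h j w

lemma pi_main (p : ℝ) (hp : 1 < p) (n : ℕ) : ∃ K > 0, ∀ (F : (Fin n → ℂ) → ℂ), ContDiff ℝ 1 F →
    HasCompactSupport F →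
    ∫ w, (Real.sqrt (∑ j, ‖pD (-Complex.I) F j w‖ ^ 2)) ^ p
      ≤ K * ∫ w, (Real.sqrt (∑ j, ‖pD Complex.I F j w‖ ^ 2)) ^ p := by
  obtain ⟨C, hC, H⟩ := pi_Lp p hp
  have hp0 : 0 < p := by linarith
  refine ⟨(n : ℝ) ^ (p - 1) * (n * C) + 1, by positivity, fun F hF sF => ?_⟩
  have c : ∀ s j, Continuous (pD s F j) := fun s j => pD_cont s hF j
  have cs : ∀ s j, HasCompactSupport (pD s F j) := fun s j => cs_of_supp sF (pD_supp s F j)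
  have i : ∀ s j, Integrable (fun w => ‖pD s F j w‖ ^ p) := fun s j => pow_int (c s j) (cs s j) hp0
  set B := ∫ w, (Real.sqrt (∑ j, ‖pD Complex.I F j w‖ ^ 2)) ^ p with hB
  have B0 : 0 ≤ B := integral_nonneg fun w => by positivity
  calc ∫ w, (Real.sqrt (∑ j, ‖pD (-Complex.I) F j w‖ ^ 2)) ^ p
      ≤ ∫ w, (n : ℝ) ^ (p - 1) * ∑ j, ‖pD (-Complex.I) F j w‖ ^ p := by
        apply integral_mono (sqrt_int hp (c _) (cs _))
        · exact (integrable_finsetSum _ fun j _ => i _ j).const_mul _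
        · exact fun w => sqrt_le_pow hp fun j => pD (-Complex.I) F j w
    _ = (n : ℝ) ^ (p - 1) * ∑ j, ∫ w, ‖pD (-Complex.I) F j w‖ ^ p := by
        rw [integral_const_mul, integral_finsetSum _ fun j _ => i _ j]
    _ ≤ (n : ℝ) ^ (p - 1) * ∑ j : Fin n, C * B := by
        gcongr with j
        refine (H n F hF sF j).trans ?_
        gcongr
        apply integral_mono (i _ j) (sqrt_int hp (c _) (cs _))
        exact fun w => pow_le_sqrt hp (fun j => pD Complex.I F j w) j
    _ = (n : ℝ) ^ (p - 1) * (n * C) * B := by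
        rw [Finset.sum_const, Finset.card_univ, Fintype.card_fin, nsmul_eq_mul]; ring
    _ ≤ ((n : ℝ) ^ (p - 1) * (n * C) + 1) * B := by nlinarith

noncomputable def eE (n : ℕ) : EuclideanSpace ℂ (Fin n) ≃L[ℝ] (Fin n → ℂ) :=
  PiLp.continuousLinearEquiv 2 ℝ (fun _ : Fin n => ℂ)

lemma vol_transfer (n : ℕ) : ∃ c : ℝ, 0 ≤ c ∧ ∀ h : EuclideanSpace ℂ (Fin n) → ℝ,
    ∫ z, h z = c * ∫ w, h ((eE n).symm w) := by
  let μ : Measure (EuclideanSpace ℂ (Fin n)) := (volume : Measure (Fin n → ℂ)).map (eE n).symm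
  have hμ : μ.IsAddHaarMeasure := (eE n).symm.isAddHaarMeasure_map volume
  have h1 := Measure.isAddLeftInvariant_eq_smul (volume : Measure (EuclideanSpace ℂ (Fin n))) μ
  refine ⟨(Measure.addHaarScalarFactor (volume : Measure (EuclideanSpace ℂ (Fin n))) μ : ℝ),
    NNReal.coe_nonneg _, fun h => ?_⟩
  have h2 : ∫ z, h z ∂μ = ∫ w, h ((eE n).symm w) :=
    (eE n).symm.toHomeomorph.measurableEmbedding.integral_map h
  have h3 := congrArg (fun m : Measure (EuclideanSpace ℂ (Fin n)) => ∫ z, h z ∂m) h1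
  simp only [integral_smul_nnreal_measure] at h3
  rw [← h2, h3]
  rfl

lemma wD_eq {n : ℕ} {f : EuclideanSpace ℂ (Fin n) → ℂ} (hf : ContDiff ℝ 1 f) (w : Fin n → ℂ)
    (j : Fin n) (v : ℂ) : fderiv ℝ (fun w => f ((eE n).symm w)) w (Pi.single j v) =
      fderiv ℝ f ((eE n).symm w) (EuclideanSpace.single j v) := by
  have := HasFDerivAt.comp w ((hf.differentiable (by norm_num)) ((eE n).symm w)).hasFDerivAt
    (eE n).symm.hasFDerivAt
  exact congrArg (fun L => L (Pi.single j v)) this.fderiv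

end ManyVariables


theorem dbar_dominates_d_Lp
    (n : ℕ) (hn : 1 ≤ n) (p : ℝ) (hp1 : 1 < p) :
    ∃ δ > (0 : ℝ), ∀ f : EuclideanSpace ℂ (Fin n) → ℂ,
      ContDiff ℝ 1 f → HasCompactSupport f →
      δ * (∫ z : EuclideanSpace ℂ (Fin n),
            (Real.sqrt (∑ j : Fin n, ‖wirtingerD n f z j‖ ^ 2)) ^ p) ^ (1 / p)
        ≤ (∫ z : EuclideanSpace ℂ (Fin n),
            (Real.sqrt (∑ j : Fin n, ‖wirtingerDBar n f z j‖ ^ 2)) ^ p) ^ (1 / p) := by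
  obtain ⟨K, hK, H⟩ := pi_main p hp1 n
  obtain ⟨c, hc, T⟩ := vol_transfer n
  have hp0 : 0 < p := by linarith
  refine ⟨(K⁻¹) ^ (1 / p), by positivity, fun f hf sf => ?_⟩
  have h := H (fun w => f ((eE n).symm w)) (hf.comp (eE n).symm.contDiff)
    (sf.comp_homeomorph (eE n).symm.toHomeomorph)
  rw [T, T]
  have e1 : ∀ w j, pD (-Complex.I) (fun w => f ((eE n).symm w)) j w
      = wirtingerD n f ((eE n).symm w) j := by
    intro w j
    unfold pD wirtingerD
    rw [wD_eq hf, wD_eq hf]; ring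
  have e2 : ∀ w j, pD (Complex.I) (fun w => f ((eE n).symm w)) j w
      = wirtingerDBar n f ((eE n).symm w) j := by
    intro w j
    unfold pD wirtingerDBar
    rw [wD_eq hf, wD_eq hf]
  simp only [e1, e2] at h
  set A := ∫ w, (Real.sqrt (∑ j : Fin n, ‖wirtingerD n f ((eE n).symm w) j‖ ^ 2)) ^ p
  set B := ∫ w, (Real.sqrt (∑ j : Fin n, ‖wirtingerDBar n f ((eE n).symm w) j‖ ^ 2)) ^ p
  have A0 : 0 ≤ A := integral_nonneg fun w => by positivity
  rw [← Real.mul_rpow (by positivity) (by positivity)]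
  apply Real.rpow_le_rpow (by positivity) _ (by positivity)
  rw [inv_mul_le_iff₀ hK]
  nlinarith [mul_le_mul_of_nonneg_left h hc]
end

section
/- Let n ≥ 1 and let f : ℂⁿ → ℂ be a compactly supported continuously differentiable function. Then for every z ∈ ℂⁿ, |f(z)| ≤ (n!/πⁿ) · ∫_{ℂⁿ} |∂̄f(ζ)| · |ζ − z|^{1−2n} dV(ζ), where |∂̄f(ζ)| = (∑ⱼ₌₁ⁿ |∂f/∂ζ̄_j(ζ)|²)^{1/2}. (The pointwise Bochner–Martinelli estimate derived from Lemma 9.2 and used in the proof of the L¹ ∂̄-Sobolev inequality.) -/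
open Metric MeasureTheory

set_option linter.unusedSectionVars false

section gen
open Set
variable {E : Type*} [NormedAddCommGroup E] [InnerProductSpace ℝ E] [FiniteDimensional ℝ E]
  [MeasurableSpace E] [BorelSpace E] [Nontrivial E]

lemma bm_dom_integrable (C R : ℝ) :
    Integrable (fun x : E => (Iio R).indicator
      (fun y : ℝ => (y ^ Module.finrank ℝ E)⁻¹ * (C * y)) ‖x‖) volume := by
  rw [integrable_fun_norm_addHaar (volume : Measure E)
    (f := (Iio R).indicator (fun y : ℝ => (y ^ Module.finrank ℝ E)⁻¹ * (C * y)))]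
  have h1 : IntegrableOn ((Ioo 0 R).indicator (fun _ : ℝ => C)) (Ioi 0) := by
    apply Integrable.integrableOn
    rw [integrable_indicator_iff measurableSet_Ioo]
    simp
  refine h1.congr_fun ?_ measurableSet_Ioi
  intro y hy
  have hy : 0 < y := hy
  have hd : 0 < Module.finrank ℝ E := Module.finrank_pos
  by_cases hyR : y < R
  · simp only [indicator, mem_Ioo, hy, hyR, and_self, if_true, mem_Iio, smul_eq_mul]
    obtain ⟨m, hm⟩ : ∃ m, Module.finrank ℝ E = m + 1 := ⟨_, (Nat.succ_pred_eq_of_pos hd).symm⟩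
    rw [hm, Nat.add_sub_cancel]
    field_simp
    ring
  · simp [indicator, hyR]

lemma bm_norm_le (h : E → ℂ) (C R : ℝ) (hC : ∀ x, ‖h x‖ ≤ C * ‖x‖)
    (hR : ∀ x, R ≤ ‖x‖ → h x = 0) (x : E) :
    ‖(‖x‖ ^ Module.finrank ℝ E)⁻¹ • h x‖ ≤ (Iio R).indicator
      (fun y : ℝ => (y ^ Module.finrank ℝ E)⁻¹ * (C * y)) ‖x‖ := by
  by_cases hx : ‖x‖ < R
  · simp only [indicator, mem_Iio, hx, if_true, norm_smul, norm_inv, norm_pow, norm_norm]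
    gcongr
    exact hC x
  · simp [indicator, hx, hR x (not_lt.1 hx)]

lemma bm_integrable (h : E → ℂ) (hc : Continuous h) (C R : ℝ) (hC : ∀ x, ‖h x‖ ≤ C * ‖x‖)
    (hR : ∀ x, R ≤ ‖x‖ → h x = 0) :
    Integrable (fun x : E => (‖x‖ ^ Module.finrank ℝ E)⁻¹ • h x) volume := by
  refine (bm_dom_integrable (E := E) C R).mono' ?_ (.of_forall (bm_norm_le h C R hC hR))
  apply Measurable.aestronglyMeasurable
  have := hc.measurable
  fun_prop

lemma bm_radial (f : E → ℂ) (hf : ContDiff ℝ 1 f) (hs : HasCompactSupport f)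
    (hi : Integrable (fun x : E => (‖x‖ ^ Module.finrank ℝ E)⁻¹ • fderiv ℝ f x x) volume) :
    ∫ x : E, (‖x‖ ^ Module.finrank ℝ E)⁻¹ • fderiv ℝ f x x =
      - ((Module.finrank ℝ E * volume.real (ball (0 : E) 1) : ℝ) • f 0) := by
  set d := Module.finrank ℝ E with hd
  have hd0 : 0 < d := Module.finrank_pos
  set G : E → ℂ := fun x : E => (‖x‖ ^ d)⁻¹ • fderiv ℝ f x x with hG
  have mp := (volume : Measure E).measurePreserving_homeomorphUnitSphereProd
  set Φ : sphere (0 : E) 1 × Ioi (0 : ℝ) → ℂ := fun p => G (p.2.1 • p.1.1) with hΦ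
  have hcomp : ∀ x : ({0}ᶜ : Set E), Φ (homeomorphUnitSphereProd E x) = G x := by
    intro x
    have := (homeomorphUnitSphereProd E).symm_apply_apply x
    have h2 := congrArg Subtype.val this
    rw [homeomorphUnitSphereProd_symm_apply_coe] at h2
    simp only [hΦ]
    rw [h2]
  have hΦi : Integrable Φ ((volume : Measure E).toSphere.prod (.volumeIoiPow (d - 1))) := by
    rw [← mp.integrable_comp_emb (Homeomorph.measurableEmbedding _)]
    have : Φ ∘ (homeomorphUnitSphereProd E) = G ∘ Subtype.val := funext hcomp
    rw [this, ← integrableOn_iff_comap_subtypeVal (measurableSet_singleton _).compl]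
    exact hi.integrableOn
  have inner : ∀ v : sphere (0 : E) 1,
      ∫ r : Ioi (0 : ℝ), Φ (v, r) ∂(.volumeIoiPow (d - 1)) = - f 0 := by
    intro v
    have hv : ‖v.1‖ = 1 := by simp
    simp only [Measure.volumeIoiPow, ENNReal.ofReal]
    rw [integral_withDensity_eq_integral_smul]
    · rw [integral_subtype_comap measurableSet_Ioi
        fun a : ℝ ↦ Real.toNNReal (a ^ (d - 1)) • G (a • v.1)]
      have hc1 : ContDiff ℝ 1 (fun r : ℝ => f (r • v.1)) := by fun_prop
      have hcs : HasCompactSupport (fun r : ℝ => f (r • v.1)) := by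
        obtain ⟨R, hR⟩ := hs.isCompact.isBounded.exists_norm_le
        refine HasCompactSupport.of_support_subset_isCompact (isCompact_Icc (a := -R) (b := R)) ?_
        intro r hr
        have := hR _ (subset_tsupport _ hr)
        rw [norm_smul, hv, mul_one, Real.norm_eq_abs] at this
        exact abs_le.1 this
      have key := HasCompactSupport.integral_Ioi_deriv_eq hc1 hcs 0
      simp only [zero_smul] at key
      rw [← key]
      apply setIntegral_congr_fun measurableSet_Ioi
      intro r hr
      have hr : 0 < r := hr
      have hder : HasDerivAt (fun r : ℝ => f (r • v.1)) (fderiv ℝ f (r • v.1) v.1) r := by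
        have h1 := (hf.differentiable (by norm_num) (r • v.1)).hasFDerivAt
        have h2 : HasDerivAt (fun r : ℝ => r • v.1) v.1 r := by
          simpa using (hasDerivAt_id r).smul_const v.1
        exact h1.comp_hasDerivAt r h2
      simp only
      rw [hder.deriv, NNReal.smul_def, Real.coe_toNNReal _ (by positivity)]
      simp only [hG, norm_smul, hv, mul_one, map_smul, Real.norm_eq_abs, abs_of_pos hr]
      rw [smul_smul, smul_smul]
      obtain ⟨m, hm⟩ : ∃ m, d = m + 1 := ⟨_, (Nat.succ_pred_eq_of_pos hd0).symm⟩
      rw [hm, Nat.add_sub_cancel]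
      have : r ^ m * (r ^ (m + 1))⁻¹ * r = 1 := by
        field_simp
        ring
      rw [this, one_smul]
    · exact (measurable_subtype_coe.pow_const _).real_toNNReal
  calc ∫ x : E, G x = ∫ x : ({(0)}ᶜ : Set E), G x.1 ∂((volume : Measure E).comap (↑)) := by
        rw [integral_subtype_comap (measurableSet_singleton _).compl G,
          restrict_compl_singleton]
    _ = ∫ p, Φ p ∂((volume : Measure E).toSphere.prod (.volumeIoiPow (d - 1))) := by
        rw [← mp.integral_comp (Homeomorph.measurableEmbedding _)]
        simp only [hcomp]
    _ = ∫ v, ∫ r, Φ (v, r) ∂(.volumeIoiPow (d - 1)) ∂(volume : Measure E).toSphere :=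
        integral_prod _ hΦi
    _ = _ := by
        simp only [inner, integral_const, Measure.toSphere_real_apply_univ, smul_neg]
        rfl

variable [NormedSpace ℂ E] [IsScalarTower ℝ ℂ E]

noncomputable def bmRot (θ : ℝ) : E ≃ₗᵢ[ℝ] E where
  toFun x := Complex.exp (θ * Complex.I) • x
  invFun x := Complex.exp (-(θ * Complex.I)) • x
  map_add' x y := smul_add _ _ _
  map_smul' r x := by
    simp only [RingHom.id_apply]
    rw [smul_comm]
  left_inv x := by simp [smul_smul, ← Complex.exp_add]
  right_inv x := by simp [smul_smul, ← Complex.exp_add]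
  norm_map' x := by
    change ‖Complex.exp (θ * Complex.I) • x‖ = ‖x‖
    rw [norm_smul, Complex.norm_exp_ofReal_mul_I, one_mul]

lemma bm_angular (f : E → ℂ) (hf : ContDiff ℝ 1 f) (C R : ℝ)
    (hC : ∀ x, ‖fderiv ℝ f x (Complex.I • x)‖ ≤ C * ‖x‖)
    (hR : ∀ x, R ≤ ‖x‖ → fderiv ℝ f x (Complex.I • x) = 0) :
    ∫ x : E, (‖x‖ ^ Module.finrank ℝ E)⁻¹ • fderiv ℝ f x (Complex.I • x) = 0 := by
  set d := Module.finrank ℝ E with hd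
  have hcD : Continuous (fun x : E => fderiv ℝ f x (Complex.I • x)) :=
    (hf.continuous_fderiv (by norm_num)).clm_apply (by fun_prop)
  set ψ : E → ℂ := fun x : E => (‖x‖ ^ d)⁻¹ • fderiv ℝ f x (Complex.I • x) with hψ
  have hψm : Measurable ψ := by
    have := hcD.measurable
    fun_prop
  have h1 : ∀ θ : ℝ, ∫ x, ψ (Complex.exp (θ * Complex.I) • x) = ∫ x, ψ x := fun θ =>
    (bmRot (E := E) θ).measurePreserving.integral_comp
      (bmRot (E := E) θ).toHomeomorph.measurableEmbedding ψ
  have hnorm : ∀ (θ : ℝ) (x : E), ‖Complex.exp (θ * Complex.I) • x‖ = ‖x‖ := fun θ x => by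
    rw [norm_smul, Complex.norm_exp_ofReal_mul_I, one_mul]
  have h2 : ∀ x : E, ∫ θ in (0 : ℝ)..(2 * Real.pi), ψ (Complex.exp (θ * Complex.I) • x) = 0 := by
    intro x
    simp only [hψ, hnorm]
    rw [intervalIntegral.integral_smul]
    have hder : ∀ θ : ℝ, HasDerivAt (fun θ : ℝ => f (Complex.exp (θ * Complex.I) • x))
        (fderiv ℝ f (Complex.exp (θ * Complex.I) • x)
          (Complex.I • Complex.exp (θ * Complex.I) • x)) θ := by
      intro θ
      have e1 := (hf.differentiable (by norm_num)
        (Complex.exp (θ * Complex.I) • x)).hasFDerivAt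
      have e2 : HasDerivAt (fun θ : ℝ => Complex.exp (θ * Complex.I))
          (Complex.I * Complex.exp (θ * Complex.I)) θ := by
        have := ((Complex.ofRealCLM.hasDerivAt (x := θ)).mul_const Complex.I).cexp
        simpa [mul_comm] using this
      have e3 := e2.smul_const x
      rw [mul_smul] at e3
      exact e1.comp_hasDerivAt θ e3
    rw [intervalIntegral.integral_eq_sub_of_hasDerivAt (fun θ _ => hder θ)]
    · simp [Complex.exp_two_pi_mul_I]
    · apply Continuous.intervalIntegrable
      exact hcD.comp (g := fun x : E => fderiv ℝ f x (Complex.I • x)) (by fun_prop)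
  have hint : Integrable (Function.uncurry fun (θ : ℝ) (x : E) =>
      ψ (Complex.exp (θ * Complex.I) • x))
      ((volume.restrict (uIoc 0 (2 * Real.pi))).prod volume) := by
    have : IsFiniteMeasure (volume.restrict (uIoc (0 : ℝ) (2 * Real.pi))) := by
      rw [uIoc_of_le (by positivity)]
      infer_instance
    have hdom := (bm_dom_integrable (E := E) C R).comp_snd
      (volume.restrict (uIoc (0 : ℝ) (2 * Real.pi)))
    refine hdom.mono' ?_ (.of_forall ?_)
    · apply Measurable.aestronglyMeasurable
      apply hψm.comp
      apply Continuous.measurable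
      fun_prop
    · rintro ⟨θ, x⟩
      have := bm_norm_le _ C R hC hR (Complex.exp (θ * Complex.I) • x)
      rw [hnorm] at this
      simpa only [Function.uncurry, hψ, hnorm] using this
  have h3 := intervalIntegral_integral_swap hint
  simp only [h1, h2, intervalIntegral.integral_const, integral_zero, sub_zero] at h3
  rcases smul_eq_zero.1 h3 with h | h
  · exact absurd h (by positivity)
  · exact h
end gen

lemma bm_algebra (n : ℕ) (L : EuclideanSpace ℂ (Fin n) →L[ℝ] ℂ) (x : EuclideanSpace ℂ (Fin n)) :
    L x + Complex.I * L (Complex.I • x) =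
      ∑ j : Fin n, 2 * (starRingEnd ℂ (x j)) * ((1 / 2 : ℂ) * (L (EuclideanSpace.single j 1)
        + Complex.I * L (EuclideanSpace.single j Complex.I))) := by
  have hx : x = ∑ j : Fin n, ((x j).re • EuclideanSpace.single j (1 : ℂ)
      + (x j).im • EuclideanSpace.single j Complex.I) := by
    ext i
    simp [Finset.sum_apply, Pi.single_apply, Finset.sum_add_distrib, Complex.re_add_im]
  have hIx : Complex.I • x = ∑ j : Fin n, ((x j).re • EuclideanSpace.single j Complex.I
      - (x j).im • EuclideanSpace.single j (1 : ℂ)) := by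
    ext i
    simp [Finset.sum_apply, Pi.single_apply, Finset.sum_sub_distrib]
    apply Complex.ext <;> simp
  rw [hIx]
  nth_rewrite 1 [hx]
  simp only [map_sum, map_add, map_sub, map_smul, Finset.mul_sum, ← Finset.sum_add_distrib]
  refine Finset.sum_congr rfl fun j _ => ?_
  have hc : (starRingEnd ℂ) (x j) = (x j).re - (x j).im * Complex.I := by
    apply Complex.ext <;> simp
  rw [hc]
  simp only [Complex.real_smul]
  linear_combination (((x j).im : ℂ) * L (EuclideanSpace.single j Complex.I)) * Complex.I_sq

lemma bm_pointwise (n : ℕ) (f : EuclideanSpace ℂ (Fin n) → ℂ) (w x : EuclideanSpace ℂ (Fin n)) :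
    ‖fderiv ℝ f w x + Complex.I * fderiv ℝ f w (Complex.I • x)‖ ≤
      2 * (Real.sqrt (∑ j : Fin n, ‖wirtingerDBar n f w j‖ ^ 2) * ‖x‖) := by
  rw [bm_algebra]
  calc _ ≤ ∑ j : Fin n, 2 * (‖x j‖ * ‖wirtingerDBar n f w j‖) := by
        refine (norm_sum_le _ _).trans (Finset.sum_le_sum fun j _ => ?_)
        rw [norm_mul, norm_mul, RCLike.norm_conj]
        simp [wirtingerDBar, mul_assoc]
    _ = 2 * ∑ j : Fin n, ‖x j‖ * ‖wirtingerDBar n f w j‖ := by rw [Finset.mul_sum]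
    _ ≤ 2 * (‖x‖ * Real.sqrt (∑ j : Fin n, ‖wirtingerDBar n f w j‖ ^ 2)) := by
        rw [EuclideanSpace.norm_eq]
        gcongr
        exact Real.sum_mul_le_sqrt_mul_sqrt _ _ _
    _ = _ := by ring

theorem bochner_martinelli_pointwise_estimate
    (n : ℕ) (hn : 1 ≤ n) (f : EuclideanSpace ℂ (Fin n) → ℂ)
    (hf : ContDiff ℝ 1 f) (hsupp : HasCompactSupport f)
    (z : EuclideanSpace ℂ (Fin n)) :
    ‖f z‖ ≤ (n.factorial : ℝ) / Real.pi ^ n *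
      ∫ ζ : EuclideanSpace ℂ (Fin n),
        Real.sqrt (∑ j : Fin n, ‖wirtingerDBar n f ζ j‖ ^ 2) * ‖ζ - z‖ ^ ((1 : ℝ) - 2 * n) := by
  have : Nonempty (Fin n) := ⟨⟨0, hn⟩⟩
  have hd : Module.finrank ℝ (EuclideanSpace ℂ (Fin n)) = 2 * n := by
    rw [← Module.finrank_mul_finrank ℝ ℂ]
    simp
  set F : EuclideanSpace ℂ (Fin n) → ℂ := fun x => f (x + z) with hF
  have hF1 : ContDiff ℝ 1 F := by fun_prop
  have hFs : HasCompactSupport F := hsupp.comp_homeomorph (Homeomorph.addRight z)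
  have hFd : ∀ x, fderiv ℝ F x = fderiv ℝ f (x + z) := fun x => fderiv_comp_add_right z
  have hDs : HasCompactSupport (fderiv ℝ F) := hFs.fderiv ℝ
  have hDc : Continuous (fderiv ℝ F) := hF1.continuous_fderiv (by norm_num)
  obtain ⟨C, hC⟩ := hDc.bounded_above_of_compact_support hDs
  obtain ⟨R, hR⟩ := hDs.isCompact.isBounded.exists_norm_le
  have hR0 : ∀ x, R + 1 ≤ ‖x‖ → fderiv ℝ F x = 0 := by
    intro x hx
    by_contra hne
    have := hR x (subset_tsupport _ hne)
    linarith
  have hC1 : ∀ x, ‖fderiv ℝ F x x‖ ≤ C * ‖x‖ := fun x => (fderiv ℝ F x).le_of_opNorm_le (hC x) x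
  have hC2 : ∀ x, ‖fderiv ℝ F x (Complex.I • x)‖ ≤ C * ‖x‖ := fun x => by
    have := (fderiv ℝ F x).le_of_opNorm_le (hC x) (Complex.I • x)
    rwa [norm_smul, Complex.norm_I, one_mul] at this
  have hR1 : ∀ x, R + 1 ≤ ‖x‖ → fderiv ℝ F x x = 0 := fun x hx => by simp [hR0 x hx]
  have hR2 : ∀ x, R + 1 ≤ ‖x‖ → fderiv ℝ F x (Complex.I • x) = 0 := fun x hx => by
    simp [hR0 x hx]
  have i1 := bm_integrable (fun x => fderiv ℝ F x x) (hDc.clm_apply continuous_id) C (R + 1) hC1 hR1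
  have i2 := bm_integrable (fun x => fderiv ℝ F x (Complex.I • x))
    (hDc.clm_apply (by fun_prop)) C (R + 1) hC2 hR2
  have r1 := bm_radial F hF1 hFs i1
  have r2 := bm_angular F hF1 C (R + 1) hC2 hR2
  have r3 : ∫ x : EuclideanSpace ℂ (Fin n), ((‖x‖ ^ (2 * n))⁻¹ • fderiv ℝ F x x +
      Complex.I * ((‖x‖ ^ (2 * n))⁻¹ • fderiv ℝ F x (Complex.I • x))) =
      - ((2 * n * volume.real (ball (0 : EuclideanSpace ℂ (Fin n)) 1) : ℝ) • F 0) := by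
    rw [hd] at i1 i2 r1 r2
    rw [integral_add i1 (i2.const_mul _), integral_const_mul, r1, r2]
    simp
  have hvol : volume.real (ball (0 : EuclideanSpace ℂ (Fin n)) 1) = Real.pi ^ n / n.factorial := by
    rw [Measure.real, InnerProductSpace.volume_ball_of_dim_even hd]
    simp
    positivity
  set S : EuclideanSpace ℂ (Fin n) → ℝ := fun ζ =>
    Real.sqrt (∑ j : Fin n, ‖wirtingerDBar n f ζ j‖ ^ 2) with hS
  have hpow : ∀ x : EuclideanSpace ℂ (Fin n),
      ‖x‖ ^ ((1 : ℝ) - 2 * n) = (‖x‖ ^ (2 * n))⁻¹ * ‖x‖ := by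
    intro x
    have hn' : (1 : ℝ) ≤ n := by exact_mod_cast hn
    rcases (norm_nonneg x).eq_or_lt with h | h
    · rw [← h, Real.zero_rpow (by linarith), mul_zero]
    · rw [Real.rpow_sub h, Real.rpow_one, ← Real.rpow_natCast]
      push_cast
      rw [div_eq_mul_inv, mul_comm]
  have hshift : ∫ ζ, S ζ * ‖ζ - z‖ ^ ((1 : ℝ) - 2 * n) =
      ∫ x, S (x + z) * ‖x‖ ^ ((1 : ℝ) - 2 * n) := by
    rw [← integral_add_right_eq_self _ z]
    simp
  have hFc : Continuous (fderiv ℝ f) := hf.continuous_fderiv (by norm_num)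
  have hSc : Continuous S := by
    simp only [hS, wirtingerDBar]
    have (v : EuclideanSpace ℂ (Fin n)) : Continuous fun ζ => fderiv ℝ f ζ v :=
      hFc.clm_apply continuous_const
    fun_prop
  have hS0 : ∀ x, R + 1 ≤ ‖x‖ → S (x + z) = 0 := by
    intro x hx
    have := hR0 x hx
    rw [hFd] at this
    simp [hS, wirtingerDBar, this]
  have hScs : HasCompactSupport (fun x => S (x + z)) := by
    refine HasCompactSupport.of_support_subset_isCompact (isCompact_closedBall 0 (R + 1)) ?_
    intro x hx
    rw [mem_closedBall_zero_iff]
    by_contra! h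
    exact hx (hS0 x h.le)
  have hSz : Continuous fun x => S (x + z) := by fun_prop
  obtain ⟨K, hK⟩ := hSz.bounded_above_of_compact_support hScs
  have hint : Integrable (fun x => S (x + z) * ‖x‖ ^ ((1 : ℝ) - 2 * n)) volume := by
    have := (bm_integrable (fun x => ((S (x + z) * ‖x‖ : ℝ) : ℂ)) (by fun_prop) K (R + 1)
      (fun x => by
        rw [Complex.norm_real, norm_mul, norm_norm]
        gcongr
        exact hK x) (fun x hx => by simp [hS0 x hx])).norm
    refine this.congr (.of_forall fun x => ?_)
    have hSn : 0 ≤ S (x + z) := Real.sqrt_nonneg _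
    simp only [hpow, hd, norm_smul, Complex.norm_real, norm_inv, norm_pow, norm_norm, norm_mul,
      Real.norm_of_nonneg hSn]
    ring
  have hfin : (2 * n * (Real.pi ^ n / n.factorial)) * ‖f z‖ ≤
      2 * ∫ x, S (x + z) * ‖x‖ ^ ((1 : ℝ) - 2 * n) := by
    have h0 : ‖- ((2 * n * volume.real (ball (0 : EuclideanSpace ℂ (Fin n)) 1) : ℝ) • F 0)‖ =
        (2 * n * (Real.pi ^ n / n.factorial)) * ‖f z‖ := by
      rw [hvol, norm_neg, norm_smul, Real.norm_of_nonneg (by positivity)]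
      simp [hF]
    rw [← h0, ← r3, ← integral_const_mul]
    refine norm_integral_le_of_norm_le (hint.const_mul 2) (.of_forall fun x => ?_)
    have h1 : (‖x‖ ^ (2 * n))⁻¹ • fderiv ℝ F x x +
      Complex.I * ((‖x‖ ^ (2 * n))⁻¹ • fderiv ℝ F x (Complex.I • x)) =
      (‖x‖ ^ (2 * n))⁻¹ • (fderiv ℝ F x x + Complex.I * fderiv ℝ F x (Complex.I • x)) := by
      simp only [Complex.real_smul]
      ring
    rw [h1, norm_smul, norm_inv, norm_pow, norm_norm, hpow, hFd]
    calc _ ≤ (‖x‖ ^ (2 * n))⁻¹ * (2 * (S (x + z) * ‖x‖)) := by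
          gcongr
          exact bm_pointwise n f (x + z) x
      _ = _ := by ring
  have hgoal : (∫ ζ, Real.sqrt (∑ j : Fin n, ‖wirtingerDBar n f ζ j‖ ^ 2) *
      ‖ζ - z‖ ^ ((1 : ℝ) - 2 * n)) = ∫ x, S (x + z) * ‖x‖ ^ ((1 : ℝ) - 2 * n) := hshift
  rw [hgoal]
  set I := ∫ x, S (x + z) * ‖x‖ ^ ((1 : ℝ) - 2 * n)
  have hn' : (1 : ℝ) ≤ n := by exact_mod_cast hn
  have hfac : (0 : ℝ) < n.factorial := by exact_mod_cast n.factorial_pos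
  have hpi : 0 < Real.pi ^ n := by positivity
  have h5 : (Real.pi ^ n / n.factorial) * ‖f z‖ ≤ I := by
    have : 0 ≤ (Real.pi ^ n / n.factorial) * ‖f z‖ := by positivity
    nlinarith
  calc ‖f z‖ = (n.factorial : ℝ) / Real.pi ^ n * ((Real.pi ^ n / n.factorial) * ‖f z‖) := by
        field_simp
    _ ≤ _ := by gcongr
end

section
/- Let n ≥ 2, let x₀ ∈ ℝⁿ, R > 0, and let B = B(x₀,R) be the open ball with boundary sphere ∂B. Let 1 ≤ p < ∞, 1 ≤ q < ∞, 1 ≤ r < ∞ satisfy q(n−p) < np and q(n−1) < nr. Then there exists a constant δ > 0, depending only on n, p, q, r, R, such that for every complex-valued function f that is continuously differentiable on an open neighborhood of cl(B), δ·‖f‖_{L^q(B)} ≤ ‖|∇f|‖_{L^p(B)} + ‖f‖_{L^r(∂B)}, where |∇f(x)| is the norm of the (Fréchet) derivative of f at x. (The Euclidean-ball case of Theorem 1.2.) -/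
open Metric MeasureTheory
open scoped ENNReal NNReal

lemma gs_normalize_lip {E : Type*} [NormedAddCommGroup E] [NormedSpace ℝ E] (y z : E)
    (hy : 1 ≤ ‖y‖) (hz : 1 ≤ ‖z‖) : ‖(‖y‖⁻¹ • y) - (‖z‖⁻¹ • z)‖ ≤ 2 * ‖y - z‖ := by
  have hy0 : 0 < ‖y‖ := by linarith
  have hz0 : 0 < ‖z‖ := by linarith
  have h1 : (‖y‖⁻¹ • y) - (‖z‖⁻¹ • z) = ‖y‖⁻¹ • (y - z) + (‖y‖⁻¹ - ‖z‖⁻¹) • z := by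
    rw [smul_sub, sub_smul]; abel
  have h2 : ‖(‖y‖⁻¹ - ‖z‖⁻¹) • z‖ = ‖y‖⁻¹ * |‖z‖ - ‖y‖| := by
    rw [norm_smul, Real.norm_eq_abs, ← abs_of_pos (inv_pos.2 hy0), ← abs_mul,
      ← abs_of_pos hz0, ← abs_mul, abs_of_pos hz0, abs_of_pos (inv_pos.2 hy0)]
    congr 1
    field_simp
  have h3 : |‖z‖ - ‖y‖| ≤ ‖y - z‖ := by
    rw [abs_sub_comm]; exact abs_norm_sub_norm_le y z
  have h4 : ‖y‖⁻¹ ≤ 1 := inv_le_one_of_one_le₀ hy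
  rw [h1]
  refine (norm_add_le _ _).trans ?_
  rw [h2, norm_smul, norm_inv, norm_norm]
  have : ‖y‖⁻¹ * ‖y - z‖ ≤ 1 * ‖y - z‖ := by gcongr
  have : ‖y‖⁻¹ * |‖z‖ - ‖y‖| ≤ 1 * ‖y - z‖ := by gcongr
  linarith

lemma gs_sphere_finite (m : ℕ) (x₀ : EuclideanSpace ℝ (Fin (m+1))) (R : ℝ) (hR : 0 < R) :
    (μH[(m : ℝ)] : Measure (EuclideanSpace ℝ (Fin (m+1)))) (sphere x₀ R) < ∞ := by
  let E := EuclideanSpace ℝ (Fin (m+1))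
  let h : Fin (m+1) → ℝ → (Fin m → ℝ) → E := fun i s v => WithLp.toLp 2 (Fin.insertNth i s v)
  let G : E → E := fun y => x₀ + R • (‖y‖⁻¹ • y)
  let Q : Set (Fin m → ℝ) := Set.Icc (fun _ => -1) (fun _ => 1)
  have hnorm : ∀ i s v, |s| = 1 → 1 ≤ ‖h i s v‖ := by
    intro i s v hs
    have := PiLp.norm_apply_le (h i s v) i
    simpa [h, hs] using this
  obtain ⟨K, hK⟩ : ∃ K : ℝ≥0, LipschitzWith K (WithLp.toLp 2 : (Fin (m+1) → ℝ) → E) :=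
    ⟨_, PiLp.lipschitzWith_toLp 2 _⟩
  have hlip : ∀ i s, |s| = 1 → LipschitzWith (Real.toNNReal (R * (2 * K))) (G ∘ h i s) := by
    intro i s hs
    refine LipschitzWith.of_dist_le_mul fun v w => ?_
    have h1 : dist (h i s v) (h i s w) ≤ K * dist v w := by
      refine (hK.dist_le_mul _ _).trans ?_
      gcongr
      rw [dist_pi_le_iff dist_nonneg]
      intro j
      refine Fin.succAboveCases i ?_ (fun k => ?_) j
      · simp
      · simpa using dist_le_pi_dist v w k
    have h2 := gs_normalize_lip _ _ (hnorm i s v hs) (hnorm i s w hs)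
    rw [Real.coe_toNNReal _ (by positivity)]
    simp only [Function.comp, G, dist_add_left]
    rw [dist_eq_norm, ← smul_sub, norm_smul, Real.norm_eq_abs, abs_of_pos hR]
    rw [dist_eq_norm] at h1
    calc _ ≤ R * (2 * (K * dist v w)) := by gcongr; linarith
      _ = _ := by ring
  have hcov : sphere x₀ R ⊆ ⋃ i, ((G ∘ h i 1) '' Q ∪ (G ∘ h i (-1)) '' Q) := by
    intro x hx
    obtain ⟨i, hi⟩ := Finite.exists_max (fun i => |(x - x₀) i|)
    have hx' : ‖x - x₀‖ = R := by simpa [dist_eq_norm] using hx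
    have hpos : 0 < |(x - x₀) i| := by
      by_contra hc
      have : x - x₀ = 0 := by
        ext j
        have := hi j
        have h0 : |(x - x₀) j| ≤ 0 := by linarith
        simpa using h0
      rw [this] at hx'
      simp at hx'; linarith
    set c := |(x - x₀) i| with hc
    let v : Fin m → ℝ := fun k => c⁻¹ * (x - x₀) (i.succAbove k)
    have hv : v ∈ Q := by
      have : ∀ k, |v k| ≤ 1 := by
        intro k
        simp only [v, abs_mul, abs_inv, hc, abs_abs]
        rw [inv_mul_le_one₀ hpos]
        exact hi _
      exact ⟨fun k => (abs_le.1 (this k)).1, fun k => (abs_le.1 (this k)).2⟩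
    have key : ∀ s, s = c⁻¹ * (x - x₀) i → (G ∘ h i s) v = x := by
      intro s hs
      have h1 : h i s v = c⁻¹ • (x - x₀) := by
        ext j
        refine Fin.succAboveCases i ?_ (fun k => ?_) j
        · simp [h, hs]
        · simp [h, v]
      simp only [Function.comp, G, h1]
      rw [norm_smul, hx', smul_smul, smul_smul, Real.norm_eq_abs, abs_of_pos (inv_pos.2 hpos)]
      have : R * (c⁻¹ * R)⁻¹ * c⁻¹ = 1 := by field_simp
      rw [this]; simp
    rw [Set.mem_iUnion]
    refine ⟨i, ?_⟩
    rcases le_total 0 ((x - x₀) i) with h0 | h0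
    · left
      refine ⟨v, hv, key 1 ?_⟩
      rw [abs_of_nonneg h0] at hc
      rw [← hc]; field_simp
    · right
      refine ⟨v, hv, key (-1) ?_⟩
      rw [abs_of_nonpos h0] at hc
      rw [show (x - x₀) i = -c by linarith]; field_simp
  have hQ : (μH[(m:ℝ)] : Measure (Fin m → ℝ)) Q < ∞ := by
    have := hausdorffMeasure_pi_real (ι := Fin m)
    rw [Fintype.card_fin] at this
    rw [this]
    exact isCompact_Icc.measure_lt_top
  have him : ∀ i s, |s| = 1 → (μH[(m : ℝ)] : Measure E) ((G ∘ h i s) '' Q) < ∞ := by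
    intro i s hs
    refine ((hlip i s hs).hausdorffMeasure_image_le (by positivity) Q).trans_lt ?_
    exact ENNReal.mul_lt_top (ENNReal.rpow_lt_top_of_nonneg (by positivity) ENNReal.coe_ne_top) hQ
  refine (measure_mono hcov).trans_lt ((measure_iUnion_le _).trans_lt ?_)
  rw [tsum_fintype]
  refine ENNReal.sum_lt_top.2 fun i _ => ?_
  refine (measure_union_le _ _).trans_lt ?_
  exact ENNReal.add_lt_top.2 ⟨him i 1 (by simp), him i (-1) (by simp)⟩
noncomputable def gsProj {m : ℕ} (x₀ : EuclideanSpace ℝ (Fin (m+1))) (R : ℝ)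
    (x : EuclideanSpace ℝ (Fin (m+1))) : EuclideanSpace ℝ (Fin (m+1)) :=
  x₀ + (R * ‖x - x₀‖⁻¹) • (x - x₀)

lemma gsProj_measurable {m : ℕ} (x₀ : EuclideanSpace ℝ (Fin (m+1))) (R : ℝ) :
    Measurable (gsProj x₀ R) := by
  unfold gsProj
  fun_prop

def gsShell {m : ℕ} (x₀ : EuclideanSpace ℝ (Fin (m+1))) (R a : ℝ) :
    Set (EuclideanSpace ℝ (Fin (m+1))) := {x | a ≤ ‖x - x₀‖ ∧ ‖x - x₀‖ ≤ R}

lemma gsShell_measurable {m : ℕ} (x₀ : EuclideanSpace ℝ (Fin (m+1))) (R a : ℝ) :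
    MeasurableSet (gsShell x₀ R a) := by
  apply IsClosed.measurableSet
  have hc : Continuous fun x : EuclideanSpace ℝ (Fin (m+1)) => ‖x - x₀‖ := by fun_prop
  exact (isClosed_le continuous_const hc).inter (isClosed_le hc continuous_const)

lemma gsProj_mem {m : ℕ} (x₀ : EuclideanSpace ℝ (Fin (m+1))) (R a : ℝ) (ha : 0 < a) (hR : 0 < R)
    {x} (hx : x ∈ gsShell x₀ R a) : gsProj x₀ R x ∈ sphere x₀ R := by
  have h0 : 0 < ‖x - x₀‖ := lt_of_lt_of_le ha hx.1
  simp only [gsProj, mem_sphere, dist_eq_norm, add_sub_cancel_left, norm_smul, norm_mul, norm_inv,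
    Real.norm_eq_abs, abs_of_pos hR, abs_of_pos h0]
  field_simp

noncomputable def gsKappa (m : ℕ) : ℝ≥0∞ :=
  ENNReal.ofReal (2 ^ (m+2)) * volume (ball (0 : EuclideanSpace ℝ (Fin (m+1))) 1)

lemma gsKappa_ne_zero (m : ℕ) : gsKappa m ≠ 0 := by
  unfold gsKappa
  refine mul_ne_zero ?_ (measure_ball_pos _ _ one_pos).ne'
  simp

lemma gsKappa_ne_top (m : ℕ) : gsKappa m ≠ ∞ :=
  ENNReal.mul_ne_top ENNReal.ofReal_ne_top measure_ball_lt_top.ne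

lemma gs_cover {m : ℕ} (x₀ : EuclideanSpace ℝ (Fin (m+1))) (R a : ℝ) (ha : 0 < a) (haR : a < R)
    (s : Set (EuclideanSpace ℝ (Fin (m+1)))) (t : ℝ) (ht : 0 < t) (htw : t ≤ R - a)
    (hs : ∀ x ∈ s, ∀ y ∈ s, dist x y ≤ t) :
    volume (gsProj x₀ R ⁻¹' s ∩ gsShell x₀ R a)
      ≤ gsKappa m * ENNReal.ofReal (R - a) * ENNReal.ofReal t ^ m := by
  have hR : 0 < R := ha.trans haR
  rcases Set.eq_empty_or_nonempty (gsProj x₀ R ⁻¹' s ∩ gsShell x₀ R a) with he | ⟨x1, hx1⟩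
  · rw [he]; simp
  set y0 := gsProj x₀ R x1 with hy0
  have hy0s : y0 ∈ s := hx1.1
  have hy0n : ‖y0 - x₀‖ = R := by
    simpa [dist_eq_norm] using gsProj_mem x₀ R a ha hR hx1.2
  let N := ⌊(R - a) / t⌋₊
  have hsub : gsProj x₀ R ⁻¹' s ∩ gsShell x₀ R a ⊆
      ⋃ k ∈ Finset.range (N + 1), closedBall (x₀ + ((a + k * t) / R) • (y0 - x₀)) (2 * t) := by
    rintro x ⟨hxs, hx⟩
    set ρ := ‖x - x₀‖ with hρ
    have hρ0 : 0 < ρ := lt_of_lt_of_le ha hx.1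
    let k := ⌊(ρ - a) / t⌋₊
    have hk1 : (k : ℝ) * t ≤ ρ - a := by
      rw [← le_div_iff₀ ht]
      exact Nat.floor_le (div_nonneg (sub_nonneg.2 hx.1) ht.le)
    have hk2 : ρ - a < (k + 1 : ℝ) * t := by
      rw [← div_lt_iff₀ ht]
      exact Nat.lt_floor_add_one _
    have hkN : k ≤ N := Nat.floor_mono (by gcongr; exact hx.2)
    simp only [Set.mem_iUnion, Finset.mem_range]
    refine ⟨k, by omega, ?_⟩
    have hxe : x - x₀ = (ρ / R) • (gsProj x₀ R x - x₀) := by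
      simp only [gsProj, add_sub_cancel_left, smul_smul, ← hρ]
      have : ρ / R * (R * ρ⁻¹) = 1 := by field_simp
      rw [this, one_smul]
    rw [mem_closedBall, dist_eq_norm]
    have e : x - (x₀ + ((a + k * t) / R) • (y0 - x₀)) =
        (ρ / R) • (gsProj x₀ R x - y0) + ((ρ - (a + k * t)) / R) • (y0 - x₀) := by
      rw [← sub_sub, hxe]
      module
    rw [e]
    refine (norm_add_le _ _).trans ?_
    rw [norm_smul, norm_smul, hy0n, Real.norm_eq_abs, Real.norm_eq_abs, abs_of_pos (by positivity),
      abs_of_nonneg (div_nonneg (by linarith) hR.le), ← dist_eq_norm]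
    have h1 := hs _ hxs _ hy0s
    have h2 : ρ / R ≤ 1 := (div_le_one hR).2 hx.2
    have h3 : ρ / R * dist (gsProj x₀ R x) y0 ≤ 1 * t := by gcongr
    have h4 : (ρ - (a + k * t)) / R * R ≤ t := by
      rw [div_mul_cancel₀ _ hR.ne']; linarith
    linarith
  refine (measure_mono hsub).trans ((measure_biUnion_finset_le _ _).trans ?_)
  have hball : ∀ z : EuclideanSpace ℝ (Fin (m+1)), volume (closedBall z (2 * t)) =
      ENNReal.ofReal ((2 * t) ^ (m + 1)) * volume (ball (0 : EuclideanSpace ℝ (Fin (m+1))) 1) := by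
    intro z
    rw [Measure.addHaar_closedBall _ _ (by positivity)]
    simp
  simp only [hball, Finset.sum_const, Finset.card_range, nsmul_eq_mul]
  have hN : ((N + 1 : ℕ) : ℝ≥0∞) = ENNReal.ofReal (N + 1) := by
    rw [← Nat.cast_succ, ENNReal.ofReal_natCast]
  rw [hN, ← mul_assoc, ← ENNReal.ofReal_mul (by positivity), gsKappa,
    ← ENNReal.ofReal_pow ht.le, mul_assoc, mul_assoc, mul_comm (volume _), ← mul_assoc (ENNReal.ofReal (2 ^ _))]
  rw [mul_comm (ENNReal.ofReal (R - a))]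
  gcongr
  rw [← ENNReal.ofReal_mul (by positivity), ← ENNReal.ofReal_mul (by positivity)]
  apply ENNReal.ofReal_le_ofReal
  have hNle : (N : ℝ) * t ≤ R - a := by
    rw [← le_div_iff₀ ht]
    exact Nat.floor_le (div_nonneg (by linarith) ht.le)
  have : ((N : ℝ) + 1) * t ≤ 2 * (R - a) := by linarith
  calc ((N : ℝ) + 1) * (2 * t) ^ (m + 1) = (((N : ℝ) + 1) * t) * (2 ^ (m+1) * t ^ m) := by ring
    _ ≤ (2 * (R - a)) * (2 ^ (m+1) * t ^ m) := by gcongr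
    _ = _ := by ring

lemma gs_shell_measure {m : ℕ} (x₀ : EuclideanSpace ℝ (Fin (m+1))) (R a : ℝ) (ha : 0 < a)
    (haR : a < R) :
    (volume.restrict (gsShell x₀ R a)).map (gsProj x₀ R) ≤
      (gsKappa m * ENNReal.ofReal (R - a)) • (μH[(m : ℝ)]).restrict (sphere x₀ R) := by
  have hR : 0 < R := ha.trans haR
  set ν := (volume.restrict (gsShell x₀ R a)).map (gsProj x₀ R) with hν
  set c := gsKappa m * ENNReal.ofReal (R - a) with hc
  have hc0 : c ≠ 0 := mul_ne_zero (gsKappa_ne_zero m) (by simpa using haR)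
  have hct : c ≠ ∞ := ENNReal.mul_ne_top (gsKappa_ne_top m) ENNReal.ofReal_ne_top
  have h1 : c⁻¹ • ν ≤ μH[(m : ℝ)] := by
    refine Measure.le_hausdorffMeasure _ _ (ENNReal.ofReal ((R - a) / 2)) (by simpa using haR) ?_
    intro s hs
    have hd : ediam (closure s) = ediam s := Metric.ediam_closure s
    have hne : ediam s ≠ ∞ := ne_top_of_le_ne_top ENNReal.ofReal_ne_top hs
    set d := (ediam s).toReal with hd'
    have hd2 : d ≤ (R - a) / 2 := by
      have := ENNReal.toReal_mono ENNReal.ofReal_ne_top hs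
      rwa [ENNReal.toReal_ofReal (by linarith)] at this
    have hdist : ∀ x ∈ closure s, ∀ y ∈ closure s, dist x y ≤ d := by
      intro x hx y hy
      rw [dist_edist]
      exact ENNReal.toReal_mono hne (hd ▸ Metric.edist_le_ediam_of_mem hx hy)
    have key : ν s ≤ c * ENNReal.ofReal d ^ m := by
      refine (measure_mono subset_closure).trans ?_
      rw [hν, Measure.map_apply (gsProj_measurable _ _) isClosed_closure.measurableSet,
        Measure.restrict_apply (gsProj_measurable _ _ isClosed_closure.measurableSet)]
      have hcont : Filter.Tendsto (fun t : ℝ => c * ENNReal.ofReal t ^ m) (nhdsWithin d (Set.Ioi d))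
          (nhds (c * ENNReal.ofReal d ^ m)) := by
        refine Filter.Tendsto.mono_left ?_ nhdsWithin_le_nhds
        refine ENNReal.Tendsto.const_mul ?_ (Or.inr hct)
        exact (((ENNReal.continuous_pow m).comp ENNReal.continuous_ofReal).tendsto d)
      refine ge_of_tendsto hcont ?_
      have hlt : d < R - a := by linarith
      filter_upwards [Ioo_mem_nhdsGT hlt] with t ht
      have hd0 : 0 ≤ d := ENNReal.toReal_nonneg
      exact gs_cover x₀ R a ha haR _ t (hd0.trans_lt ht.1) ht.2.le
        fun x hx y hy => (hdist x hx y hy).trans ht.1.le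
    rw [Measure.smul_apply, smul_eq_mul, ENNReal.rpow_natCast]
    rw [hd', ENNReal.ofReal_toReal hne] at key
    calc c⁻¹ * ν s ≤ c⁻¹ * (c * ediam s ^ m) := by gcongr
      _ = ediam s ^ m := by rw [← mul_assoc, ENNReal.inv_mul_cancel hc0 hct, one_mul]
  have h2 : ν ≤ c • μH[(m : ℝ)] := by
    calc ν = c • (c⁻¹ • ν) := by rw [smul_smul, ENNReal.mul_inv_cancel hc0 hct, one_smul]
      _ ≤ c • μH[(m : ℝ)] := by gcongr
  have h3 : ν.restrict (sphere x₀ R) = ν := by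
    rw [hν, Measure.restrict_map (gsProj_measurable _ _) isClosed_sphere.measurableSet,
      Measure.restrict_restrict (gsProj_measurable _ _ isClosed_sphere.measurableSet)]
    congr 2
    apply Set.inter_eq_right.2
    intro x hx
    exact gsProj_mem x₀ R a ha hR hx
  rw [← h3, ← Measure.restrict_smul]
  exact Measure.restrict_mono_measure h2 _

lemma gs_shell_lintegral {m : ℕ} (x₀ : EuclideanSpace ℝ (Fin (m+1))) (R a : ℝ) (ha : 0 < a)
    (haR : a < R) (φ : EuclideanSpace ℝ (Fin (m+1)) → ℝ≥0∞) (hφ : ContinuousOn φ (sphere x₀ R)) :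
    ∫⁻ x in gsShell x₀ R a, φ (gsProj x₀ R x) ≤
      gsKappa m * ENNReal.ofReal (R - a) * ∫⁻ x in sphere x₀ R, φ x ∂μH[(m : ℝ)] := by
  have hle := gs_shell_measure x₀ R a ha haR
  have hm0 : AEMeasurable φ ((μH[(m : ℝ)]).restrict (sphere x₀ R)) :=
    hφ.aemeasurable isClosed_sphere.measurableSet
  have hm : AEMeasurable φ ((volume.restrict (gsShell x₀ R a)).map (gsProj x₀ R)) :=
    (hm0.smul_measure _).mono_measure hle
  rw [← lintegral_map' hm (gsProj_measurable _ _).aemeasurable, ← smul_eq_mul,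
    ← lintegral_smul_measure]
  exact lintegral_mono' hle le_rfl

lemma gs_smooth_deriv : ∃ M : ℝ, 0 < M ∧ (∀ y, |deriv Real.smoothTransition y| ≤ M) ∧
    ∀ y, 1 < y → deriv Real.smoothTransition y = 0 := by
  have hgt : ∀ y, 1 < y → deriv Real.smoothTransition y = 0 := by
    intro y hy
    have : Real.smoothTransition =ᶠ[nhds y] fun _ => 1 := by
      filter_upwards [lt_mem_nhds hy] with z hz
      exact Real.smoothTransition.one_of_one_le hz.le
    rw [this.deriv_eq]; simp
  have hlt : ∀ y, y < 0 → deriv Real.smoothTransition y = 0 := by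
    intro y hy
    have : Real.smoothTransition =ᶠ[nhds y] fun _ => 0 := by
      filter_upwards [gt_mem_nhds hy] with z hz
      exact Real.smoothTransition.zero_of_nonpos hz.le
    rw [this.deriv_eq]; simp
  have hc : Continuous (deriv Real.smoothTransition) :=
    (Real.smoothTransition.contDiff (n := 1)).continuous_deriv le_rfl
  obtain ⟨M, hM⟩ := (isCompact_Icc (a := (0:ℝ)) (b := 1)).exists_bound_of_continuousOn hc.continuousOn
  refine ⟨max M 1, by positivity, fun y => ?_, hgt⟩
  by_cases h0 : y < 0
  · rw [hlt y h0]; simp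
  by_cases h1 : 1 < y
  · rw [hgt y h1]; simp
  exact (hM y ⟨not_lt.1 h0, not_lt.1 h1⟩).trans (le_max_left _ _)

noncomputable def gsCut {m : ℕ} (x₀ : EuclideanSpace ℝ (Fin (m+1))) (R ε : ℝ)
    (x : EuclideanSpace ℝ (Fin (m+1))) : ℝ :=
  Real.smoothTransition ((R ^ 2 - ‖x - x₀‖ ^ 2) / ε)

lemma gsCut_contDiff {m : ℕ} (x₀ : EuclideanSpace ℝ (Fin (m+1))) (R ε : ℝ) :
    ContDiff ℝ 1 (gsCut x₀ R ε) := by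
  unfold gsCut
  refine (Real.smoothTransition.contDiff (n := 1)).comp ?_
  refine ContDiff.div_const ?_ _
  exact contDiff_const.sub ((contDiff_id.sub contDiff_const).norm_sq ℝ)

lemma gsCut_norm_fderiv {m : ℕ} (x₀ : EuclideanSpace ℝ (Fin (m+1))) (R ε : ℝ) (hε : 0 < ε)
    (x : EuclideanSpace ℝ (Fin (m+1))) :
    ‖fderiv ℝ (gsCut x₀ R ε) x‖ ≤ |deriv Real.smoothTransition ((R ^ 2 - ‖x - x₀‖ ^ 2) / ε)| *
      (2 * ‖x - x₀‖ / ε) := by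
  have h1 : HasFDerivAt (fun x : EuclideanSpace ℝ (Fin (m+1)) => ‖x - x₀‖ ^ 2)
      (2 • (innerSL ℝ (x - x₀)).comp (ContinuousLinearMap.id ℝ _)) x :=
    ((hasFDerivAt_id x).sub_const x₀).norm_sq
  have h2 := (h1.const_sub (R ^ 2)).mul_const (ε⁻¹)
  have h3 : HasDerivAt Real.smoothTransition
      (deriv Real.smoothTransition ((R ^ 2 - ‖x - x₀‖ ^ 2) * ε⁻¹)) _ :=
    ((Real.smoothTransition.contDiff (n := 1)).differentiable (by simp) _).hasDerivAt
  have h4 := h3.comp_hasFDerivAt x h2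
  have h5 : fderiv ℝ (gsCut x₀ R ε) x = _ := h4.fderiv
  rw [h5, norm_smul, norm_smul, norm_neg, div_eq_mul_inv, Real.norm_eq_abs]
  gcongr
  rw [Real.norm_eq_abs, abs_of_pos (inv_pos.2 hε), ContinuousLinearMap.comp_id, div_eq_inv_mul]
  gcongr
  rw [two_smul, two_mul]
  refine (norm_add_le _ _).trans ?_
  rw [innerSL_apply_norm]

lemma gs_cutoff {m : ℕ} {F : Type*} [NormedAddCommGroup F] [NormedSpace ℝ F]
    (x₀ : EuclideanSpace ℝ (Fin (m+1))) (R : ℝ) (hR : 0 < R)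
    (p : ℝ) (hp : Real.HolderConjugate ((m + 1 : ℕ) : ℝ) p) (M : ℝ) (hM : 0 < M)
    (hM1 : ∀ y, |deriv Real.smoothTransition y| ≤ M)
    (hM2 : ∀ y, 1 < y → deriv Real.smoothTransition y = 0)
    (g : EuclideanSpace ℝ (Fin (m+1)) → F) (U : Set (EuclideanSpace ℝ (Fin (m+1))))
    (hU : IsOpen U) (hBU : closedBall x₀ R ⊆ U) (hg : ContDiffOn ℝ 1 g U)
    (ε : ℝ) (hε : 0 < ε) (hεR : ε < R ^ 2) :
    ∫⁻ x in ball x₀ √(R ^ 2 - ε), ‖g x‖ₑ ^ p ≤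
      lintegralPowLePowLIntegralFDerivConst
        (volume : Measure (EuclideanSpace ℝ (Fin (m+1)))) p *
      ((∫⁻ x in ball x₀ R, ‖fderiv ℝ g x‖ₑ) +
        ENNReal.ofReal (2 * M * R / ε) * ∫⁻ x in gsShell x₀ R √(R ^ 2 - ε), ‖g x‖ₑ) ^ p := by
  set a := √(R ^ 2 - ε) with ha
  have ha0 : 0 ≤ a := Real.sqrt_nonneg _
  have ha2 : a ^ 2 = R ^ 2 - ε := Real.sq_sqrt (by linarith)
  let u : EuclideanSpace ℝ (Fin (m+1)) → F := fun x => gsCut x₀ R ε x • g x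
  have hcut0 : ∀ x, R ≤ ‖x - x₀‖ → gsCut x₀ R ε x = 0 := by
    intro x hx
    apply Real.smoothTransition.zero_of_nonpos
    apply div_nonpos_of_nonpos_of_nonneg _ hε.le
    have : R ^ 2 ≤ ‖x - x₀‖ ^ 2 := by gcongr
    linarith
  have hu0 : ∀ x, R < ‖x - x₀‖ → u =ᶠ[nhds x] fun _ => 0 := by
    intro x hx
    have hc : Continuous fun x : EuclideanSpace ℝ (Fin (m+1)) => ‖x - x₀‖ := by fun_prop
    filter_upwards [hc.continuousAt.eventually (lt_mem_nhds hx)] with z hz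
    simp [u, hcut0 z hz.le]
  have hu : ContDiff ℝ 1 u := by
    rw [contDiff_iff_contDiffAt]
    intro x
    by_cases hx : R < ‖x - x₀‖
    · exact (contDiffAt_const (c := (0:F))).congr_of_eventuallyEq (hu0 x hx)
    · have hxU : x ∈ U := hBU (by simpa [dist_eq_norm] using hx)
      exact (gsCut_contDiff x₀ R ε).contDiffAt.smul (hg.contDiffAt (hU.mem_nhds hxU))
  have hcs : HasCompactSupport u := by
    refine HasCompactSupport.intro (isCompact_closedBall x₀ R) ?_
    intro x hx
    have : R ≤ ‖x - x₀‖ := by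
      rw [mem_closedBall, dist_eq_norm] at hx; linarith
    simp [u, hcut0 x this]
  have hp' : Real.HolderConjugate (Module.finrank ℝ (EuclideanSpace ℝ (Fin (m+1)))) p := by
    simpa using hp
  have key := lintegral_pow_le_pow_lintegral_fderiv
    (volume : Measure (EuclideanSpace ℝ (Fin (m+1)))) hu hcs hp'
  have hL : ∫⁻ x in ball x₀ a, ‖g x‖ₑ ^ p ≤ ∫⁻ x, ‖u x‖ₑ ^ p := by
    refine le_trans (le_of_eq ?_) (setLIntegral_le_lintegral (ball x₀ a) _)
    refine setLIntegral_congr_fun measurableSet_ball ?_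
    intro x hx
    have : gsCut x₀ R ε x = 1 := by
      apply Real.smoothTransition.one_of_one_le
      rw [one_le_div hε]
      rw [mem_ball, dist_eq_norm] at hx
      have : ‖x - x₀‖ ^ 2 ≤ a ^ 2 := by gcongr
      linarith
    simp [u, this]
  refine hL.trans (key.trans ?_)
  have hp0 : 0 ≤ p := hp.symm.nonneg
  refine mul_le_mul_right (ENNReal.rpow_le_rpow ?_ hp0) _
  have hpt : ∀ x, ‖fderiv ℝ u x‖ₑ ≤ (ball x₀ R).indicator (fun x => ‖fderiv ℝ g x‖ₑ) x +
      (gsShell x₀ R a).indicator (fun x => ENNReal.ofReal (2 * M * R / ε) * ‖g x‖ₑ) x := by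
    intro x
    by_cases hx : R < ‖x - x₀‖
    · rw [(hu0 x hx).fderiv_eq, fderiv_const_apply, ← ofReal_norm, norm_zero]; simp
    · rw [not_lt] at hx
      have hxU : x ∈ U := hBU (by simpa [dist_eq_norm] using hx)
      have hdg : DifferentiableAt ℝ g x :=
        (hg.contDiffAt (hU.mem_nhds hxU)).differentiableAt (by simp)
      have hdc : DifferentiableAt ℝ (gsCut x₀ R ε) x :=
        (gsCut_contDiff x₀ R ε).differentiable (by simp) x
      have hfd : fderiv ℝ u x = gsCut x₀ R ε x • fderiv ℝ g x
          + (fderiv ℝ (gsCut x₀ R ε) x).smulRight (g x) := fderiv_fun_smul hdc hdg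
      rw [hfd]
      have htri : ∀ A B : EuclideanSpace ℝ (Fin (m+1)) →L[ℝ] F, ‖A + B‖ₑ ≤ ‖A‖ₑ + ‖B‖ₑ := by
        intro A B
        rw [← ofReal_norm, ← ofReal_norm, ← ofReal_norm, ← ENNReal.ofReal_add (by positivity) (by positivity)]
        exact ENNReal.ofReal_le_ofReal (norm_add_le _ _)
      refine (htri _ _).trans ?_
      refine add_le_add ?_ ?_
      · rcases hx.lt_or_eq with h | h
        · rw [Set.indicator_of_mem (by simpa [dist_eq_norm] using h), enorm_smul]
          have : ‖gsCut x₀ R ε x‖ₑ ≤ 1 := by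
            rw [← enorm_one (G := ℝ)]
            rw [enorm_le_iff_norm_le, Real.norm_eq_abs, gsCut,
              abs_of_nonneg (Real.smoothTransition.nonneg _)]
            simpa using Real.smoothTransition.le_one _
          calc _ ≤ 1 * ‖fderiv ℝ g x‖ₑ := by gcongr
            _ = _ := one_mul _
        · rw [hcut0 x h.ge, zero_smul, ← ofReal_norm, norm_zero]; simp
      · have hn := gsCut_norm_fderiv x₀ R ε hε x
        by_cases hs : a ≤ ‖x - x₀‖
        · rw [Set.indicator_of_mem (show x ∈ gsShell x₀ R a from ⟨hs, hx⟩)]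
          rw [← ofReal_norm, ← ofReal_norm, ← ENNReal.ofReal_mul (by positivity)]
          apply ENNReal.ofReal_le_ofReal
          rw [ContinuousLinearMap.norm_smulRight_apply]
          gcongr
          refine hn.trans ?_
          calc _ ≤ M * (2 * R / ε) := by gcongr; exact hM1 _
            _ = _ := by ring
        · have h1 : 1 < (R ^ 2 - ‖x - x₀‖ ^ 2) / ε := by
            rw [one_lt_div hε]
            have : ‖x - x₀‖ ^ 2 < a ^ 2 := by
              rw [not_le] at hs
              gcongr
            linarith
          rw [hM2 _ h1] at hn
          have : fderiv ℝ (gsCut x₀ R ε) x = 0 := by simpa using hn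
          rw [this, ← ofReal_norm, ContinuousLinearMap.norm_smulRight_apply, norm_zero]; simp
  refine (lintegral_mono hpt).trans ?_
  have hss : gsShell x₀ R a ⊆ U := fun x hx => hBU (by simpa [dist_eq_norm] using hx.2)
  have hmeas : AEMeasurable (fun x => (gsShell x₀ R a).indicator
      (fun x => ENNReal.ofReal (2 * M * R / ε) * ‖g x‖ₑ) x) volume := by
    rw [aemeasurable_indicator_iff (gsShell_measurable _ _ _)]
    refine AEMeasurable.const_mul ?_ _
    exact ContinuousOn.aemeasurable ((hg.continuousOn.mono hss).enorm) (gsShell_measurable _ _ _)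
  rw [lintegral_add_right' _ hmeas, lintegral_indicator measurableSet_ball,
    lintegral_indicator (gsShell_measurable _ _ _), lintegral_const_mul' _ _ ENNReal.ofReal_ne_top]

lemma gs_base {m : ℕ} {F : Type*} [NormedAddCommGroup F] [NormedSpace ℝ F]
    (x₀ : EuclideanSpace ℝ (Fin (m+1))) (R : ℝ) (hR : 0 < R)
    (p : ℝ) (hp : Real.HolderConjugate ((m + 1 : ℕ) : ℝ) p) :
    ∃ C : ℝ≥0∞, C ≠ ∞ ∧ ∀ (g : EuclideanSpace ℝ (Fin (m+1)) → F)
      (U : Set (EuclideanSpace ℝ (Fin (m+1)))),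
      IsOpen U → closedBall x₀ R ⊆ U → ContDiffOn ℝ 1 g U →
      ∫⁻ x in ball x₀ R, ‖g x‖ₑ ^ p ≤ C * ((∫⁻ x in ball x₀ R, ‖fderiv ℝ g x‖ₑ) +
        ∫⁻ x in sphere x₀ R, ‖g x‖ₑ ∂μH[(m : ℝ)]) ^ p := by
  obtain ⟨M, hM, hM1, hM2⟩ := gs_smooth_deriv
  have hp0 : 0 ≤ p := hp.symm.nonneg
  set C₀ : ℝ≥0∞ := ((lintegralPowLePowLIntegralFDerivConst
        (volume : Measure (EuclideanSpace ℝ (Fin (m+1)))) p : ℝ≥0) : ℝ≥0∞) with hC₀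
  set L : ℝ≥0∞ := 1 + ENNReal.ofReal (2 * M) * gsKappa m with hL
  have hLt : L ≠ ∞ := ENNReal.add_ne_top.2 ⟨ENNReal.one_ne_top,
    ENNReal.mul_ne_top ENNReal.ofReal_ne_top (gsKappa_ne_top m)⟩
  refine ⟨C₀ * L ^ p, ENNReal.mul_ne_top ENNReal.coe_ne_top
    (ENNReal.rpow_ne_top_of_nonneg hp0 hLt), ?_⟩
  intro g U hU hBU hg
  set D := ∫⁻ x in ball x₀ R, ‖fderiv ℝ g x‖ₑ with hD
  set T := ∫⁻ x in sphere x₀ R, ‖g x‖ₑ ∂μH[(m : ℝ)] with hT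
  set σ := (μH[(m : ℝ)] : Measure (EuclideanSpace ℝ (Fin (m+1)))) (sphere x₀ R) with hσ
  have hσt : σ ≠ ∞ := (gs_sphere_finite m x₀ R hR).ne
  have hgc : ContinuousOn g (closedBall x₀ R) := hg.continuousOn.mono hBU
  have huc := (isCompact_closedBall x₀ R).uniformContinuousOn_of_continuous hgc
  rw [Metric.uniformContinuousOn_iff] at huc
  have step1 : ∀ η > 0, ∀ ρ, 0 < ρ → ρ < R → ∫⁻ x in ball x₀ ρ, ‖g x‖ₑ ^ p ≤
      C₀ * (L * (D + (T + ENNReal.ofReal η * σ))) ^ p := by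
    intro η hη ρ hρ0 hρ
    obtain ⟨δ, hδ, hδ'⟩ := huc η hη
    obtain ⟨ε, hε, hε2⟩ : ∃ ε > 0, ε < min (R ^ 2 - ρ ^ 2) (δ * R) := by
      refine exists_between (lt_min ?_ (by positivity))
      have : ρ ^ 2 < R ^ 2 := by gcongr
      linarith
    have hε3 : ε < R ^ 2 - ρ ^ 2 := hε2.trans_le (min_le_left _ _)
    have hε4 : ε < δ * R := hε2.trans_le (min_le_right _ _)
    have hεR : ε < R ^ 2 := by nlinarith
    have hcut := gs_cutoff x₀ R hR p hp M hM hM1 hM2 g U hU hBU hg ε hε hεR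
    set a := √(R ^ 2 - ε) with ha
    have ha0 : 0 < a := Real.sqrt_pos.2 (by linarith)
    have ha2 : a ^ 2 = R ^ 2 - ε := Real.sq_sqrt (by linarith)
    have haR : a < R := by
      apply lt_of_pow_lt_pow_left₀ 2 hR.le; linarith
    have hρa : ρ ≤ a := by
      apply le_of_lt; apply lt_of_pow_lt_pow_left₀ 2 ha0.le; linarith
    have hw : (R - a) * R ≤ ε := by nlinarith
    refine (lintegral_mono_set (ball_subset_ball hρa)).trans (hcut.trans ?_)
    refine mul_le_mul_right (ENNReal.rpow_le_rpow ?_ hp0) _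
    have hsh : ∫⁻ x in gsShell x₀ R a, ‖g x‖ₑ ≤
        ∫⁻ x in gsShell x₀ R a, (fun y => ‖g y‖ₑ + ENNReal.ofReal η) (gsProj x₀ R x) := by
      refine setLIntegral_mono' (gsShell_measurable _ _ _) ?_
      intro x hx
      have hPx := gsProj_mem x₀ R a ha0 hR hx
      have hxb : x ∈ closedBall x₀ R := by simpa [dist_eq_norm] using hx.2
      have hn0 : 0 < ‖x - x₀‖ := ha0.trans_le hx.1
      have hdist : dist x (gsProj x₀ R x) < δ := by
        have e : x - gsProj x₀ R x = (1 - R * ‖x - x₀‖⁻¹) • (x - x₀) := by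
          rw [gsProj, sub_smul, one_smul, sub_add_eq_sub_sub]
        have e2 : |1 - R * ‖x - x₀‖⁻¹| = (R - ‖x - x₀‖) * ‖x - x₀‖⁻¹ := by
          rw [abs_of_nonpos]
          · field_simp; ring
          · have : 1 ≤ R * ‖x - x₀‖⁻¹ := by
              rw [← div_eq_mul_inv, one_le_div hn0]; exact hx.2
            linarith
        rw [dist_eq_norm, e, norm_smul, Real.norm_eq_abs, e2, mul_assoc, inv_mul_cancel₀ hn0.ne',
          mul_one]
        have h1 := hx.1
        have : (R - a) * R < δ * R := by linarith
        have := lt_of_mul_lt_mul_right this hR.le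
        linarith
      have := hδ' x hxb _ (sphere_subset_closedBall hPx) hdist
      simp only
      rw [← ofReal_norm, ← ofReal_norm, ← ENNReal.ofReal_add (by positivity) hη.le]
      apply ENNReal.ofReal_le_ofReal
      rw [dist_eq_norm] at this
      have h2 := norm_le_norm_add_norm_sub' (g x) (g (gsProj x₀ R x))
      linarith
    have hsh2 := gs_shell_lintegral x₀ R a ha0 haR (fun y => ‖g y‖ₑ + ENNReal.ofReal η)
      (((hgc.mono sphere_subset_closedBall).enorm).add continuousOn_const)
    have hsum : ∫⁻ x in sphere x₀ R, (‖g x‖ₑ + ENNReal.ofReal η) ∂μH[(m : ℝ)] =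
        T + ENNReal.ofReal η * σ := by
      rw [lintegral_add_right _ measurable_const]
      simp [hT, hσ]
    have hfin : ENNReal.ofReal (2 * M * R / ε) * ∫⁻ x in gsShell x₀ R a, ‖g x‖ₑ ≤
        ENNReal.ofReal (2 * M) * gsKappa m * (T + ENNReal.ofReal η * σ) := by
      calc _ ≤ ENNReal.ofReal (2 * M * R / ε) * (gsKappa m * ENNReal.ofReal (R - a) *
            (T + ENNReal.ofReal η * σ)) := by
            rw [← hsum]; gcongr; exact hsh.trans hsh2
        _ = (ENNReal.ofReal (2 * M * R / ε) * ENNReal.ofReal (R - a)) * gsKappa m *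
            (T + ENNReal.ofReal η * σ) := by ring
        _ ≤ _ := by
            gcongr
            rw [← ENNReal.ofReal_mul (by positivity)]
            apply ENNReal.ofReal_le_ofReal
            calc 2 * M * R / ε * (R - a) = 2 * M * (((R - a) * R) / ε) := by ring
              _ ≤ 2 * M * 1 := by gcongr; exact (div_le_one hε).2 hw
              _ = _ := mul_one _
    rw [mul_add]
    refine add_le_add ?_ (hfin.trans ?_)
    · calc D = 1 * D := (one_mul _).symm
        _ ≤ L * D := by gcongr; exact le_self_add
    · gcongr; exact le_add_self
  have step2 : ∀ ρ, 0 < ρ → ρ < R → ∫⁻ x in ball x₀ ρ, ‖g x‖ₑ ^ p ≤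
      C₀ * (L * (D + T)) ^ p := by
    intro ρ hρ0 hρ
    have ht : Filter.Tendsto (fun η : ℝ => C₀ * (L * (D + (T + ENNReal.ofReal η * σ))) ^ p)
        (nhdsWithin 0 (Set.Ioi 0)) (nhds (C₀ * (L * (D + (T + ENNReal.ofReal 0 * σ))) ^ p)) := by
      refine Filter.Tendsto.mono_left ?_ nhdsWithin_le_nhds
      refine ENNReal.Tendsto.const_mul ?_ (Or.inr ENNReal.coe_ne_top)
      refine (ENNReal.continuous_rpow_const.tendsto _).comp ?_
      refine ENNReal.Tendsto.const_mul ?_ (Or.inr hLt)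
      refine tendsto_const_nhds.add (tendsto_const_nhds.add ?_)
      exact ENNReal.Tendsto.mul_const (ENNReal.continuous_ofReal.tendsto 0) (Or.inr hσt)
    have := ge_of_tendsto ht (b := ∫⁻ x in ball x₀ ρ, ‖g x‖ₑ ^ p) (by
      filter_upwards [self_mem_nhdsWithin] with η hη
      exact step1 η hη ρ hρ0 hρ)
    simpa using this
  have hunion : ball x₀ R = ⋃ k : ℕ, ball x₀ (R * (1 - 1 / (k + 2))) := by
    ext x
    simp only [Set.mem_iUnion, mem_ball]
    constructor
    · intro hx
      obtain ⟨k, hk⟩ := exists_nat_one_div_lt (show 0 < 1 - dist x x₀ / R by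
        rw [sub_pos, div_lt_one hR]; exact hx)
      refine ⟨k, ?_⟩
      have h1 : (1 : ℝ) / (k + 2) ≤ 1 / (k + 1) := by gcongr; norm_num
      have h2 : dist x x₀ / R < 1 - 1 / (k + 2) := by linarith
      rw [div_lt_iff₀ hR] at h2
      linarith
    · rintro ⟨k, hk⟩
      refine hk.trans_le ?_
      have : (0 : ℝ) ≤ 1 / (k + 2) := by positivity
      nlinarith
  have hmono : Monotone fun k : ℕ => ball x₀ (R * (1 - 1 / ((k : ℝ) + 2))) := by
    intro i j hij
    apply ball_subset_ball
    have : (i : ℝ) ≤ j := by exact_mod_cast hij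
    gcongr
  calc ∫⁻ x in ball x₀ R, ‖g x‖ₑ ^ p = ⨆ k : ℕ, ∫⁻ x in ball x₀ (R * (1 - 1 / ((k : ℝ) + 2))), ‖g x‖ₑ ^ p := by
        rw [hunion, setLIntegral_iUnion_of_directed _ hmono.directed_le]
    _ ≤ C₀ * (L * (D + T)) ^ p := by
        refine iSup_le fun k => step2 _ ?_ ?_
        · have : (1 : ℝ) / (k + 2) < 1 := by
            rw [div_lt_one (by positivity)]
            have : (0 : ℝ) ≤ k := by positivity
            linarith
          exact mul_pos hR (by linarith)
        · have : (0 : ℝ) < 1 / (k + 2) := by positivity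
          nlinarith
    _ = _ := by rw [ENNReal.mul_rpow_of_nonneg _ _ hp0, mul_assoc]

noncomputable def gsN {α G : Type*} [MeasurableSpace α] [NormedAddCommGroup G]
    (t : ℝ) (f : α → G) (μ : Measure α) : ℝ≥0∞ := (∫⁻ x, ‖f x‖ₑ ^ t ∂μ) ^ (1 / t)

lemma gsN_eq {α G : Type*} [MeasurableSpace α] [NormedAddCommGroup G]
    (t : ℝ) (ht : 0 < t) (f : α → G) (μ : Measure α) :
    gsN t f μ = eLpNorm f (ENNReal.ofReal t) μ := by
  rw [eLpNorm_eq_lintegral_rpow_enorm_toReal (by simpa using ht) ENNReal.ofReal_ne_top,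
    ENNReal.toReal_ofReal ht.le, gsN]

lemma gsN_mono {α : Type*} [MeasurableSpace α] (μ : Measure α) (hμ : μ Set.univ ≠ ∞)
    (t u : ℝ) (ht : 0 < t) (htu : t ≤ u) :
    ∃ K : ℝ≥0∞, K ≠ ∞ ∧ ∀ (G : Type) [NormedAddCommGroup G] (f : α → G), AEStronglyMeasurable f μ →
      gsN t f μ ≤ K * gsN u f μ := by
  refine ⟨μ Set.univ ^ (1 / t - 1 / u), ?_, ?_⟩
  · refine ENNReal.rpow_ne_top_of_nonneg ?_ hμ
    have : 1 / u ≤ 1 / t := by gcongr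
    linarith
  · intro G _ f hf
    rw [gsN_eq t ht, gsN_eq u (ht.trans_le htu), mul_comm]
    have := eLpNorm_le_eLpNorm_mul_rpow_measure_univ (μ := μ) (ENNReal.ofReal_le_ofReal htu) hf
    rwa [ENNReal.toReal_ofReal ht.le, ENNReal.toReal_ofReal (ht.le.trans htu)] at this

lemma gsN_toReal {α G : Type*} [MeasurableSpace α] [NormedAddCommGroup G]
    (t : ℝ) (ht : 0 < t) (f : α → G) (μ : Measure α) (hf : AEStronglyMeasurable f μ) :
    (∫ x, ‖f x‖ ^ t ∂μ) ^ (1 / t) = (gsN t f μ).toReal := by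
  rw [gsN, ← ENNReal.toReal_rpow, integral_eq_lintegral_of_nonneg_ae]
  · congr 3
    ext x
    rw [← ofReal_norm, ENNReal.ofReal_rpow_of_nonneg (norm_nonneg _) ht.le]
  · exact Filter.Eventually.of_forall fun x => by positivity
  · exact (hf.norm.aemeasurable.pow_const t).aestronglyMeasurable

lemma gsN_ne_top {α G : Type*} [TopologicalSpace α] [MeasurableSpace α] [NormedAddCommGroup G]
    (t : ℝ) (ht : 0 < t) (f : α → G) (μ : Measure α) (S K : Set α) (hS : MeasurableSet S)
    (hK : IsCompact K) (hSK : S ⊆ K) (hμ : μ S ≠ ∞) (hf : ContinuousOn f K) :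
    gsN t f (μ.restrict S) ≠ ∞ := by
  obtain ⟨B, hB⟩ := hK.exists_bound_of_continuousOn hf
  refine ENNReal.rpow_ne_top_of_nonneg (by positivity) ?_
  have : ∫⁻ x in S, ‖f x‖ₑ ^ t ∂μ ≤ ∫⁻ x in S, ENNReal.ofReal B ^ t ∂μ := by
    refine setLIntegral_mono' hS fun x hx => ?_
    refine ENNReal.rpow_le_rpow ?_ ht.le
    rw [← ofReal_norm]
    exact ENNReal.ofReal_le_ofReal (hB x (hSK hx))
  refine ne_top_of_le_ne_top ?_ this
  rw [setLIntegral_const]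
  exact ENNReal.mul_ne_top (ENNReal.rpow_ne_top_of_nonneg ht.le ENNReal.ofReal_ne_top) hμ

lemma gs_absorb (X D T C : ℝ≥0∞) (s : ℝ) (hs : 1 ≤ s) (hX : X ≠ ∞)
    (h : X ^ s ≤ C * (X ^ (s - 1) * D + T ^ s)) : X ≤ (1 + 2 * C) * (D + T) := by
  rcases le_or_gt X (D + T) with hle | hgt
  · calc X ≤ 1 * (D + T) := by rwa [one_mul]
      _ ≤ _ := by gcongr; exact le_self_add
  have hX0 : X ≠ 0 := (zero_le.trans_lt hgt).ne'
  have hsplit : ∀ Y : ℝ≥0∞, Y ^ s = Y ^ (s - 1) * Y := by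
    intro Y
    have := ENNReal.rpow_add_of_nonneg (x := Y) (s - 1) 1 (by linarith) zero_le_one
    rwa [sub_add_cancel, ENNReal.rpow_one] at this
  have hT : T ≤ X := le_add_self.trans hgt.le
  have h1 : X ^ (s - 1) * X ≤ X ^ (s - 1) * (2 * C * (D + T)) := by
    rw [← hsplit]
    refine h.trans ?_
    have h2 : T ^ s ≤ X ^ (s - 1) * (D + T) := by
      rw [hsplit]
      exact mul_le_mul' (ENNReal.rpow_le_rpow hT (by linarith)) le_add_self
    have h3 : X ^ (s - 1) * D ≤ X ^ (s - 1) * (D + T) := by gcongr; exact le_self_add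
    calc _ ≤ C * (X ^ (s - 1) * (D + T) + X ^ (s - 1) * (D + T)) := by gcongr
      _ = _ := by ring
  have hp0 : X ^ (s - 1) ≠ 0 := by
    intro h0
    rw [ENNReal.rpow_eq_zero_iff] at h0
    tauto
  have hpt : X ^ (s - 1) ≠ ∞ := ENNReal.rpow_ne_top_of_nonneg (by linarith) hX
  have h4 := (ENNReal.mul_le_mul_iff_right hp0 hpt).1 h1
  refine h4.trans ?_
  gcongr
  exact le_add_self

lemma gs_holder {α : Type*} [MeasurableSpace α] (μ : Measure α) (hμ : μ Set.univ ≠ ∞)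
    (s a p : ℝ) (hs : 1 ≤ s) (ha : 1 < a) (hp : 1 ≤ p) (hc : (s - 1) / (s * a) + 1 / p ≤ 1) :
    ∃ K : ℝ≥0∞, K ≠ ∞ ∧ ∀ (G H : Type) [NormedAddCommGroup G] [NormedAddCommGroup H]
      (f : α → G) (h : α → H), AEStronglyMeasurable f μ → AEStronglyMeasurable h μ →
      ∫⁻ x, ‖f x‖ₑ ^ (s - 1) * ‖h x‖ₑ ∂μ ≤ K * (gsN (s * a) f μ ^ (s - 1) * gsN p h μ) := by
  rcases hs.eq_or_lt with rfl | hs1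
  · obtain ⟨K, hK, hK'⟩ := gsN_mono μ hμ 1 p one_pos hp
    refine ⟨K, hK, ?_⟩
    intro G H _ _ f h hf hh
    have := hK' H h hh
    simpa [gsN] using this
  · have hs0 : 0 < s - 1 := by linarith
    set t := s * a / (s - 1) with ht
    have hsa : 0 < s * a := by nlinarith
    have ht1 : 1 < t := by
      rw [ht, one_lt_div hs0]; nlinarith
    have hconj := Real.HolderConjugate.conjExponent ht1
    set t' := Real.conjExponent t with ht'
    have ht'0 : 0 < t' := hconj.symm.pos
    have ht'p : t' ≤ p := by
      have h1 := hconj.inv_add_inv_eq_one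
      have h2 : t⁻¹ = (s - 1) / (s * a) := by rw [ht, inv_div]
      have h3 : 1 / p ≤ 1 / t' := by rw [one_div t']; linarith
      exact (one_div_le_one_div (by linarith) ht'0).1 h3
    obtain ⟨K, hK, hK'⟩ := gsN_mono μ hμ t' p ht'0 ht'p
    refine ⟨K, hK, ?_⟩
    intro G H _ _ f h hf hh
    have := ENNReal.lintegral_mul_le_Lp_mul_Lq μ hconj (f := fun x => ‖f x‖ₑ ^ (s - 1))
      (g := fun x => ‖h x‖ₑ) (hf.enorm.pow_const _) hh.enorm
    refine this.trans ?_
    have e : (∫⁻ x, (‖f x‖ₑ ^ (s - 1)) ^ t ∂μ) ^ (1 / t) = gsN (s * a) f μ ^ (s - 1) := by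
      simp_rw [← ENNReal.rpow_mul]
      rw [gsN, ← ENNReal.rpow_mul]
      have e1 : (s - 1) * t = s * a := by rw [ht]; field_simp
      have e2 : 1 / t = 1 / (s * a) * (s - 1) := by rw [ht]; field_simp
      rw [e1, e2]
    rw [e]
    calc _ ≤ gsN (s * a) f μ ^ (s - 1) * (K * gsN p h μ) := by
          gcongr; exact hK' H h hh
      _ = _ := by ring

lemma gs_power {m : ℕ} (x₀ : EuclideanSpace ℝ (Fin (m+1))) (R : ℝ) (hR : 0 < R)
    (a : ℝ) (ha : Real.HolderConjugate ((m + 1 : ℕ) : ℝ) a) (s : ℝ) (hs : 1 ≤ s) :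
    ∃ C : ℝ≥0∞, C ≠ ∞ ∧ ∀ (f : EuclideanSpace ℝ (Fin (m+1)) → ℂ)
      (U : Set (EuclideanSpace ℝ (Fin (m+1)))),
      IsOpen U → closedBall x₀ R ⊆ U → ContDiffOn ℝ 1 f U →
      gsN (s * a) f (volume.restrict (ball x₀ R)) ^ s ≤
        C * ((∫⁻ x in ball x₀ R, ‖f x‖ₑ ^ (s - 1) * ‖fderiv ℝ f x‖ₑ) +
        ∫⁻ x in sphere x₀ R, ‖f x‖ₑ ^ s ∂μH[(m : ℝ)]) := by
  have ha0 : 0 < a := ha.symm.pos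
  have hs0 : 0 < s := by linarith
  have hN : ∀ f : EuclideanSpace ℝ (Fin (m+1)) → ℂ,
      gsN (s * a) f (volume.restrict (ball x₀ R)) ^ s =
        (∫⁻ x in ball x₀ R, ‖f x‖ₑ ^ (s * a)) ^ (1 / a) := by
    intro f
    rw [gsN, ← ENNReal.rpow_mul]
    congr 1
    field_simp
  have hroot : ∀ A C B : ℝ≥0∞, A ≤ C * B ^ a → A ^ (1 / a) ≤ C ^ (1 / a) * B := by
    intro A C B h
    have := ENNReal.rpow_le_rpow h (show 0 ≤ 1 / a by positivity)
    rwa [ENNReal.mul_rpow_of_nonneg _ _ (by positivity), ← ENNReal.rpow_mul,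
      mul_one_div_cancel ha0.ne', ENNReal.rpow_one] at this
  rcases hs.eq_or_lt with rfl | hs1
  · obtain ⟨C, hC, hC'⟩ := gs_base (F := ℂ) x₀ R hR a ha
    refine ⟨C ^ (1 / a), ENNReal.rpow_ne_top_of_nonneg (by positivity) hC, ?_⟩
    intro f U hU hBU hf
    rw [hN]
    apply hroot
    simpa using hC' f U hU hBU hf
  · obtain ⟨C, hC, hC'⟩ := gs_base (F := ℝ) x₀ R hR a ha
    refine ⟨C ^ (1 / a) * ENNReal.ofReal s, ENNReal.mul_ne_top
      (ENNReal.rpow_ne_top_of_nonneg (by positivity) hC) ENNReal.ofReal_ne_top, ?_⟩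
    intro f U hU hBU hf
    have hg : ContDiffOn ℝ 1 (fun x => ‖f x‖ ^ s) U := by
      exact (contDiff_norm_rpow hs1).comp_contDiffOn hf
    have hb := hC' _ U hU hBU hg
    have hen : ∀ x, ‖‖f x‖ ^ s‖ₑ = ‖f x‖ₑ ^ s := by
      intro x
      rw [← ofReal_norm (f x), ENNReal.ofReal_rpow_of_nonneg (norm_nonneg _) hs0.le,
        Real.enorm_eq_ofReal (by positivity)]
    simp only [hen, ← ENNReal.rpow_mul] at hb
    rw [hN, mul_assoc]
    refine (hroot _ _ _ hb).trans ?_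
    gcongr
    rw [mul_add]
    refine add_le_add ?_ ?_
    · rw [← lintegral_const_mul' _ _ ENNReal.ofReal_ne_top]
      refine setLIntegral_mono' measurableSet_ball ?_
      intro x hx
      have hxU : x ∈ U := hBU (ball_subset_closedBall hx)
      have hdf : DifferentiableAt ℝ f x :=
        (hf.contDiffAt (hU.mem_nhds hxU)).differentiableAt (by simp)
      have hfd := ((hasFDerivAt_norm_rpow (f x) hs1).comp x hdf.hasFDerivAt).fderiv
      have hfd' : fderiv ℝ (fun x => ‖f x‖ ^ s) x = _ := hfd
      rw [hfd', ← ofReal_norm, ← ofReal_norm, ← ofReal_norm,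
        ENNReal.ofReal_rpow_of_nonneg (norm_nonneg _) (by linarith),
        ← ENNReal.ofReal_mul (by positivity), ← ENNReal.ofReal_mul (by positivity)]
      apply ENNReal.ofReal_le_ofReal
      refine (ContinuousLinearMap.opNorm_comp_le _ _).trans ?_
      rw [norm_smul, innerSL_apply_norm, Real.norm_of_nonneg (by positivity), ← mul_assoc]
      refine mul_le_mul_of_nonneg_right ?_ (norm_nonneg _)
      rw [mul_assoc]
      refine mul_le_mul_of_nonneg_left ?_ hs0.le
      by_cases h0 : ‖f x‖ = 0
      · rw [h0, mul_zero]; exact Real.rpow_nonneg le_rfl _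
      · rw [← Real.rpow_add_one h0]
        apply le_of_eq; congr 1; ring
    · calc _ = 1 * ∫⁻ x in sphere x₀ R, ‖f x‖ₑ ^ s ∂μH[(m : ℝ)] := (one_mul _).symm
        _ ≤ _ := by gcongr; simpa using hs

theorem gradient_sobolev_inequality_ball
    (n : ℕ) (hn : 2 ≤ n) (x₀ : EuclideanSpace ℝ (Fin n)) (R : ℝ) (hR : 0 < R)
    (p q r : ℝ) (hp : 1 ≤ p) (hq : 1 ≤ q) (hr : 1 ≤ r)
    (hqp : q * (n - p) < n * p) (hqr : q * (n - 1) < n * r) :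
    ∃ δ > (0 : ℝ), ∀ f : EuclideanSpace ℝ (Fin n) → ℂ,
      ∀ U : Set (EuclideanSpace ℝ (Fin n)), IsOpen U → closure (ball x₀ R) ⊆ U →
      ContDiffOn ℝ 1 f U →
      δ * (∫ x in ball x₀ R, ‖f x‖ ^ q) ^ (1 / q)
        ≤ (∫ x in ball x₀ R, ‖fderiv ℝ f x‖ ^ p) ^ (1 / p)
          + (∫ x in sphere x₀ R, ‖f x‖ ^ r ∂(μH[(n : ℝ) - 1])) ^ (1 / r) := by
  obtain ⟨m, rfl⟩ : ∃ m, n = m + 1 := ⟨n - 1, by omega⟩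
  have hm : (1 : ℝ) ≤ m := by
    have : 1 ≤ m := by omega
    exact_mod_cast this
  have hm0 : (0 : ℝ) < m := by linarith
  have hcast : ((m + 1 : ℕ) : ℝ) - 1 = m := by push_cast; ring
  rw [hcast] at *
  push_cast at hqp hqr
  set a : ℝ := (m + 1) / m with ha
  have ha1 : 1 < a := by rw [ha, one_lt_div hm0]; linarith
  have hconj : Real.HolderConjugate ((m + 1 : ℕ) : ℝ) a := by
    rw [Real.holderConjugate_iff]
    refine ⟨by push_cast; linarith, ?_⟩
    rw [ha]; push_cast; field_simp; ring
  set s : ℝ := max 1 (q * m / (m + 1)) with hs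
  have hs1 : 1 ≤ s := le_max_left _ _
  have hsr : s ≤ r := max_le hr (by rw [div_le_iff₀ (by positivity)]; linarith)
  have hqs : q ≤ s * a := by
    have h1 : q * m / (m + 1) ≤ s := le_max_right _ _
    have h2 : q = q * m / (m + 1) * a := by rw [ha]; field_simp
    rw [h2]; gcongr
  have hsp : s * (m + 1 - p) ≤ p * m := by
    rcases max_cases 1 (q * m / ((m : ℝ) + 1)) with ⟨h, _⟩ | ⟨h, _⟩
    · rw [hs, h]; nlinarith
    · rw [hs, h, div_mul_eq_mul_div, div_le_iff₀ (by positivity)]; nlinarith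
  have hc : (s - 1) / (s * a) + 1 / p ≤ 1 := by
    have e : (s - 1) / (s * a) + 1 / p = ((s - 1) * m * p + s * (m + 1)) / (s * (m + 1) * p) := by
      rw [ha]; field_simp
    rw [e, div_le_one (by positivity)]
    nlinarith
  have hs0 : 0 < s := by linarith
  have hsa0 : 0 < s * a := by nlinarith
  set μ := (volume : Measure (EuclideanSpace ℝ (Fin (m+1)))).restrict (ball x₀ R) with hμ
  set τ := (μH[(m : ℝ)] : Measure (EuclideanSpace ℝ (Fin (m+1)))).restrict (sphere x₀ R) with hτ
  have hσ := (gs_sphere_finite m x₀ R hR).ne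
  have hμt : μ Set.univ ≠ ∞ := by
    rw [hμ, Measure.restrict_apply_univ]; exact measure_ball_lt_top.ne
  have hτt : τ Set.univ ≠ ∞ := by
    rw [hτ, Measure.restrict_apply_univ]; exact hσ
  obtain ⟨K₁, hK₁, hq'⟩ := gsN_mono μ hμt q (s * a) (by linarith) hqs
  obtain ⟨K₂, hK₂, hr'⟩ := gsN_mono τ hτt s r hs0 hsr
  obtain ⟨K₃, hK₃, hH⟩ := gs_holder μ hμt s a p hs1 ha1 hp hc
  obtain ⟨C, hC, hP⟩ := gs_power x₀ R hR a hconj s hs1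
  set C' := C * (K₃ + K₂ ^ s) with hC'
  have hC't : C' ≠ ∞ := ENNReal.mul_ne_top hC (ENNReal.add_ne_top.2
    ⟨hK₃, ENNReal.rpow_ne_top_of_nonneg hs0.le hK₂⟩)
  set K := K₁ * (1 + 2 * C') with hK
  have hKt : K ≠ ∞ := ENNReal.mul_ne_top hK₁ (ENNReal.add_ne_top.2
    ⟨ENNReal.one_ne_top, ENNReal.mul_ne_top (by simp) hC't⟩)
  have hKr : 0 ≤ K.toReal := ENNReal.toReal_nonneg
  refine ⟨(K.toReal + 1)⁻¹, by positivity, ?_⟩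
  intro f U hU hBU' hf
  have hBU : closedBall x₀ R ⊆ U := by rwa [closure_ball x₀ hR.ne'] at hBU'
  have hfc : ContinuousOn f (closedBall x₀ R) := hf.continuousOn.mono hBU
  have hdc : ContinuousOn (fderiv ℝ f) (closedBall x₀ R) :=
    (hf.continuousOn_fderiv_of_isOpen hU le_rfl).mono hBU
  have hfm : AEStronglyMeasurable f μ :=
    (hfc.mono ball_subset_closedBall).aestronglyMeasurable measurableSet_ball
  have hdm : AEStronglyMeasurable (fderiv ℝ f) μ :=
    (hdc.mono ball_subset_closedBall).aestronglyMeasurable measurableSet_ball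
  have hft : AEStronglyMeasurable f τ :=
    (hfc.mono sphere_subset_closedBall).aestronglyMeasurable isClosed_sphere.measurableSet
  rw [gsN_toReal q (by linarith) f μ hfm, gsN_toReal p (by linarith) _ μ hdm,
    gsN_toReal r (by linarith) f τ hft]
  have hcpt := isCompact_closedBall x₀ R
  have hXt : gsN (s * a) f μ ≠ ∞ := gsN_ne_top _ hsa0 f volume _ _ measurableSet_ball hcpt
    ball_subset_closedBall measure_ball_lt_top.ne hfc
  have hDt : gsN p (fderiv ℝ f) μ ≠ ∞ := gsN_ne_top _ (by linarith) _ volume _ _ measurableSet_ball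
    hcpt ball_subset_closedBall measure_ball_lt_top.ne hdc
  have hTt : gsN r f τ ≠ ∞ := gsN_ne_top _ (by linarith) f _ _ _ isClosed_sphere.measurableSet
    hcpt sphere_subset_closedBall hσ hfc
  have hmain : gsN (s * a) f μ ^ s ≤
      C' * (gsN (s * a) f μ ^ (s - 1) * gsN p (fderiv ℝ f) μ + gsN r f τ ^ s) := by
    refine (hP f U hU hBU hf).trans ?_
    rw [hC', mul_assoc]
    refine mul_le_mul_right ?_ _
    have h1 := hH _ _ f (fderiv ℝ f) hfm hdm
    have h2 : ∫⁻ x, ‖f x‖ₑ ^ s ∂τ ≤ K₂ ^ s * gsN r f τ ^ s := by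
      have h3 := ENNReal.rpow_le_rpow (hr' _ f hft) hs0.le
      rw [ENNReal.mul_rpow_of_nonneg _ _ hs0.le, gsN, ← ENNReal.rpow_mul,
        one_div_mul_cancel hs0.ne', ENNReal.rpow_one] at h3
      exact h3
    refine (add_le_add h1 h2).trans ?_
    rw [mul_add]
    refine add_le_add ?_ ?_
    · gcongr; exact le_self_add
    · gcongr; exact le_add_self
  have habs := gs_absorb _ _ _ _ s hs1 hXt hmain
  have hfin : gsN q f μ ≤ K * (gsN p (fderiv ℝ f) μ + gsN r f τ) := by
    refine (hq' _ f hfm).trans ?_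
    rw [hK, mul_assoc]
    gcongr
  have hreal := ENNReal.toReal_mono (ENNReal.mul_ne_top hKt (ENNReal.add_ne_top.2 ⟨hDt, hTt⟩)) hfin
  rw [ENNReal.toReal_mul, ENNReal.toReal_add hDt hTt] at hreal
  rw [inv_mul_le_iff₀ (by positivity)]
  refine hreal.trans ?_
  gcongr
  linarith
end
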